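/- arXiv:1504.00400 — 13 statements merged into one kernel-verified Lean document; each statement's English description precedes it below -/
import Mathlib

section
/- Let H = (u, v, h(u,v)) : ℝ³ → ℝ³ be a polynomial map with H(0) = 0, where h is a polynomial in two variables with no linear part, the three components of H are linearly independent over ℝ, the Jacobian matrix JH is nilpotent at every point, and deg_z(u·A) ≠ deg_z(v·B), where A = vₓ·u_z − uₓ·v_z, B = v_y·u_z − u_y·v_z, and deg_z denotes the degree in the variable z. Then for every real λ ≠ 0 the polynomial map λ·id + H : ℝ³ → ℝ³ is injective and has a polynomial inverse (it is a polynomial automorphism of ℝ³). -/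
open MvPolynomial

namespace MvPolynomial

variable {σ τ : Type*}

theorem pderiv_pderiv_comm (i j : σ) (f : MvPolynomial σ ℝ) :
    pderiv i (pderiv j f) = pderiv j (pderiv i f) := by
  classical
  ext m
  simp only [coeff_pderiv, Finsupp.add_apply, add_right_comm m]
  by_cases h : i = j
  · simp [h]
  · simp only [Finsupp.single_eq_of_ne h, Finsupp.single_eq_of_ne (Ne.symm h)]
    push_cast
    ring

theorem pderiv_aeval_eq_sum [Fintype σ] (g : σ → MvPolynomial τ ℝ) (f : MvPolynomial σ ℝ) (j : τ) :
    pderiv j (aeval g f) = ∑ i, aeval g (pderiv i f) * pderiv j (g i) := by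
  classical
  induction f using MvPolynomial.induction_on with
  | C a => simp [algebraMap_eq]
  | add p q hp hq => simp only [map_add, hp, hq, add_mul, Finset.sum_add_distrib]
  | mul_X p n hp =>
    simp only [map_mul, aeval_X, pderiv_mul, hp, pderiv_X, map_add, add_mul, Finset.sum_add_distrib]
    congr 1
    · rw [Finset.sum_mul]
      exact Finset.sum_congr rfl fun i _ => by ring
    · rw [Finset.sum_eq_single n]
      · simp
      · intro b _ hb
        simp [Pi.single_eq_of_ne (Ne.symm hb)]
      · simp

theorem totalDegree_pderiv_lt {i : σ} {f : MvPolynomial σ ℝ} (h : pderiv i f ≠ 0) :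
    (pderiv i f).totalDegree < f.totalDegree := by
  classical
  obtain ⟨m, hm, hd⟩ := Finset.exists_mem_eq_sup _ (support_nonempty.2 h) fun m => m.sum fun _ e => e
  rw [totalDegree, hd]
  have hm' : m + Finsupp.single i 1 ∈ f.support := by
    rw [mem_support_iff, coeff_pderiv] at hm
    exact mem_support_iff.2 (left_ne_zero_of_mul hm)
  have := le_totalDegree hm'
  rw [Finsupp.sum_add_index' (by simp) (by simp)] at this
  simp at this
  omega

theorem totalDegree_pderiv_le (i : σ) (f : MvPolynomial σ ℝ) :
    (pderiv i f).totalDegree ≤ f.totalDegree := by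
  by_cases h : pderiv i f = 0
  · simp [h]
  · exact (totalDegree_pderiv_lt h).le

theorem pderiv_eq_zero_of_dvd {i : σ} {f : MvPolynomial σ ℝ} (h : f ∣ pderiv i f) :
    pderiv i f = 0 := by
  by_contra h0
  exact (totalDegree_pderiv_lt h0).not_ge (totalDegree_le_of_dvd_of_isDomain h h0)

theorem coeff_eq_zero_of_pderiv_eq_zero {i : σ} {f : MvPolynomial σ ℝ} (h : pderiv i f = 0)
    {m : σ →₀ ℕ} (hm : m i ≠ 0) : coeff m f = 0 := by
  classical
  have := coeff_pderiv f (i := i) (m - Finsupp.single i 1)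
  rw [h, coeff_zero, tsub_add_cancel_of_le (by simpa [Nat.one_le_iff_ne_zero] using hm)] at this
  rcases mul_eq_zero.1 this.symm with h' | h'
  · exact h'
  · exact absurd h' (by positivity)

theorem eq_C_of_forall_pderiv_eq_zero {f : MvPolynomial σ ℝ} (h : ∀ i, pderiv i f = 0) :
    f = C (coeff 0 f) := by
  classical
  ext m
  rw [coeff_C]
  split_ifs with hm
  · rw [← hm]
  · obtain ⟨i, hi⟩ := DFunLike.ne_iff.1 (Ne.symm hm)
    exact coeff_eq_zero_of_pderiv_eq_zero (h i) hi

theorem degreeOf_pderiv_le (i j : σ) (f : MvPolynomial σ ℝ) :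
    degreeOf i (pderiv j f) ≤ degreeOf i f := by
  classical
  rw [degreeOf_le_iff]
  intro m hm
  rw [mem_support_iff, coeff_pderiv] at hm
  have := (degreeOf_le_iff (n := i)).1 le_rfl _ (mem_support_iff.2 (left_ne_zero_of_mul hm))
  simp only [Finsupp.add_apply] at this
  omega

theorem degreeOf_le_degreeOf_pderiv_add_one (i : σ) (f : MvPolynomial σ ℝ) :
    degreeOf i f ≤ degreeOf i (pderiv i f) + 1 := by
  classical
  rw [degreeOf_le_iff]
  intro m hm
  by_cases h : m i = 0
  · omega
  have hm' : m - Finsupp.single i 1 ∈ (pderiv i f).support := by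
    rw [mem_support_iff, coeff_pderiv,
      tsub_add_cancel_of_le (by simpa [Nat.one_le_iff_ne_zero] using h)]
    exact mul_ne_zero (mem_support_iff.1 hm) (by positivity)
  have := (degreeOf_le_iff (n := i)).1 le_rfl _ hm'
  simp at this
  omega

theorem degreeOf_eq_zero_of_pderiv_eq_zero {i : σ} {f : MvPolynomial σ ℝ} (h : pderiv i f = 0) :
    degreeOf i f = 0 := by
  rw [← Nat.le_zero, degreeOf_le_iff]
  intro m hm
  by_contra hm'
  exact mem_support_iff.1 hm (coeff_eq_zero_of_pderiv_eq_zero h (by omega))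

theorem pderiv_eq_zero_of_degreeOf_eq_zero {i : σ} {f : MvPolynomial σ ℝ} (h : degreeOf i f = 0) :
    pderiv i f = 0 := by
  classical
  ext m
  rw [coeff_pderiv, coeff_zero]
  by_contra hc
  have := degreeOf_le_iff.1 h.le _ (mem_support_iff.2 (left_ne_zero_of_mul hc))
  simp at this

end MvPolynomial

theorem Polynomial.natDegree_eq_zero_of_leading_terms {S : Type*} [CommRing S] [IsDomain S]
    [CharZero S] {d : S → S} (hd0 : d 0 = 0) (hd : ∀ a c, d a = c * a → a ≠ 0 → c = 0)
    {u du A E₁ E₂ α : Polynomial S} (hdu : ∀ n, du.coeff n = d (u.coeff n))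
    (hu : u.natDegree ≠ 0) (hA : A ≠ 0)
    (hE₁ : ∀ n, u.natDegree + A.natDegree ≤ n → E₁.coeff n = 0)
    (hE₂ : ∀ n, u.natDegree + A.natDegree ≤ n + 1 → E₂.coeff n = 0)
    (h : A * du + E₁ + α * (A * Polynomial.derivative u + E₂) = 0) : α.natDegree = 0 := by
  by_contra hα
  have hα0 : α ≠ 0 := by rintro rfl; simp at hα
  have hu0 : u ≠ 0 := by rintro rfl; simp at hu
  have hu' : Polynomial.derivative u ≠ 0 := fun h' =>
    hu (Polynomial.derivative_eq_zero.1 h')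
  have hAu0 : A * Polynomial.derivative u ≠ 0 := mul_ne_zero hA hu'
  have hdeg : (A * Polynomial.derivative u).natDegree = A.natDegree + (u.natDegree - 1) := by
    rw [Polynomial.natDegree_mul hA hu', Polynomial.natDegree_derivative]
  have hlt : E₂.degree < (A * Polynomial.derivative u).degree := by
    rw [Polynomial.degree_eq_natDegree hAu0, Polynomial.degree_lt_iff_coeff_zero, hdeg]
    exact fun m hm => hE₂ m (by omega)
  have hMdeg : (A * Polynomial.derivative u + E₂).natDegree = A.natDegree + (u.natDegree - 1) := by
    rw [Polynomial.natDegree_add_eq_left_of_degree_lt hlt, hdeg]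
  have hMlead : (A * Polynomial.derivative u + E₂).leadingCoeff =
      A.leadingCoeff * (u.leadingCoeff * u.natDegree) := by
    rw [Polynomial.leadingCoeff_add_of_degree_lt' hlt, Polynomial.leadingCoeff_mul,
      Polynomial.leadingCoeff_derivative]
  have hdudeg : du.natDegree ≤ u.natDegree :=
    Polynomial.natDegree_le_iff_coeff_eq_zero.2 fun n hn => by
      rw [hdu, Polynomial.coeff_eq_zero_of_natDegree_lt hn, hd0]
  have htop := congrArg (fun p => p.coeff (α.natDegree + (A.natDegree + (u.natDegree - 1)))) h
  simp only [Polynomial.coeff_add _ _ (α.natDegree + (A.natDegree + (u.natDegree - 1))),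
    Polynomial.coeff_zero] at htop
  rw [hE₁ _ (by omega), ← hMdeg, Polynomial.coeff_mul_degree_add_degree, hMlead, hMdeg] at htop
  have hlA := Polynomial.leadingCoeff_ne_zero.2 hA
  have hlu := Polynomial.leadingCoeff_ne_zero.2 hu0
  have hlα := Polynomial.leadingCoeff_ne_zero.2 hα0
  have hm : (u.natDegree : S) ≠ 0 := Nat.cast_ne_zero.2 hu
  by_cases h1 : α.natDegree = 1
  · rw [show α.natDegree + (A.natDegree + (u.natDegree - 1)) = A.natDegree + u.natDegree by omega,
      Polynomial.coeff_mul_add_eq_of_natDegree_le le_rfl hdudeg, hdu] at htop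
    have : d u.leadingCoeff = (-(α.leadingCoeff * u.natDegree)) * u.leadingCoeff := by
      apply mul_left_cancel₀ hlA
      simp only [Polynomial.leadingCoeff] at htop ⊢
      linear_combination htop
    exact mul_ne_zero hlα hm (neg_eq_zero.1 (hd _ _ this hlu))
  · rw [Polynomial.coeff_eq_zero_of_natDegree_lt] at htop
    · have : α.leadingCoeff * (A.leadingCoeff * (u.leadingCoeff * u.natDegree)) ≠ 0 :=
        mul_ne_zero hlα (mul_ne_zero hlA (mul_ne_zero hlu hm))
      exact this (by simpa using htop)
    · refine lt_of_le_of_lt (Polynomial.natDegree_mul_le_of_le le_rfl hdudeg) ?_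
      omega

namespace MvPolynomial

variable {n : ℕ}

/-- View a polynomial in `n + 1` variables as a univariate polynomial in the variable `i`. -/
noncomputable def toUnivariate (i : Fin (n + 1)) :
    MvPolynomial (Fin (n + 1)) ℝ →ₐ[ℝ] Polynomial (MvPolynomial (Fin n) ℝ) :=
  (finSuccEquiv ℝ n : _ →ₐ[ℝ] _).comp (rename (Equiv.swap 0 i))

theorem toUnivariate_apply (i : Fin (n + 1)) (f : MvPolynomial (Fin (n + 1)) ℝ) :
    toUnivariate i f = finSuccEquiv ℝ n (rename (Equiv.swap 0 i) f) := rfl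

theorem natDegree_toUnivariate (i : Fin (n + 1)) (f : MvPolynomial (Fin (n + 1)) ℝ) :
    (toUnivariate i f).natDegree = degreeOf i f := by
  have h := degreeOf_rename_of_injective (p := f) (Equiv.swap 0 i).injective i
  rw [Equiv.swap_apply_right] at h
  rw [toUnivariate_apply, natDegree_finSuccEquiv, h]

theorem toUnivariate_injective (i : Fin (n + 1)) : Function.Injective (toUnivariate i) :=
  (finSuccEquiv ℝ n).injective.comp (rename_injective _ (Equiv.injective _))

theorem toUnivariate_pderiv_self (i : Fin (n + 1)) (f : MvPolynomial (Fin (n + 1)) ℝ) :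
    toUnivariate i (pderiv i f) = Polynomial.derivative (toUnivariate i f) := by
  rw [toUnivariate_apply, ← pderiv_rename (Equiv.injective _), Equiv.swap_apply_right]
  ext k m
  rw [finSuccEquiv_coeff_coeff, coeff_pderiv, Polynomial.coeff_derivative, toUnivariate_apply,
    show ((k : MvPolynomial (Fin n) ℝ) + 1) = C ((k : ℝ) + 1) by simp, mul_comm _ (C _),
    coeff_C_mul, finSuccEquiv_coeff_coeff]
  have : m.cons k + Finsupp.single 0 1 = m.cons (k + 1) := by
    ext j
    refine Fin.cases ?_ (fun j => ?_) j <;> simp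
  simp [this, mul_comm]

theorem degreeOf_pderiv_self (i : Fin (n + 1)) (f : MvPolynomial (Fin (n + 1)) ℝ) :
    degreeOf i (pderiv i f) = degreeOf i f - 1 := by
  rw [← natDegree_toUnivariate, toUnivariate_pderiv_self, Polynomial.natDegree_derivative,
    natDegree_toUnivariate]

theorem exists_coeff_toUnivariate_pderiv {i j : Fin (n + 1)} (hij : j ≠ i) :
    ∃ l : Fin n, ∀ (f : MvPolynomial (Fin (n + 1)) ℝ) (k : ℕ),
      (toUnivariate i (pderiv j f)).coeff k = pderiv l ((toUnivariate i f).coeff k) := by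
  have h0 : Equiv.swap 0 i j ≠ 0 := fun h =>
    hij ((Equiv.swap 0 i).injective (h.trans (Equiv.swap_apply_right 0 i).symm))
  obtain ⟨l, hl⟩ := Fin.exists_succ_eq.2 h0
  refine ⟨l, fun f k => ?_⟩
  rw [toUnivariate_apply, ← pderiv_rename (Equiv.injective _), ← hl]
  ext m
  rw [finSuccEquiv_coeff_coeff, coeff_pderiv, coeff_pderiv, toUnivariate_apply,
    finSuccEquiv_coeff_coeff]
  have : m.cons k + Finsupp.single l.succ 1 = (m + Finsupp.single l 1).cons k := by
    ext j
    refine Fin.cases ?_ (fun j => ?_) j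
    · simp
    · simp [Finsupp.single_apply]
  simp [this]

theorem pderiv_eq_zero_of_leading_terms {i j : Fin (n + 1)} (hij : j ≠ i)
    {u A E₁ E₂ α : MvPolynomial (Fin (n + 1)) ℝ} (hu : pderiv i u ≠ 0) (hA : A ≠ 0)
    (hE₁ : degreeOf i E₁ < degreeOf i u + degreeOf i A)
    (hE₂ : E₂ = 0 ∨ degreeOf i E₂ + 1 < degreeOf i u + degreeOf i A)
    (h : A * pderiv j u + E₁ + α * (A * pderiv i u + E₂) = 0) : pderiv i α = 0 := by
  obtain ⟨l, hl⟩ := exists_coeff_toUnivariate_pderiv hij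
  apply pderiv_eq_zero_of_degreeOf_eq_zero
  rw [← natDegree_toUnivariate]
  refine Polynomial.natDegree_eq_zero_of_leading_terms (d := pderiv l) (map_zero _)
    (fun a c hac ha => ?_) (u := toUnivariate i u) (hl u) ?_ (A := toUnivariate i A) ?_
    (E₁ := toUnivariate i E₁) ?_ (E₂ := toUnivariate i E₂) ?_ ?_
  · have := pderiv_eq_zero_of_dvd (Dvd.intro_left c hac.symm)
    exact (mul_eq_zero.1 (hac.symm.trans this)).resolve_right ha
  · rw [natDegree_toUnivariate]
    exact fun h0 => hu (pderiv_eq_zero_of_degreeOf_eq_zero h0)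
  · exact (map_ne_zero_iff _ (toUnivariate_injective i)).2 hA
  · intro k hk
    apply Polynomial.coeff_eq_zero_of_natDegree_lt
    simp only [natDegree_toUnivariate] at hk ⊢
    omega
  · intro k hk
    rcases hE₂ with rfl | hE₂
    · simp
    apply Polynomial.coeff_eq_zero_of_natDegree_lt
    simp only [natDegree_toUnivariate] at hk ⊢
    omega
  · rw [← toUnivariate_pderiv_self, ← map_mul, ← map_mul, ← map_add, ← map_add, ← map_mul,
      ← map_add, h, map_zero]

theorem exists_isRelPrime_pderiv_of_burgers {g ε : MvPolynomial (Fin 2) ℝ} (hg : pderiv 1 g ≠ 0)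
    (h : pderiv 0 (pderiv 0 g) * pderiv 1 g ^ 2
      - 2 * pderiv 0 g * pderiv 1 g * pderiv 1 (pderiv 0 g)
      + pderiv 0 g ^ 2 * pderiv 1 (pderiv 1 g) = ε * pderiv 1 g ^ 3) :
    ∃ κ P Q : MvPolynomial (Fin 2) ℝ, κ ≠ 0 ∧ Q ≠ 0 ∧ pderiv 0 g = κ * P ∧ pderiv 1 g = κ * Q ∧
      IsRelPrime P Q ∧ pderiv 1 Q = 0 ∧
      pderiv 0 P * Q - P * pderiv 0 Q - P * pderiv 1 P = ε * Q ^ 2 := by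
  obtain ⟨Q, P, κ, hrel, hQ, hP⟩ :=
    UniqueFactorizationMonoid.exists_reduced_factors (pderiv 1 g) hg (pderiv 0 g)
  have hκ : κ ≠ 0 := by rintro rfl; simp at hQ; exact hg hQ.symm
  have hQ0 : Q ≠ 0 := by rintro rfl; simp at hQ; exact hg hQ.symm
  have hcomm := pderiv_pderiv_comm 0 1 g
  rw [← hP, ← hQ] at h hcomm
  simp only [pderiv_mul] at h hcomm
  have key : Q * (pderiv 0 P * Q - P * pderiv 0 Q) - P * (pderiv 1 P * Q - P * pderiv 1 Q)
      = ε * Q ^ 3 := by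
    apply mul_left_cancel₀ (pow_ne_zero 3 hκ)
    linear_combination h - κ ^ 2 * P * Q * hcomm
  have hdvd : Q ∣ P ^ 2 * pderiv 1 Q :=
    ⟨ε * Q ^ 2 - (pderiv 0 P * Q - P * pderiv 0 Q) + P * pderiv 1 P, by
      linear_combination key⟩
  have hQ1 : pderiv 1 Q = 0 :=
    pderiv_eq_zero_of_dvd ((hrel.pow_right).dvd_of_dvd_mul_left hdvd)
  refine ⟨κ, P, Q, hκ, hQ0, hP.symm, hQ.symm, hrel.symm, hQ1, ?_⟩
  rw [hQ1] at key
  apply mul_left_cancel₀ hQ0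
  linear_combination key

theorem eq_zero_of_weight {P Q : MvPolynomial (Fin 2) ℝ} {k : ℝ} (hk : k ≠ 0)
    (hP0 : pderiv 0 P = 0) (hP1 : pderiv 1 P = C k) (hQ0 : pderiv 0 Q = -C k)
    (hQ1 : pderiv 1 Q = 0) (m : ℕ) (hm : m ≠ 0) (w : MvPolynomial (Fin 2) ℝ)
    (hw : Q * pderiv 0 w - P * pderiv 1 w = C (m * k) * w) : w = 0 := by
  induction hN : w.totalDegree using Nat.strong_induction_on generalizing w m with
  | _ N ih =>
    subst hN
    have hcomm := pderiv_pderiv_comm 0 1 w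
    have h0 : pderiv 0 w = 0 := by
      by_contra hne
      refine hne (ih _ (totalDegree_pderiv_lt hne) (m + 1) (by omega) _ ?_ rfl)
      have := congrArg (pderiv 0) hw
      simp only [map_sub, pderiv_mul, pderiv_C, hP0, hQ0] at this
      simp only [Nat.cast_add, Nat.cast_one, add_mul, one_mul, C_add]
      linear_combination this + P * hcomm
    have h1 : pderiv 1 w = 0 := by
      by_contra hne
      refine hne (ih _ (totalDegree_pderiv_lt hne) (m + 1) (by omega) _ ?_ rfl)
      have := congrArg (pderiv 1) hw
      simp only [map_sub, pderiv_mul, pderiv_C, hP1, hQ1] at this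
      simp only [Nat.cast_add, Nat.cast_one, add_mul, one_mul, C_add]
      linear_combination this + Q * hcomm
    rw [h0, h1] at hw
    simpa [hk, hm] using hw

theorem exists_pderiv_zero_eq_smul_of_burgers {g : MvPolynomial (Fin 2) ℝ} (hg : pderiv 1 g ≠ 0)
    (h : pderiv 0 (pderiv 0 g) * pderiv 1 g ^ 2
      - 2 * pderiv 0 g * pderiv 1 g * pderiv 1 (pderiv 0 g)
      + pderiv 0 g ^ 2 * pderiv 1 (pderiv 1 g) = 0) :
    ∃ ρ : ℝ, pderiv 0 g = C ρ * pderiv 1 g := by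
  obtain ⟨κ, P, Q, hκ, hQ, hgP, hgQ, hrel, hQ1, hE⟩ :=
    exists_isRelPrime_pderiv_of_burgers (ε := 0) hg (by simpa using h)
  rcases eq_or_ne P 0 with rfl | hP
  · exact ⟨0, by simp [hgP]⟩
  have hP0 : pderiv 0 P = 0 := by
    refine pderiv_eq_zero_of_dvd (hrel.dvd_of_dvd_mul_right (z := Q) ?_)
    exact ⟨pderiv 0 Q + pderiv 1 P, by linear_combination hE⟩
  have hQ0 : pderiv 0 Q = - pderiv 1 P := by
    apply mul_left_cancel₀ hP
    rw [hP0] at hE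
    linear_combination -hE
  have hP1 : pderiv 1 P = C (coeff 0 (pderiv 1 P)) := by
    apply eq_C_of_forall_pderiv_eq_zero
    intro i
    fin_cases i
    · simp [pderiv_pderiv_comm 0 1 P, hP0]
    · have := pderiv_pderiv_comm 0 1 Q
      rw [hQ1, hQ0] at this
      simpa using this
  generalize coeff 0 (pderiv 1 P) = k at hP1
  rw [hP1] at hQ0
  by_cases hk : k = 0
  · subst hk
    have hPc := eq_C_of_forall_pderiv_eq_zero (f := P) (by
      intro i; fin_cases i <;> simp [hP0, hP1])
    have hQc := eq_C_of_forall_pderiv_eq_zero (f := Q) (by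
      intro i; fin_cases i <;> simp [hQ0, hQ1])
    generalize coeff 0 P = p at hPc
    generalize coeff 0 Q = q at hQc
    subst hPc hQc
    have hq : q ≠ 0 := by simpa using hQ
    refine ⟨p / q, ?_⟩
    rw [hgP, hgQ, mul_left_comm, ← C_mul, div_mul_cancel₀ p hq]
  · exfalso
    refine hg (eq_zero_of_weight hk hP0 hP1 hQ0 hQ1 1 one_ne_zero _ ?_)
    have h0 : Q * pderiv 0 g - P * pderiv 1 g = 0 := by rw [hgP, hgQ]; ring
    have := congrArg (pderiv 1) h0
    simp only [map_sub, pderiv_mul, map_zero, hP1, hQ1] at this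
    simp only [Nat.cast_one, one_mul]
    linear_combination this + Q * pderiv_pderiv_comm 0 1 g

theorem exists_linear_relation_of_hessian_eq_zero {h : MvPolynomial (Fin 2) ℝ}
    (hess : pderiv 0 (pderiv 0 h) * pderiv 1 (pderiv 1 h) = pderiv 1 (pderiv 0 h) ^ 2) :
    ∃ p q : ℝ, (p ≠ 0 ∨ q ≠ 0) ∧ ∀ i, C q * pderiv i (pderiv 0 h) = C p * pderiv i (pderiv 1 h) := by
  have hcomm := pderiv_pderiv_comm 0 1 h
  by_cases h11 : pderiv 1 (pderiv 1 h) = 0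
  · refine ⟨1, 0, Or.inl one_ne_zero, fun i => ?_⟩
    have h10 : pderiv 1 (pderiv 0 h) = 0 := by
      rw [h11, mul_zero] at hess
      exact pow_eq_zero_iff two_ne_zero |>.1 hess.symm
    fin_cases i <;> simp [hcomm, h10, h11]
  · obtain ⟨ρ, hρ⟩ := exists_pderiv_zero_eq_smul_of_burgers (g := pderiv 1 h) h11 (by
      have h1 := congrArg (pderiv 1) hess
      rw [← hcomm] at h1 hess
      simp only [pderiv_mul, pow_two] at h1
      rw [pderiv_pderiv_comm 1 0 (pderiv 0 h), ← hcomm] at h1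
      apply mul_left_cancel₀ h11
      linear_combination pderiv 1 (pderiv 1 h) ^ 2 * h1 - 
        pderiv 1 (pderiv 1 h) * pderiv 1 (pderiv 1 (pderiv 1 h)) * hess)
    refine ⟨ρ, 1, Or.inr one_ne_zero, fun i => ?_⟩
    rw [C_1, one_mul]
    rw [← hcomm] at hess
    fin_cases i
    · apply mul_right_cancel₀ h11
      simp only [Fin.zero_eta]
      rw [hess, hρ]
      ring
    · simp only [Fin.mk_one]
      rw [← hcomm, hρ]

theorem pderiv_eq_zero_of_burgers_reduced {P Q ε : MvPolynomial (Fin 2) ℝ} (hQ : Q ≠ 0)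
    (hQ1 : pderiv 1 Q = 0)
    (hE : pderiv 0 P * Q - P * pderiv 0 Q - P * pderiv 1 P = ε * Q ^ 2)
    (hε : pderiv 0 ε * Q = pderiv 1 ε * P) (i : Fin 2) : pderiv i ε = 0 := by
  have h1 : pderiv 1 ε = 0 := by
    by_contra hne
    have hdeg : degreeOf 1 P ≤ 1 := by
      rcases eq_or_ne P 0 with rfl | hP
      · simp
      have h0 : pderiv 0 ε ≠ 0 := by
        intro h0
        rw [h0, zero_mul] at hε
        exact mul_ne_zero hne hP hε.symm
      have hd := congrArg (degreeOf 1) hε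
      rw [degreeOf_mul_eq h0 hQ, degreeOf_mul_eq hne hP,
        degreeOf_eq_zero_of_pderiv_eq_zero hQ1] at hd
      have := degreeOf_pderiv_le 1 0 ε
      have := degreeOf_le_degreeOf_pderiv_add_one 1 ε
      omega
    have hP11 : pderiv 1 (pderiv 1 P) = 0 := by
      apply pderiv_eq_zero_of_degreeOf_eq_zero
      rw [degreeOf_pderiv_self]
      omega
    have hQ01 : pderiv 1 (pderiv 0 Q) = 0 := by rw [pderiv_pderiv_comm, hQ1, map_zero]
    have hE1 := congrArg (pderiv 1) hE
    simp only [map_sub, pderiv_mul, pow_two, hQ1, hQ01, hP11] at hE1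
    rw [pderiv_pderiv_comm 1 0 P] at hE1
    have hP011 : pderiv 1 (pderiv 0 (pderiv 1 P)) = 0 := by
      rw [pderiv_pderiv_comm, hP11, map_zero]
    have hε11 : pderiv 1 (pderiv 1 ε) = 0 := by
      have := congrArg (pderiv 1) hE1
      simp only [map_sub, map_add, pderiv_mul, hQ1, hQ01, hP11, hP011, map_zero] at this
      have h' : pderiv 1 (pderiv 1 ε) * Q ^ 2 = 0 := by linear_combination -this
      exact (mul_eq_zero.1 h').resolve_right (pow_ne_zero 2 hQ)
    have hε1 := congrArg (pderiv 1) hε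
    simp only [pderiv_mul, hQ1, hε11] at hε1
    rw [pderiv_pderiv_comm 1 0 ε] at hε1
    set e := pderiv 1 ε
    have hε2 := congrArg (pderiv 0) hε1
    simp only [pderiv_mul, zero_mul, mul_zero, add_zero, zero_add] at hε2
    have key : e ^ 3 = e * pderiv 0 (pderiv 0 e) - 2 * pderiv 0 e ^ 2 := by
      apply mul_right_cancel₀ (pow_ne_zero 2 hQ)
      linear_combination (-e ^ 2) * hE1 - e * Q * hε2 + 
        (2 * pderiv 0 e * Q + e * pderiv 1 P + e * pderiv 0 Q) * hε1
    have hdeg3 := congrArg totalDegree key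
    have hle : (e * pderiv 0 (pderiv 0 e) - 2 * pderiv 0 e ^ 2).totalDegree
        ≤ 2 * e.totalDegree := by
      have h1 := totalDegree_pderiv_le 0 e
      have h2 := totalDegree_pderiv_le 0 (pderiv 0 e)
      refine (totalDegree_sub _ _).trans (max_le ?_ ?_)
      · exact (totalDegree_mul _ _).trans (by omega)
      · have h2' : (2 : MvPolynomial (Fin 2) ℝ).totalDegree = 0 := totalDegree_C (2 : ℝ)
        have := totalDegree_mul 2 (pderiv 0 e ^ 2)
        have := totalDegree_pow (pderiv 0 e) 2
        omega
    rw [pow_succ, pow_two, totalDegree_mul_of_isDomain (mul_ne_zero hne hne) hne,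
      totalDegree_mul_of_isDomain hne hne] at hdeg3
    have he : pderiv 0 e = 0 := by
      by_contra h0
      have := totalDegree_pderiv_lt h0
      omega
    rw [he] at key
    exact pow_ne_zero 3 hne (by simpa using key)
  have h0 : pderiv 0 ε = 0 := by
    rw [h1, zero_mul] at hε
    exact (mul_eq_zero.1 hε).resolve_right hQ
  fin_cases i
  · exact h0
  · exact h1

/-- The substitution `(x, y) ↦ (x, y + a x² + r x)`. -/
noncomputable def quadShear (a r : ℝ) : MvPolynomial (Fin 2) ℝ →ₐ[ℝ] MvPolynomial (Fin 2) ℝ :=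
  aeval ![X 0, X 1 + (C a * X 0 ^ 2 + C r * X 0)]

theorem quadShear_neg_apply (a r : ℝ) (f : MvPolynomial (Fin 2) ℝ) :
    quadShear a r (quadShear (-a) (-r) f) = f := by
  have : (quadShear a r).comp (quadShear (-a) (-r)) = AlgHom.id ℝ _ := by
    ext i
    fin_cases i
    · simp [quadShear]
    · simp [quadShear]
      ring
  exact DFunLike.congr_fun this f

theorem quadShear_injective (a r : ℝ) : Function.Injective (quadShear a r) := by
  have h := quadShear_neg_apply (-a) (-r)
  rw [neg_neg, neg_neg] at h
  exact Function.LeftInverse.injective h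

theorem pderiv_zero_quadShear (a r : ℝ) (f : MvPolynomial (Fin 2) ℝ) :
    pderiv 0 (quadShear a r f) =
      quadShear a r (pderiv 0 f + (C (2 * a) * X 0 + C r) * pderiv 1 f) := by
  have hX : quadShear a r (X 0) = X 0 := by simp [quadShear]
  have hC (b : ℝ) : quadShear a r (C b) = C b := by simp [quadShear]
  rw [map_add, map_mul, map_add, map_mul, hX, hC, hC]
  rw [quadShear, pderiv_aeval_eq_sum, Fin.sum_univ_two]
  simp only [map_add, pderiv_mul, pderiv_pow, pderiv_X_self, pderiv_C, C_mul, Matrix.cons_val_zero,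
    Matrix.cons_val_one, pderiv_X_of_ne (by decide : (1 : Fin 2) ≠ 0)]
  rw [show (C 2 : MvPolynomial (Fin 2) ℝ) = 2 from map_ofNat C 2]
  push_cast
  ring

theorem pderiv_one_quadShear (a r : ℝ) (f : MvPolynomial (Fin 2) ℝ) :
    pderiv 1 (quadShear a r f) = quadShear a r (pderiv 1 f) := by
  rw [quadShear, pderiv_aeval_eq_sum, Fin.sum_univ_two]
  simp

theorem eval_quadShear (a r : ℝ) (f : MvPolynomial (Fin 2) ℝ) (x y : ℝ) :
    eval ![x, y] (quadShear a r f) = eval ![x, y + (a * x ^ 2 + r * x)] f := by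
  rw [quadShear, ← aeval_eq_eval, ← aeval_eq_eval, ← AlgHom.comp_apply, comp_aeval]
  congr 2
  ext i
  fin_cases i <;> simp

theorem eval_eq_of_pderiv_eq_zero {σ : Type*} [Fintype σ] {f : MvPolynomial σ ℝ} {p q : σ → ℝ}
    (h : ∀ i, pderiv i f = 0 ∨ p i = q i) : eval p f = eval q f := by
  rw [eval_eq', eval_eq']
  refine Finset.sum_congr rfl fun m hm => ?_
  congr 1
  refine Finset.prod_congr rfl fun i _ => ?_
  rcases h i with h | h
  · rw [not_imp_comm.1 (coeff_eq_zero_of_pderiv_eq_zero (m := m) h) (mem_support_iff.1 hm),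
      pow_zero, pow_zero]
  · rw [h]

theorem pderiv_zero_eq_affine_mul {b : ℝ} {u c α ε : MvPolynomial (Fin 2) ℝ}
    (hu : pderiv 1 u ≠ 0) (hc : pderiv 1 c = -pderiv 0 u)
    (hα : pderiv 1 u * (pderiv 0 c + C b * α) = -pderiv 0 u ^ 2)
    (hε : C b * pderiv 1 α = ε * pderiv 1 u)
    (hε' : pderiv 0 ε * pderiv 1 u = pderiv 1 ε * pderiv 0 u) :
    ∃ e ρ : ℝ, ε = C e ∧ pderiv 0 u = (C e * X 0 + C ρ) * pderiv 1 u := by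
  have hB : pderiv 0 (pderiv 0 u) * pderiv 1 u ^ 2
      - 2 * pderiv 0 u * pderiv 1 u * pderiv 1 (pderiv 0 u)
      + pderiv 0 u ^ 2 * pderiv 1 (pderiv 1 u) = ε * pderiv 1 u ^ 3 := by
    have h1 := congrArg (pderiv 1) hα
    have h2 := congrArg (pderiv 0) hc
    rw [pderiv_pderiv_comm] at h2
    simp only [pderiv_mul, map_add, map_neg, pow_two, pderiv_C, zero_mul, zero_add, h2, hε] at h1
    linear_combination (-pderiv 1 u) * h1 + pderiv 1 (pderiv 1 u) * hα
  obtain ⟨κ, P, Q, hκ, hQ, hP', hQ', -, hQ1, hE⟩ := exists_isRelPrime_pderiv_of_burgers hu hB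
  have hεd := pderiv_eq_zero_of_burgers_reduced hQ hQ1 hE (by
    rw [hP', hQ'] at hε'
    apply mul_left_cancel₀ hκ
    linear_combination hε')
  have hεC := eq_C_of_forall_pderiv_eq_zero hεd
  generalize coeff 0 ε = e at hεC
  subst hεC
  obtain ⟨ρ, hρ⟩ := exists_pderiv_zero_eq_smul_of_burgers (g := quadShear (-e / 2) 0 u) (by
      rw [pderiv_one_quadShear]
      exact (map_ne_zero_iff _ (quadShear_injective _ _)).2 hu) (by
      simp only [pderiv_one_quadShear, pderiv_zero_quadShear]
      have h2 : (2 : MvPolynomial (Fin 2) ℝ) = quadShear (-e / 2) 0 2 := (map_ofNat _ 2).symm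
      rw [h2]
      simp only [← map_mul (quadShear (-e / 2) 0), ← map_sub (quadShear (-e / 2) 0),
        ← map_add (quadShear (-e / 2) 0), ← map_pow (quadShear (-e / 2) 0)]
      rw [map_eq_zero_iff _ (quadShear_injective _ _)]
      have : (2 * (-e / 2)) = -e := by ring
      simp only [this, map_add, pderiv_mul, pderiv_C, pderiv_X_self, map_neg, map_zero]
      rw [pderiv_X_of_ne (by decide : (0 : Fin 2) ≠ 1)]
      have hcomm := pderiv_pderiv_comm 0 1 u
      linear_combination hB - C e * X 0 * pderiv 1 u ^ 2 * hcomm)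
  refine ⟨e, ρ, rfl, ?_⟩
  have hC : (C ρ : MvPolynomial (Fin 2) ℝ) = quadShear (-e / 2) 0 (C ρ) := by simp [quadShear]
  rw [pderiv_one_quadShear, pderiv_zero_quadShear, hC, ← map_mul] at hρ
  have := quadShear_injective _ _ hρ
  have h2 : (2 * (-e / 2)) = -e := by ring
  rw [h2, C_neg, C_0] at this
  linear_combination this

/-- A polynomial satisfying `u_x = (e x + ρ) u_y` depends on `y + ρ x + e x² / 2` only. -/
theorem eval_eq_of_pderiv_zero_eq_affine_mul {e ρ : ℝ} {u : MvPolynomial (Fin 2) ℝ}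
    (hu : pderiv 0 u = (C e * X 0 + C ρ) * pderiv 1 u) (x y : ℝ) :
    eval ![x, y] u = eval ![0, y + ρ * x + e / 2 * x ^ 2] u := by
  have h0 : pderiv 0 (quadShear (-(e / 2)) (-ρ) u) = 0 := by
    rw [pderiv_zero_quadShear, hu, map_eq_zero_iff _ (quadShear_injective _ _),
      show 2 * -(e / 2) = -e by ring, C_neg, C_neg]
    ring
  have h1 (x y : ℝ) : eval ![x, y] u =
      eval ![x, y + (e / 2 * x ^ 2 + ρ * x)] (quadShear (-(e / 2)) (-ρ) u) := by
    rw [← eval_quadShear, quadShear_neg_apply]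
  rw [h1, h1]
  apply eval_eq_of_pderiv_eq_zero
  intro i
  fin_cases i
  · exact Or.inl h0
  · right
    simp
    ring

theorem pderiv_aeval_pair {σ : Type*} (u v : MvPolynomial σ ℝ) (f : MvPolynomial (Fin 2) ℝ) (j : σ) :
    pderiv j (aeval ![u, v] f) =
      aeval ![u, v] (pderiv 0 f) * pderiv j u + aeval ![u, v] (pderiv 1 f) * pderiv j v := by
  rw [pderiv_aeval_eq_sum, Fin.sum_univ_two]
  rfl

theorem eq_zero_of_aeval_pair_eq_zero {σ : Type*} {u v : MvPolynomial σ ℝ} {i j : σ}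
    (hJ : pderiv i u * pderiv j v - pderiv j u * pderiv i v ≠ 0) (f : MvPolynomial (Fin 2) ℝ)
    (hf : aeval ![u, v] f = 0) : f = 0 := by
  induction hN : f.totalDegree using Nat.strong_induction_on generalizing f with
  | _ N ih =>
    subst hN
    have hi := congrArg (pderiv i) hf
    have hj := congrArg (pderiv j) hf
    rw [pderiv_aeval_pair, map_zero] at hi hj
    have h0 : pderiv 0 f = 0 := by
      by_contra hne
      refine hne (ih _ (totalDegree_pderiv_lt hne) _ ?_ rfl)
      refine (mul_eq_zero.1 (?_ : _ * (pderiv i u * pderiv j v - pderiv j u * pderiv i v) = 0)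
        ).resolve_right hJ
      linear_combination pderiv j v * hi - pderiv i v * hj
    have h1 : pderiv 1 f = 0 := by
      by_contra hne
      refine hne (ih _ (totalDegree_pderiv_lt hne) _ ?_ rfl)
      refine (mul_eq_zero.1 (?_ : _ * (pderiv i u * pderiv j v - pderiv j u * pderiv i v) = 0)
        ).resolve_right hJ
      linear_combination pderiv i u * hj - pderiv j u * hi
    have hC := eq_C_of_forall_pderiv_eq_zero (f := f) (by intro k; fin_cases k <;> assumption)
    rw [hC] at hf ⊢
    simpa using hf

theorem exists_rename_castSucc_eq {n : ℕ} {f : MvPolynomial (Fin (n + 1)) ℝ}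
    (h : pderiv (Fin.last n) f = 0) : ∃ g : MvPolynomial (Fin n) ℝ, rename Fin.castSucc g = f := by
  refine exists_rename_eq_of_vars_subset_range f _ (Fin.castSucc_injective n) fun i hi => ?_
  obtain ⟨d, hd, hid⟩ := (mem_vars_iff_mem_support i).1 hi
  refine Fin.exists_castSucc_eq.2 ?_
  rintro rfl
  exact mem_support_iff.1 hd (coeff_eq_zero_of_pderiv_eq_zero h (Finsupp.mem_support_iff.1 hid))

theorem eq_zero_of_forall_pderiv_eq_zero {σ : Type*} {f : MvPolynomial σ ℝ}
    (h : ∀ i, pderiv i f = 0) (h0 : eval 0 f = 0) : f = 0 := by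
  have hC := eq_C_of_forall_pderiv_eq_zero h
  rw [hC] at h0 ⊢
  simpa using h0

theorem eval_aeval_zero_X (f : MvPolynomial (Fin 2) ℝ) (t : ℝ) :
    Polynomial.eval t (aeval ![0, Polynomial.X] f) = eval ![0, t] f := by
  induction f using MvPolynomial.induction_on with
  | C a => simp
  | add p q hp hq => rw [map_add, map_add, Polynomial.eval_add, hp, hq]
  | mul_X p n hp =>
    rw [map_mul, map_mul, Polynomial.eval_mul, hp]
    fin_cases n <;> simp

theorem exists_structure_of_pderiv_two_eq_zero {u v : MvPolynomial (Fin 3) ℝ}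
    {h : MvPolynomial (Fin 2) ℝ} (huz : pderiv 2 u = 0) (hvz : pderiv 2 v ≠ 0)
    (hu : pderiv 0 u ≠ 0 ∨ pderiv 1 u ≠ 0)
    (htr : pderiv 0 u + pderiv 1 v + aeval ![u, v] (pderiv 1 h) * pderiv 2 v = 0)
    (hdet : pderiv 0 u ^ 2 +
      pderiv 1 u * (pderiv 0 v + aeval ![u, v] (pderiv 0 h) * pderiv 2 v) = 0)
    (hu0 : eval 0 u = 0) (hv0 : eval 0 v = 0) (hne : h ≠ 0) (h0 : eval 0 h = 0)
    (h00 : eval 0 (pderiv 0 h) = 0) (h01 : eval 0 (pderiv 1 h) = 0) :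
    ∃ (b ρ k : ℝ) (g : Polynomial ℝ), b ≠ 0 ∧ ∀ p : Fin 3 → ℝ,
      eval p u = g.eval (p 1 + ρ * p 0 + k * b * p 0 ^ 2) ∧
      eval p v = b * p 2 - (2 * k * b * p 0 + ρ) * eval p u ∧
      eval p (aeval ![u, v] h) = k * eval p u ^ 2 := by
  have hindep (f : MvPolynomial (Fin 2) ℝ) (hf : aeval ![u, v] f = 0) : f = 0 := by
    rcases hu with hu | hu
    · refine eq_zero_of_aeval_pair_eq_zero (i := 0) (j := 2) ?_ f hf
      rw [huz, zero_mul, sub_zero]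
      exact mul_ne_zero hu hvz
    · refine eq_zero_of_aeval_pair_eq_zero (i := 1) (j := 2) ?_ f hf
      rw [huz, zero_mul, sub_zero]
      exact mul_ne_zero hu hvz
  have huxz : pderiv 2 (pderiv 0 u) = 0 := by rw [pderiv_pderiv_comm, huz, map_zero]
  have huyz : pderiv 2 (pderiv 1 u) = 0 := by rw [pderiv_pderiv_comm, huz, map_zero]
  have hz (j : Fin 3) (hj : j ≠ 2) (α : MvPolynomial (Fin 3) ℝ)
      (hα : pderiv 2 (pderiv j v + α * pderiv 2 v) = 0) : pderiv 2 α = 0 := by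
    refine pderiv_eq_zero_of_leading_terms (n := 2) (u := v) (A := 1)
      (E₁ := -(pderiv j v + α * pderiv 2 v)) (E₂ := 0) hj hvz one_ne_zero ?_ (Or.inl rfl) (by ring)
    rw [degreeOf_eq_zero_of_pderiv_eq_zero (by rw [map_neg, hα, neg_zero])]
    have : degreeOf 2 v ≠ 0 := fun h => hvz (pderiv_eq_zero_of_degreeOf_eq_zero h)
    omega
  -- the last variable disappears from the partial derivatives of `h`
  have hβz : pderiv 2 (aeval ![u, v] (pderiv 1 h)) = 0 := by
    refine hz 1 (by decide) _ ?_
    rw [show pderiv 1 v + aeval ![u, v] (pderiv 1 h) * pderiv 2 v = -pderiv 0 u by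
      linear_combination htr, map_neg, huxz, neg_zero]
  have h11 : pderiv 1 (pderiv 1 h) = 0 := by
    rw [pderiv_aeval_pair, huz, mul_zero, zero_add] at hβz
    exact hindep _ ((mul_eq_zero.1 hβz).resolve_right hvz)
  have huy : pderiv 1 u ≠ 0 := by
    intro h1
    rw [h1, zero_mul, add_zero] at hdet
    have := pow_eq_zero_iff two_ne_zero |>.1 hdet
    tauto
  have hRz : pderiv 2 (pderiv 0 v + aeval ![u, v] (pderiv 0 h) * pderiv 2 v) = 0 := by
    have := congrArg (pderiv 2) hdet
    rw [map_add, pderiv_mul, huyz, pow_two, pderiv_mul, huxz] at this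
    simpa [huy] using this
  have hαz := hz 0 (by decide) _ hRz
  have h10 : pderiv 1 (pderiv 0 h) = 0 := by
    rw [pderiv_aeval_pair, huz, mul_zero, zero_add] at hαz
    exact hindep _ ((mul_eq_zero.1 hαz).resolve_right hvz)
  have h1 : pderiv 1 h = 0 := by
    refine eq_zero_of_forall_pderiv_eq_zero (fun i => ?_) h01
    fin_cases i
    · exact (pderiv_pderiv_comm _ _ _).trans h10
    · exact h11
  rw [h1, map_zero, zero_mul, add_zero] at htr
  have hvy : pderiv 1 v = -pderiv 0 u := by linear_combination htr
  have hvyz : pderiv 1 (pderiv 2 v) = 0 := by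
    rw [pderiv_pderiv_comm, hvy, map_neg, huxz, neg_zero]
  have h00ne : pderiv 0 (pderiv 0 h) ≠ 0 := by
    intro h2
    have h3 : pderiv 0 h = 0 := by
      refine eq_zero_of_forall_pderiv_eq_zero (fun i => ?_) h00
      fin_cases i <;> assumption
    refine hne (eq_zero_of_forall_pderiv_eq_zero (fun i => ?_) h0)
    fin_cases i <;> assumption
  have hαy : pderiv 1 (aeval ![u, v] (pderiv 0 h)) =
      aeval ![u, v] (pderiv 0 (pderiv 0 h)) * pderiv 1 u := by
    rw [pderiv_aeval_pair, h10, map_zero, zero_mul, add_zero]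
  have hR2 : pderiv 2 (pderiv 0 v) + aeval ![u, v] (pderiv 0 h) * pderiv 2 (pderiv 2 v) = 0 := by
    rw [map_add, pderiv_mul, hαz, zero_mul, zero_add] at hRz
    exact hRz
  have hvzz : pderiv 2 (pderiv 2 v) = 0 := by
    have h2 := congrArg (pderiv 1) hR2
    have h3 : pderiv 1 (pderiv 2 (pderiv 0 v)) = 0 := by
      rw [pderiv_pderiv_comm 2 0, pderiv_pderiv_comm 1 0, hvyz, map_zero]
    have h4 : pderiv 1 (pderiv 2 (pderiv 2 v)) = 0 := by
      rw [pderiv_pderiv_comm 1 2, hvyz, map_zero]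
    rw [map_add, pderiv_mul, h3, h4, map_zero, mul_zero, add_zero, zero_add, hαy] at h2
    exact (mul_eq_zero.1 h2).resolve_left
      (mul_ne_zero (fun h => h00ne (hindep _ h)) huy)
  have hvxz : pderiv 0 (pderiv 2 v) = 0 := by
    rw [hvzz, mul_zero, add_zero] at hR2
    rw [pderiv_pderiv_comm, hR2]
  obtain ⟨b, hb⟩ : ∃ b, pderiv 2 v = C b := ⟨_, eq_C_of_forall_pderiv_eq_zero (by
    intro i; fin_cases i <;> assumption)⟩
  have hb0 : b ≠ 0 := by rintro rfl; exact hvz (by simp [hb])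
  -- descent to two variables
  have hren (i : Fin 2) (f : MvPolynomial (Fin 2) ℝ) :
      pderiv i.castSucc (rename Fin.castSucc f) = rename Fin.castSucc (pderiv i f) :=
    pderiv_rename (Fin.castSucc_injective 2) i f
  have hren0 := hren 0
  have hren1 := hren 1
  rw [Fin.castSucc_zero] at hren0
  rw [Fin.castSucc_one] at hren1
  have hinj := rename_injective (R := ℝ) _ (Fin.castSucc_injective 2)
  obtain ⟨u', hu'⟩ := exists_rename_castSucc_eq (n := 2) huz
  obtain ⟨c, hc⟩ := exists_rename_castSucc_eq (n := 2) (f := v - C b * X 2) (by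
    change pderiv 2 _ = 0
    simp [hb])
  have hv : v = rename Fin.castSucc c + C b * X 2 := by rw [hc]; ring
  have hvx : pderiv 0 v = rename Fin.castSucc (pderiv 0 c) := by
    rw [hv, map_add, hren0]
    simp
  have hvy' : pderiv 1 v = rename Fin.castSucc (pderiv 1 c) := by
    rw [hv, map_add, hren1]
    simp
  obtain ⟨α, hα⟩ := exists_rename_castSucc_eq (n := 2) hαz
  have h100 : pderiv 1 (pderiv 0 (pderiv 0 h)) = 0 := by rw [pderiv_pderiv_comm, h10, map_zero]
  obtain ⟨ε, hε⟩ := exists_rename_castSucc_eq (n := 2)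
    (f := aeval ![u, v] (pderiv 0 (pderiv 0 h))) (by
      change pderiv 2 _ = 0
      rw [pderiv_aeval_pair, huz, h100, map_zero, mul_zero, zero_mul, add_zero])
  have hcy : pderiv 1 c = -pderiv 0 u' := by
    apply hinj
    rw [← hvy', hvy, map_neg, ← hren0, hu']
  have hdet' : pderiv 1 u' * (pderiv 0 c + C b * α) = -pderiv 0 u' ^ 2 := by
    apply hinj
    simp only [map_mul, map_add, map_neg, map_pow, ← hren0, ← hren1, hu', hα, rename_C]
    rw [hren0, ← hvx]
    rw [hb] at hdet
    linear_combination hdet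
  obtain ⟨e, ρ, he, hu'x⟩ := pderiv_zero_eq_affine_mul (b := b) (ε := C b * ε)
    (fun h => huy (by rw [← hu', hren1, h, map_zero])) hcy hdet'
    (by
      apply hinj
      simp only [map_mul, ← hren1, hu', hα, rename_C, hε, hαy]
      ring)
    (by
      apply hinj
      simp only [pderiv_mul, map_add, map_mul, ← hren0, ← hren1, hu', rename_C, hε, pderiv_C,
        pderiv_aeval_pair, h100, map_zero]
      ring)
  obtain ⟨k, hk⟩ : ∃ k, e = 2 * k * b := ⟨e / (2 * b), by field_simp⟩
  have h00k : pderiv 0 (pderiv 0 h) = C (2 * k) := by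
    rw [← sub_eq_zero]
    apply hindep
    rw [map_sub, ← hε, sub_eq_zero, aeval_C, algebraMap_eq]
    have : ε = C (2 * k) := by
      apply mul_left_cancel₀ (C_ne_zero.2 hb0 : (C b : MvPolynomial (Fin 2) ℝ) ≠ 0)
      rw [he, hk, ← C_mul, mul_comm b]
    rw [this, rename_C]
  have h0k : pderiv 0 h = C (2 * k) * X 0 := by
    rw [← sub_eq_zero]
    refine eq_zero_of_forall_pderiv_eq_zero (fun i => ?_) (by
      rw [map_sub, h00, map_mul, eval_X, Pi.zero_apply, mul_zero, sub_zero])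
    fin_cases i
    · simp [h00k]
    · simp [h10]
  have hhk : h = C k * X 0 ^ 2 := by
    rw [← sub_eq_zero]
    refine eq_zero_of_forall_pderiv_eq_zero (fun i => ?_) (by
      rw [map_sub, h0, map_mul, map_pow, eval_X, Pi.zero_apply, zero_pow two_ne_zero, mul_zero,
        sub_zero])
    fin_cases i
    · simp only [Fin.zero_eta, map_sub, pderiv_mul, h0k, pderiv_pow, pderiv_C, pderiv_X_self, C_mul]
      rw [show (C 2 : MvPolynomial (Fin 2) ℝ) = 2 from map_ofNat C 2]
      push_cast
      ring
    · simp [h1]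
  have hαu : α = C (2 * k) * u' := by
    apply hinj
    rw [hα, h0k, map_mul (aeval ![u, v]), map_mul (rename _), rename_C, hu', aeval_C, aeval_X, algebraMap_eq]
    rfl
  have hcu : c + (C e * X 0 + C ρ) * u' = 0 := by
    refine eq_zero_of_forall_pderiv_eq_zero (fun i => ?_) ?_
    · fin_cases i
      · apply mul_left_cancel₀ (fun h => huy (by rw [← hu', hren1, h, map_zero]) : pderiv 1 u' ≠ 0)
        have he' : (C e : MvPolynomial (Fin 2) ℝ) = C b * C (2 * k) := by
          rw [hk, ← C_mul, mul_comm b]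
        simp only [Fin.zero_eta, map_add, pderiv_mul, pderiv_C, pderiv_X_self]
        rw [hαu] at hdet'
        linear_combination hdet' - pderiv 0 u' * hu'x + pderiv 1 u' * u' * he'
      · simp only [Fin.mk_one, map_add, pderiv_mul, pderiv_C,
          pderiv_X_of_ne (by decide : (0 : Fin 2) ≠ 1)]
        linear_combination hcy - hu'x
    · have h2 : eval 0 u' = 0 := by
        rw [← hu', eval_rename] at hu0
        exact hu0
      have h3 : eval 0 c = 0 := by
        rw [hv, map_add, eval_rename] at hv0
        simpa using hv0
      rw [map_add, map_mul, h2, h3, mul_zero, add_zero]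
  have hup (p : Fin 3 → ℝ) : eval p u = eval ![p 0, p 1] u' := by
    rw [← hu', eval_rename]
    congr 2
    ext i
    fin_cases i <;> rfl
  refine ⟨b, ρ, k, aeval ![0, Polynomial.X] u', hb0, fun p => ⟨?_, ?_, ?_⟩⟩
  · rw [hup, eval_eq_of_pderiv_zero_eq_affine_mul hu'x, eval_aeval_zero_X]
    rw [hk, show 2 * k * b / 2 = k * b by ring]
  · have hcp : eval p (rename Fin.castSucc c) = -(e * p 0 + ρ) * eval p u := by
      have := congrArg (fun f => eval p (rename Fin.castSucc f)) hcu
      simp only [map_add, map_mul, rename_C, rename_X, hu', eval_C, eval_X, map_zero,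
        Fin.castSucc_zero] at this
      linear_combination this
    rw [hv, map_add, hcp, hk]
    simp
    ring
  · rw [hhk]
    simp

/-- The substitution `(x, y) ↦ (c x - d y, d x + c y)`. -/
noncomputable def rotTwo (c d : ℝ) : MvPolynomial (Fin 2) ℝ →ₐ[ℝ] MvPolynomial (Fin 2) ℝ :=
  aeval ![C c * X 0 - C d * X 1, C d * X 0 + C c * X 1]

/-- The substitution `(x, y, z) ↦ (c x - d y, d x + c y, z)`. -/
noncomputable def rotThree (c d : ℝ) : MvPolynomial (Fin 3) ℝ →ₐ[ℝ] MvPolynomial (Fin 3) ℝ :=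
  aeval ![C c * X 0 - C d * X 1, C d * X 0 + C c * X 1, X 2]

theorem pderiv_zero_rotTwo (c d : ℝ) (f : MvPolynomial (Fin 2) ℝ) :
    pderiv 0 (rotTwo c d f) = rotTwo c d (C c * pderiv 0 f + C d * pderiv 1 f) := by
  have hC (b : ℝ) : rotTwo c d (C b) = C b := by simp [rotTwo]
  rw [map_add, map_mul, map_mul, hC, hC, rotTwo, pderiv_aeval_eq_sum, Fin.sum_univ_two]
  simp [mul_comm]

theorem pderiv_one_rotTwo (c d : ℝ) (f : MvPolynomial (Fin 2) ℝ) :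
    pderiv 1 (rotTwo c d f) = rotTwo c d (C c * pderiv 1 f - C d * pderiv 0 f) := by
  have hC (b : ℝ) : rotTwo c d (C b) = C b := by simp [rotTwo]
  rw [map_sub, map_mul, map_mul, hC, hC, rotTwo, pderiv_aeval_eq_sum, Fin.sum_univ_two]
  simp
  ring

theorem pderiv_zero_rotThree (c d : ℝ) (f : MvPolynomial (Fin 3) ℝ) :
    pderiv 0 (rotThree c d f) = rotThree c d (C c * pderiv 0 f + C d * pderiv 1 f) := by
  have hC (b : ℝ) : rotThree c d (C b) = C b := by simp [rotThree]
  rw [map_add, map_mul, map_mul, hC, hC, rotThree, pderiv_aeval_eq_sum, Fin.sum_univ_three]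
  simp [mul_comm]

theorem pderiv_one_rotThree (c d : ℝ) (f : MvPolynomial (Fin 3) ℝ) :
    pderiv 1 (rotThree c d f) = rotThree c d (C c * pderiv 1 f - C d * pderiv 0 f) := by
  have hC (b : ℝ) : rotThree c d (C b) = C b := by simp [rotThree]
  rw [map_sub, map_mul, map_mul, hC, hC, rotThree, pderiv_aeval_eq_sum, Fin.sum_univ_three]
  simp
  ring

theorem pderiv_two_rotThree (c d : ℝ) (f : MvPolynomial (Fin 3) ℝ) :
    pderiv 2 (rotThree c d f) = rotThree c d (pderiv 2 f) := by
  rw [rotThree, pderiv_aeval_eq_sum, Fin.sum_univ_three]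
  simp

theorem eval_rotTwo_zero (c d : ℝ) (f : MvPolynomial (Fin 2) ℝ) :
    eval 0 (rotTwo c d f) = eval 0 f := by
  rw [rotTwo, ← aeval_eq_eval, ← AlgHom.comp_apply, comp_aeval]
  congr 2
  ext i
  fin_cases i <;> simp

theorem eval_rotThree (c d : ℝ) (f : MvPolynomial (Fin 3) ℝ) (p : Fin 3 → ℝ) :
    eval p (rotThree c d f) = eval ![c * p 0 - d * p 1, d * p 0 + c * p 1, p 2] f := by
  rw [rotThree, ← aeval_eq_eval, ← aeval_eq_eval, ← AlgHom.comp_apply, comp_aeval]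
  congr 2
  ext i
  fin_cases i <;> simp

theorem eval_rotThree_zero (c d : ℝ) (f : MvPolynomial (Fin 3) ℝ) :
    eval 0 (rotThree c d f) = eval 0 f := by
  rw [eval_rotThree]
  congr 2
  ext i
  fin_cases i <;> simp

theorem eval_rotThree_of_sq_add_sq_eq_one {c d : ℝ} (hcd : c ^ 2 + d ^ 2 = 1)
    (f : MvPolynomial (Fin 3) ℝ) (p : Fin 3 → ℝ) :
    eval ![c * p 0 + d * p 1, c * p 1 - d * p 0, p 2] (rotThree c d f) = eval p f := by
  rw [eval_rotThree]
  congr 2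
  ext i
  fin_cases i
  · simp
    linear_combination p 0 * hcd
  · simp
    linear_combination p 1 * hcd
  · rfl

theorem rotThree_injective {c d : ℝ} (hcd : c ^ 2 + d ^ 2 = 1) :
    Function.Injective (rotThree c d) := fun f g h =>
  funext fun p => by
    rw [← eval_rotThree_of_sq_add_sq_eq_one hcd f, h, eval_rotThree_of_sq_add_sq_eq_one hcd]

theorem aeval_pair_rotTwo {c d : ℝ} (hcd : c ^ 2 + d ^ 2 = 1) (u v : MvPolynomial (Fin 3) ℝ)
    (f : MvPolynomial (Fin 2) ℝ) :
    aeval ![rotThree c d (C c * u + C d * v), rotThree c d (C c * v - C d * u)] (rotTwo c d f) =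
      rotThree c d (aeval ![u, v] f) := by
  have hcd' : (C c ^ 2 + C d ^ 2 : MvPolynomial (Fin 3) ℝ) = 1 := by
    rw [← C_pow, ← C_pow, ← C_add, hcd, C_1]
  have hC (b : ℝ) : rotThree c d (C b) = C b := by simp [rotThree]
  rw [← AlgHom.comp_apply, ← AlgHom.comp_apply]
  refine DFunLike.congr_fun (MvPolynomial.algHom_ext fun i => ?_) f
  rw [AlgHom.comp_apply, AlgHom.comp_apply, rotTwo, aeval_X, aeval_X]
  simp only [map_add, map_sub, map_mul, hC]
  fin_cases i
  · simp [algebraMap_eq]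
    linear_combination (rotThree c d u) * hcd'
  · simp [algebraMap_eq]
    linear_combination (rotThree c d v) * hcd'

theorem exists_structure_of_rotation {c d : ℝ} (hcd : c ^ 2 + d ^ 2 = 1)
    {u v : MvPolynomial (Fin 3) ℝ} {h : MvPolynomial (Fin 2) ℝ}
    (hz : C c * pderiv 2 u + C d * pderiv 2 v = 0)
    (hAB : pderiv 0 v * pderiv 2 u - pderiv 0 u * pderiv 2 v ≠ 0 ∨
      pderiv 1 v * pderiv 2 u - pderiv 1 u * pderiv 2 v ≠ 0)
    (htr : pderiv 0 u + aeval ![u, v] (pderiv 0 h) * pderiv 2 u +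
      (pderiv 1 v + aeval ![u, v] (pderiv 1 h) * pderiv 2 v) = 0)
    (hdet : (pderiv 0 u + aeval ![u, v] (pderiv 0 h) * pderiv 2 u) *
        (pderiv 1 v + aeval ![u, v] (pderiv 1 h) * pderiv 2 v) -
      (pderiv 1 u + aeval ![u, v] (pderiv 1 h) * pderiv 2 u) *
        (pderiv 0 v + aeval ![u, v] (pderiv 0 h) * pderiv 2 v) = 0)
    (hu0 : eval 0 u = 0) (hv0 : eval 0 v = 0) (hne : aeval ![u, v] h ≠ 0) (h0 : eval 0 h = 0)
    (h00 : eval 0 (pderiv 0 h) = 0) (h01 : eval 0 (pderiv 1 h) = 0) :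
    ∃ (b ρ k : ℝ) (g : Polynomial ℝ), ∀ p : Fin 3 → ℝ,
      c * eval p u + d * eval p v =
        g.eval (c * p 1 - d * p 0 + ρ * (c * p 0 + d * p 1) + k * b * (c * p 0 + d * p 1) ^ 2) ∧
      c * eval p v - d * eval p u = b * p 2 - (2 * k * b * (c * p 0 + d * p 1) + ρ) *
        (c * eval p u + d * eval p v) ∧
      eval p (aeval ![u, v] h) = k * (c * eval p u + d * eval p v) ^ 2 := by
  have hcd' : (C c ^ 2 + C d ^ 2 : MvPolynomial (Fin 3) ℝ) = 1 := by
    rw [← C_pow, ← C_pow, ← C_add, hcd, C_1]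
  have hinj := rotThree_injective hcd
  have hC (b : ℝ) : rotThree c d (C b) = C b := by simp [rotThree]
  have hC2 (u v : MvPolynomial (Fin 3) ℝ) (b : ℝ) : aeval ![u, v] (C b) = C b := by
    simp [algebraMap_eq]
  have hUx : pderiv 0 (rotThree c d (C c * u + C d * v)) = rotThree c d
      (C c * (C c * pderiv 0 u + C d * pderiv 0 v) +
        C d * (C c * pderiv 1 u + C d * pderiv 1 v)) := by
    rw [pderiv_zero_rotThree]; simp
  have hUy : pderiv 1 (rotThree c d (C c * u + C d * v)) = rotThree c d
      (C c * (C c * pderiv 1 u + C d * pderiv 1 v) -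
        C d * (C c * pderiv 0 u + C d * pderiv 0 v)) := by
    rw [pderiv_one_rotThree]; simp
  have hUz : pderiv 2 (rotThree c d (C c * u + C d * v)) = 0 := by
    rw [pderiv_two_rotThree, ← (rotThree c d).map_zero, ← hz]; simp
  have hVx : pderiv 0 (rotThree c d (C c * v - C d * u)) = rotThree c d
      (C c * (C c * pderiv 0 v - C d * pderiv 0 u) +
        C d * (C c * pderiv 1 v - C d * pderiv 1 u)) := by
    rw [pderiv_zero_rotThree]; simp
  have hVy : pderiv 1 (rotThree c d (C c * v - C d * u)) = rotThree c d
      (C c * (C c * pderiv 1 v - C d * pderiv 1 u) -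
        C d * (C c * pderiv 0 v - C d * pderiv 0 u)) := by
    rw [pderiv_one_rotThree]; simp
  have hVz : pderiv 2 (rotThree c d (C c * v - C d * u)) = rotThree c d
      (C c * pderiv 2 v - C d * pderiv 2 u) := by
    rw [pderiv_two_rotThree]; simp
  set α := aeval ![u, v] (pderiv 0 h) with hα
  set β := aeval ![u, v] (pderiv 1 h) with hβ
  have hα' : aeval ![rotThree c d (C c * u + C d * v), rotThree c d (C c * v - C d * u)]
      (pderiv 0 (rotTwo c d h)) = rotThree c d (C c * α + C d * β) := by
    rw [pderiv_zero_rotTwo, aeval_pair_rotTwo hcd, map_add (aeval _), map_mul (aeval _),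
      map_mul (aeval _), hC2, hC2]
  have hβ' : aeval ![rotThree c d (C c * u + C d * v), rotThree c d (C c * v - C d * u)]
      (pderiv 1 (rotTwo c d h)) = rotThree c d (C c * β - C d * α) := by
    rw [pderiv_one_rotTwo, aeval_pair_rotTwo hcd, map_sub (aeval _), map_mul (aeval _),
      map_mul (aeval _), hC2, hC2]
  have htr' : (C c * (C c * pderiv 0 u + C d * pderiv 0 v) +
        C d * (C c * pderiv 1 u + C d * pderiv 1 v)) +
      (C c * (C c * pderiv 1 v - C d * pderiv 1 u) -
        C d * (C c * pderiv 0 v - C d * pderiv 0 u)) +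
      (C c * β - C d * α) * (C c * pderiv 2 v - C d * pderiv 2 u) = 0 := by
    linear_combination (C c ^ 2 + C d ^ 2) * htr - (C c * α + C d * β) * hz
  obtain ⟨b, ρ, k, g, -, hstr⟩ := exists_structure_of_pderiv_two_eq_zero
    (u := rotThree c d (C c * u + C d * v)) (v := rotThree c d (C c * v - C d * u))
    (h := rotTwo c d h) hUz
    (by
      rw [hVz, map_ne_zero_iff _ hinj]
      intro hw
      have h1 : pderiv 2 u = 0 := by
        linear_combination C c * hz - C d * hw - pderiv 2 u * hcd'
      have h2 : pderiv 2 v = 0 := by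
        linear_combination C d * hz + C c * hw - pderiv 2 v * hcd'
      simp [h1, h2] at hAB)
    (by
      rw [hUx, hUy, map_ne_zero_iff _ hinj, map_ne_zero_iff _ hinj]
      by_contra! hcon
      obtain ⟨h1, h2⟩ := hcon
      have h3 : C c * pderiv 0 u + C d * pderiv 0 v = 0 := by
        linear_combination C c * h1 - C d * h2 - (C c * pderiv 0 u + C d * pderiv 0 v) * hcd'
      have h4 : C c * pderiv 1 u + C d * pderiv 1 v = 0 := by
        linear_combination C d * h1 + C c * h2 - (C c * pderiv 1 u + C d * pderiv 1 v) * hcd'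
      rcases hAB with hA | hB
      · apply hA
        linear_combination (C c * pderiv 0 v - C d * pderiv 0 u) * hz -
          (C c * pderiv 2 v - C d * pderiv 2 u) * h3 -
          (pderiv 0 v * pderiv 2 u - pderiv 0 u * pderiv 2 v) * hcd'
      · apply hB
        linear_combination (C c * pderiv 1 v - C d * pderiv 1 u) * hz -
          (C c * pderiv 2 v - C d * pderiv 2 u) * h4 -
          (pderiv 1 v * pderiv 2 u - pderiv 1 u * pderiv 2 v) * hcd')
    (by
      rw [hUx, hVy, hβ', hVz, ← map_mul, ← map_add, ← map_add, map_eq_zero_iff _ hinj]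
      exact htr')
    (by
      rw [hUx, hUy, hVx, hα', hVz, ← map_mul, ← map_add (rotThree c d), ← map_mul, ← map_pow,
        ← map_add (rotThree c d), map_eq_zero_iff _ hinj]
      linear_combination (C c * (C c * pderiv 0 u + C d * pderiv 0 v) +
        C d * (C c * pderiv 1 u + C d * pderiv 1 v)) * htr' - (C c ^ 2 + C d ^ 2) ^ 2 * hdet +
        ((C c * α + C d * β) * ((C c * (C c * pderiv 1 v - C d * pderiv 1 u) -
        C d * (C c * pderiv 0 v - C d * pderiv 0 u)) +
          (C c * β - C d * α) * (C c * pderiv 2 v - C d * pderiv 2 u)) -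
        (C c * β - C d * α) * ((C c * (C c * pderiv 0 v - C d * pderiv 0 u) +
        C d * (C c * pderiv 1 v - C d * pderiv 1 u)) +
          (C c * α + C d * β) * (C c * pderiv 2 v - C d * pderiv 2 u))) * hz)
    (by
      rw [eval_rotThree_zero, map_add, map_mul, map_mul, hu0, hv0, mul_zero, mul_zero, add_zero])
    (by
      rw [eval_rotThree_zero, map_sub, map_mul, map_mul, hu0, hv0, mul_zero, mul_zero, sub_zero])
    (fun h' => hne (by
      rw [← map_eq_zero_iff _ hinj, ← aeval_pair_rotTwo hcd, h', map_zero]))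
    (by rw [eval_rotTwo_zero, h0])
    (by rw [pderiv_zero_rotTwo, eval_rotTwo_zero, map_add, map_mul, map_mul, h00, h01]; simp)
    (by rw [pderiv_one_rotTwo, eval_rotTwo_zero, map_sub, map_mul, map_mul, h00, h01]; simp)
  refine ⟨b, ρ, k, g, fun p => ?_⟩
  have := hstr ![c * p 0 + d * p 1, c * p 1 - d * p 0, p 2]
  rw [aeval_pair_rotTwo hcd] at this
  simp only [eval_rotThree_of_sq_add_sq_eq_one hcd] at this
  simpa using this

theorem exists_polynomial_inverse {c d lam b ρ k : ℝ} (hcd : c ^ 2 + d ^ 2 = 1) (hlam : lam ≠ 0)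
    {u v w : MvPolynomial (Fin 3) ℝ} {g : Polynomial ℝ}
    (hstr : ∀ p : Fin 3 → ℝ,
      c * eval p u + d * eval p v =
        g.eval (c * p 1 - d * p 0 + ρ * (c * p 0 + d * p 1) + k * b * (c * p 0 + d * p 1) ^ 2) ∧
      c * eval p v - d * eval p u = b * p 2 - (2 * k * b * (c * p 0 + d * p 1) + ρ) *
        (c * eval p u + d * eval p v) ∧
      eval p w = k * (c * eval p u + d * eval p v) ^ 2) :
    ∃ G : Fin 3 → MvPolynomial (Fin 3) ℝ,
      (∀ p : Fin 3 → ℝ, (fun i => eval (fun i => lam * p i + eval p (![u, v, w] i)) (G i)) = p) ∧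
      (∀ p : Fin 3 → ℝ, (fun i => lam * eval p (G i) +
        eval (fun i => eval p (G i)) (![u, v, w] i)) = p) := by
  obtain ⟨x', hx'⟩ : ∃ f : MvPolynomial (Fin 3) ℝ, ∀ p, eval p f = c * p 0 + d * p 1 :=
    ⟨C c * X 0 + C d * X 1, by simp⟩
  obtain ⟨y', hy'⟩ : ∃ f : MvPolynomial (Fin 3) ℝ, ∀ p, eval p f = c * p 1 - d * p 0 :=
    ⟨C c * X 1 - C d * X 0, by simp⟩
  obtain ⟨T, hT⟩ : ∃ f : MvPolynomial (Fin 3) ℝ, ∀ p, eval p f =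
      ((c * p 1 - d * p 0) + ρ * (c * p 0 + d * p 1) - b / lam * p 2 +
        k * b / lam * (c * p 0 + d * p 1) ^ 2) / lam :=
    ⟨C lam⁻¹ * (y' + C ρ * x' - C (b / lam) * X 2 + C (k * b / lam) * x' ^ 2), fun p => by
      simp only [map_mul, map_add, map_sub, map_pow, eval_C, eval_X, hx', hy']
      ring⟩
  obtain ⟨U, hU⟩ : ∃ f : MvPolynomial (Fin 3) ℝ, ∀ p, eval p f = g.eval (eval p T) :=
    ⟨Polynomial.aeval T g, fun p => by
      have := Polynomial.aeval_algHom_apply (aeval p) T g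
      rw [aeval_eq_eval, Polynomial.coe_aeval_eq_eval] at this
      exact this.symm⟩
  obtain ⟨S, hS⟩ : ∃ f : MvPolynomial (Fin 3) ℝ, ∀ p, eval p f =
      (c * p 0 + d * p 1 - eval p U) / lam :=
    ⟨C lam⁻¹ * (x' - U), fun p => by
      simp only [map_mul, map_sub, eval_C, hx']
      ring⟩
  obtain ⟨Z, hZ⟩ : ∃ f : MvPolynomial (Fin 3) ℝ, ∀ p, eval p f =
      (p 2 - k * eval p U ^ 2) / lam :=
    ⟨C lam⁻¹ * (X 2 - C k * U ^ 2), fun p => by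
      simp only [map_mul, map_sub, map_pow, eval_C, eval_X]
      ring⟩
  obtain ⟨Y, hY⟩ : ∃ f : MvPolynomial (Fin 3) ℝ, ∀ p, eval p f =
      (c * p 1 - d * p 0 - b * eval p Z + (2 * k * b * eval p S + ρ) * eval p U) / lam :=
    ⟨C lam⁻¹ * (y' - C b * Z + (C (2 * k * b) * S + C ρ) * U), fun p => by
      simp only [map_mul, map_sub, map_add, eval_C, hy']
      ring⟩
  refine ⟨![C c * S - C d * Y, C d * S + C c * Y, Z], fun p => ?_, fun p => ?_⟩
  · obtain ⟨h1, h2, h3⟩ := hstr p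
    set q : Fin 3 → ℝ := fun i => lam * p i + eval p (![u, v, w] i) with hq
    have q0 : q 0 = lam * p 0 + eval p u := rfl
    have q1 : q 1 = lam * p 1 + eval p v := rfl
    have q2 : q 2 = lam * p 2 + eval p w := rfl
    have hqx : c * q 0 + d * q 1 = lam * (c * p 0 + d * p 1) + (c * eval p u + d * eval p v) := by
      rw [q0, q1]; ring
    have hqy : c * q 1 - d * q 0 = lam * (c * p 1 - d * p 0) +
        (b * p 2 - (2 * k * b * (c * p 0 + d * p 1) + ρ) * (c * eval p u + d * eval p v)) := by
      rw [q0, q1, ← h2]; ring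
    have hqT : eval q T =
        c * p 1 - d * p 0 + ρ * (c * p 0 + d * p 1) + k * b * (c * p 0 + d * p 1) ^ 2 := by
      rw [hT, hqx, hqy, q2, h3]
      field_simp
      ring
    have hqU : eval q U = c * eval p u + d * eval p v := by rw [hU, hqT, h1]
    have hqS : eval q S = c * p 0 + d * p 1 := by
      rw [hS, hqx, hqU]; field_simp; ring
    have hqZ : eval q Z = p 2 := by
      rw [hZ, q2, h3, hqU]; field_simp; ring
    have hqY : eval q Y = c * p 1 - d * p 0 := by
      rw [hY, hqy, hqZ, hqS, hqU]; field_simp; ring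
    ext i
    fin_cases i
    · simp [hqS, hqY]
      linear_combination p 0 * hcd
    · simp [hqS, hqY]
      linear_combination p 1 * hcd
    · exact hqZ
  · set q : Fin 3 → ℝ := fun i => eval p (![C c * S - C d * Y, C d * S + C c * Y, Z] i) with hq
    have q0 : q 0 = c * eval p S - d * eval p Y := by simp [hq]
    have q1 : q 1 = d * eval p S + c * eval p Y := by simp [hq]
    have q2 : q 2 = eval p Z := by simp [hq]
    obtain ⟨h1, h2, h3⟩ := hstr q
    have hqx : c * q 0 + d * q 1 = eval p S := by
      rw [q0, q1]; linear_combination eval p S * hcd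
    have hqy : c * q 1 - d * q 0 = eval p Y := by
      rw [q0, q1]; linear_combination eval p Y * hcd
    have hqU : c * eval q u + d * eval q v = eval p U := by
      rw [h1, hqx, hqy, hU]
      congr 1
      rw [hY, hZ, hS, hT]
      field_simp
      ring
    rw [hqU, hqx, q2] at h2
    rw [hqU] at h3
    have hS' : lam * eval p S = c * p 0 + d * p 1 - eval p U := by rw [hS]; field_simp
    have hY' : lam * eval p Y =
        c * p 1 - d * p 0 - b * eval p Z + (2 * k * b * eval p S + ρ) * eval p U := by
      rw [hY]; field_simp
    have hZ' : lam * eval p Z = p 2 - k * eval p U ^ 2 := by rw [hZ]; field_simp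
    ext i
    fin_cases i
    · change lam * q 0 + eval q u = p 0
      rw [q0]
      linear_combination c * hS' - d * hY' + c * hqU - d * h2 + (p 0 - eval q u) * hcd
    · change lam * q 1 + eval q v = p 1
      rw [q1]
      linear_combination d * hS' + c * hY' + d * hqU + c * h2 + (p 1 - eval q v) * hcd
    · change lam * q 2 + eval q w = p 2
      rw [q2, h3, hZ']
      ring

theorem pderiv_eq_zero_of_degreeOf_mul_lt {n : ℕ} {i j : Fin (n + 1)} (hij : j ≠ i)
    {u v A B α : MvPolynomial (Fin (n + 1)) ℝ} (hu : pderiv i u ≠ 0)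
    (hdeg : degreeOf i (v * B) < degreeOf i (u * A))
    (h : A * pderiv j u + B * pderiv j v + α * (A * pderiv i u + B * pderiv i v) = 0) :
    pderiv i α = 0 := by
  have hA : A ≠ 0 := by rintro rfl; simp at hdeg
  have hu0 : u ≠ 0 := by rintro rfl; simp at hu
  rw [degreeOf_mul_eq hu0 hA] at hdeg
  refine pderiv_eq_zero_of_leading_terms hij hu hA ?_ ?_ h
  · rcases eq_or_ne B 0 with rfl | hB
    · rw [zero_mul, degreeOf_zero]
      omega
    rcases eq_or_ne v 0 with rfl | hv
    · rw [map_zero, mul_zero, degreeOf_zero]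
      omega
    rw [degreeOf_mul_eq hv hB] at hdeg
    have h1 := degreeOf_mul_le i B (pderiv j v)
    have h2 := degreeOf_pderiv_le i j v
    omega
  · by_cases hv : pderiv i v = 0
    · exact Or.inl (by rw [hv, mul_zero])
    rcases eq_or_ne B 0 with rfl | hB
    · exact Or.inl (zero_mul _)
    have hv0 : v ≠ 0 := by rintro rfl; simp at hv
    rw [degreeOf_mul_eq hv0 hB] at hdeg
    have h1 := degreeOf_mul_le i B (pderiv i v)
    have h2 := degreeOf_pderiv_self i v
    have h3 : degreeOf i v ≠ 0 := fun h => hv (pderiv_eq_zero_of_degreeOf_eq_zero h)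
    exact Or.inr (by omega)

theorem exists_direction_of_hessian {σ : Type*} {i j : σ} {u v : MvPolynomial σ ℝ}
    {h : MvPolynomial (Fin 2) ℝ}
    (hJ : pderiv i u * pderiv j v - pderiv j u * pderiv i v ≠ 0)
    (hα : pderiv i (aeval ![u, v] (pderiv 0 h)) = 0)
    (hβ : pderiv i (aeval ![u, v] (pderiv 1 h)) = 0)
    (hne : h ≠ 0) (h0 : eval 0 h = 0)
    (h00 : eval 0 (pderiv 0 h) = 0) (h01 : eval 0 (pderiv 1 h) = 0) :
    ∃ p q : ℝ, (p ≠ 0 ∨ q ≠ 0) ∧ C p * pderiv i u + C q * pderiv i v = 0 := by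
  have hindep := eq_zero_of_aeval_pair_eq_zero hJ
  have hcomm := pderiv_pderiv_comm 0 1 h
  rw [pderiv_aeval_pair] at hα hβ
  rw [hcomm] at hβ
  have hess : pderiv 0 (pderiv 0 h) * pderiv 1 (pderiv 1 h) = pderiv 1 (pderiv 0 h) ^ 2 := by
    rw [← sub_eq_zero]
    apply hindep
    rw [map_sub, map_mul, map_pow]
    refine (mul_eq_zero.1 (?_ : _ * (pderiv i u * pderiv j v - pderiv j u * pderiv i v) = 0)
      ).resolve_right hJ
    set a := aeval ![u, v] (pderiv 0 (pderiv 0 h))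
    set b := aeval ![u, v] (pderiv 1 (pderiv 0 h))
    set c := aeval ![u, v] (pderiv 1 (pderiv 1 h))
    linear_combination (c * pderiv j v + b * pderiv j u) * hα -
      (b * pderiv j v + a * pderiv j u) * hβ
  obtain ⟨p, q, hpq, hrel⟩ := exists_linear_relation_of_hessian_eq_zero hess
  refine ⟨p, q, hpq, ?_⟩
  have hC (b : ℝ) : aeval ![u, v] (C b) = C b := by simp [algebraMap_eq]
  have hr0 := congrArg (aeval ![u, v]) (hrel 0)
  have hr1 := congrArg (aeval ![u, v]) (hrel 1)
  rw [map_mul (aeval _), map_mul (aeval _), hC, hC] at hr0 hr1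
  rw [hcomm] at hr0
  by_contra hs
  have hz (f : MvPolynomial (Fin 2) ℝ)
      (hf : aeval ![u, v] f * (C p * pderiv i u + C q * pderiv i v) = 0) : f = 0 :=
    hindep f ((mul_eq_zero.1 hf).resolve_right hs)
  have h2 : pderiv 0 (pderiv 0 h) = 0 := hz _ (by
    linear_combination C p * hα + pderiv i v * hr0)
  have h3 : pderiv 1 (pderiv 0 h) = 0 := hz _ (by
    linear_combination C p * hβ + pderiv i v * hr1)
  have h4 : pderiv 1 (pderiv 1 h) = 0 := hz _ (by
    linear_combination C q * hβ - pderiv i u * hr1)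
  have h5 : pderiv 0 h = 0 := by
    refine eq_zero_of_forall_pderiv_eq_zero (fun k => ?_) h00
    fin_cases k <;> assumption
  have h6 : pderiv 1 h = 0 := by
    refine eq_zero_of_forall_pderiv_eq_zero (fun k => ?_) h01
    fin_cases k
    · exact hcomm.trans h3
    · exact h4
  refine hne (eq_zero_of_forall_pderiv_eq_zero (fun k => ?_) h0)
  fin_cases k <;> assumption

theorem exists_unit_direction {u v : MvPolynomial (Fin 3) ℝ} {h : MvPolynomial (Fin 2) ℝ}
    (htr : pderiv 0 u + aeval ![u, v] (pderiv 0 h) * pderiv 2 u +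
      (pderiv 1 v + aeval ![u, v] (pderiv 1 h) * pderiv 2 v) = 0)
    (hdet : (pderiv 0 u + aeval ![u, v] (pderiv 0 h) * pderiv 2 u) *
        (pderiv 1 v + aeval ![u, v] (pderiv 1 h) * pderiv 2 v) -
      (pderiv 1 u + aeval ![u, v] (pderiv 1 h) * pderiv 2 u) *
        (pderiv 0 v + aeval ![u, v] (pderiv 0 h) * pderiv 2 v) = 0)
    (hdeg : degreeOf 2 (u * (pderiv 0 v * pderiv 2 u - pderiv 0 u * pderiv 2 v)) ≠
      degreeOf 2 (v * (pderiv 1 v * pderiv 2 u - pderiv 1 u * pderiv 2 v)))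
    (hAB : pderiv 0 v * pderiv 2 u - pderiv 0 u * pderiv 2 v ≠ 0 ∨
      pderiv 1 v * pderiv 2 u - pderiv 1 u * pderiv 2 v ≠ 0)
    (hne : h ≠ 0) (h0 : eval 0 h = 0)
    (h00 : eval 0 (pderiv 0 h) = 0) (h01 : eval 0 (pderiv 1 h) = 0) :
    ∃ c d : ℝ, c ^ 2 + d ^ 2 = 1 ∧ C c * pderiv 2 u + C d * pderiv 2 v = 0 := by
  suffices H : ∃ p q : ℝ, (p ≠ 0 ∨ q ≠ 0) ∧ C p * pderiv 2 u + C q * pderiv 2 v = 0 by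
    obtain ⟨p, q, hpq, hs⟩ := H
    have hpos : 0 < p ^ 2 + q ^ 2 := by
      rcases hpq with h | h <;> positivity
    have hsq := Real.sq_sqrt hpos.le
    have hr := (Real.sqrt_pos.2 hpos).ne'
    refine ⟨(√(p ^ 2 + q ^ 2))⁻¹ * p, (√(p ^ 2 + q ^ 2))⁻¹ * q, ?_, ?_⟩
    · field_simp
      exact hsq.symm
    · rw [C_mul, C_mul]
      linear_combination C (√(p ^ 2 + q ^ 2))⁻¹ * hs
  by_cases huz : pderiv 2 u = 0
  · exact ⟨1, 0, Or.inl one_ne_zero, by simp [huz]⟩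
  by_cases hvz : pderiv 2 v = 0
  · exact ⟨0, 1, Or.inr one_ne_zero, by simp [hvz]⟩
  set α := aeval ![u, v] (pderiv 0 h) with hα
  set β := aeval ![u, v] (pderiv 1 h) with hβ
  set A := pderiv 0 v * pderiv 2 u - pderiv 0 u * pderiv 2 v with hA
  set B := pderiv 1 v * pderiv 2 u - pderiv 1 u * pderiv 2 v with hB
  have hI0 : A * pderiv 0 u + B * pderiv 0 v + α * (A * pderiv 2 u + B * pderiv 2 v) = 0 := by
    rw [hA, hB]
    linear_combination ((pderiv 0 v + α * pderiv 2 v) * pderiv 2 u -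
      pderiv 2 v * (pderiv 0 u + α * pderiv 2 u)) * htr + pderiv 2 v * hdet
  have hI1 : A * pderiv 1 u + B * pderiv 1 v + β * (A * pderiv 2 u + B * pderiv 2 v) = 0 := by
    rw [hA, hB]
    linear_combination ((pderiv 1 v + β * pderiv 2 v) * pderiv 2 u -
      pderiv 2 v * (pderiv 1 u + β * pderiv 2 u)) * htr - pderiv 2 u * hdet
  have hz : pderiv 2 α = 0 ∧ pderiv 2 β = 0 := by
    rcases lt_or_gt_of_ne hdeg with hlt | hlt
    · exact ⟨pderiv_eq_zero_of_degreeOf_mul_lt (n := 2) (j := 0) (by decide) hvz hlt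
        (by linear_combination hI0),
        pderiv_eq_zero_of_degreeOf_mul_lt (n := 2) (j := 1) (by decide) hvz hlt
        (by linear_combination hI1)⟩
    · exact ⟨pderiv_eq_zero_of_degreeOf_mul_lt (n := 2) (j := 0) (by decide) huz hlt hI0,
        pderiv_eq_zero_of_degreeOf_mul_lt (n := 2) (j := 1) (by decide) huz hlt hI1⟩
  rcases hAB with h' | h'
  · refine exists_direction_of_hessian (j := 0) ?_ hz.1 hz.2 hne h0 h00 h01
    rwa [mul_comm (pderiv 2 u)]
  · refine exists_direction_of_hessian (j := 1) ?_ hz.1 hz.2 hne h0 h00 h01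
    rwa [mul_comm (pderiv 2 u)]

end MvPolynomial

theorem Matrix.trace_eq_zero_and_minors_of_pow_three_eq_zero {N : Matrix (Fin 3) (Fin 3) ℝ}
    (hN : N ^ 3 = 0) : N 0 0 + N 1 1 + N 2 2 = 0 ∧
      N 0 0 * N 1 1 - N 0 1 * N 1 0 + (N 0 0 * N 2 2 - N 0 2 * N 2 0) +
        (N 1 1 * N 2 2 - N 1 2 * N 2 1) = 0 := by
  have h1 : N.trace = 0 := (Matrix.isNilpotent_trace_of_isNilpotent ⟨3, hN⟩).eq_zero
  have h2 : (N ^ 2).trace = 0 := (Matrix.isNilpotent_trace_of_isNilpotent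
    ⟨3, by rw [← pow_mul, mul_comm, pow_mul, hN, zero_pow two_ne_zero]⟩).eq_zero
  rw [Matrix.trace_fin_three] at h1
  simp only [pow_two, Matrix.trace_fin_three, Matrix.mul_apply, Fin.sum_univ_three] at h2
  exact ⟨h1, by linear_combination (N 0 0 + N 1 1 + N 2 2) / 2 * h1 - h2 / 2⟩

/-- Let `H = (u, v, h(u,v)) : ℝ³ → ℝ³` be a polynomial map with `H(0) = 0`,
`h` with no linear part, the components of `H` linearly independent over `ℝ`, `JH` nilpotent
at every point, and `deg_z(u·A) ≠ deg_z(v·B)`.  Then for every `λ ≠ 0` the polynomial map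
`λ·id + H` is injective and has a polynomial inverse. -/
theorem stmt1 (u v : MvPolynomial (Fin 3) ℝ) (h : MvPolynomial (Fin 2) ℝ)
    (hlin : ∀ d : Fin 2 →₀ ℕ, (d.sum fun _ n => n) ≤ 1 → coeff d h = 0)
    (H : Fin 3 → MvPolynomial (Fin 3) ℝ) (hH : H = ![u, v, aeval ![u, v] h])
    (hH0 : ∀ i, eval (0 : Fin 3 → ℝ) (H i) = 0)
    (hindep : ∀ c : Fin 3 → ℝ, c 0 • H 0 + c 1 • H 1 + c 2 • H 2 = 0 → c = 0)
    (hnilp : ∀ p : Fin 3 → ℝ,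
      ((Matrix.of fun i j => eval p (pderiv j (H i))) ^ 3 : Matrix (Fin 3) (Fin 3) ℝ) = 0)
    (A B : MvPolynomial (Fin 3) ℝ)
    (hA : A = pderiv 0 v * pderiv 2 u - pderiv 0 u * pderiv 2 v)
    (hB : B = pderiv 1 v * pderiv 2 u - pderiv 1 u * pderiv 2 v)
    (hdeg : degreeOf 2 (u * A) ≠ degreeOf 2 (v * B))
    (lam : ℝ) (hlam : lam ≠ 0)
    (F : (Fin 3 → ℝ) → (Fin 3 → ℝ)) (hF : ∀ p, F p = fun i => lam * p i + eval p (H i)) :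
    Function.Injective F ∧
    ∃ G : Fin 3 → MvPolynomial (Fin 3) ℝ,
      (∀ p : Fin 3 → ℝ, (fun i => eval (F p) (G i)) = p) ∧
      (∀ p : Fin 3 → ℝ, F (fun i => eval p (G i)) = p) := by
  subst hH hA hB
  have hN (p : Fin 3 → ℝ) := Matrix.trace_eq_zero_and_minors_of_pow_three_eq_zero (hnilp p)
  have htr : pderiv 0 u + pderiv 1 v + pderiv 2 (aeval ![u, v] h) = 0 := by
    refine MvPolynomial.funext fun p => ?_
    simpa using (hN p).1
  have hmin : pderiv 0 u * pderiv 1 v - pderiv 1 u * pderiv 0 v +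
      (pderiv 0 u * pderiv 2 (aeval ![u, v] h) - pderiv 2 u * pderiv 0 (aeval ![u, v] h)) +
      (pderiv 1 v * pderiv 2 (aeval ![u, v] h) -
        pderiv 2 v * pderiv 1 (aeval ![u, v] h)) = 0 := by
    refine MvPolynomial.funext fun p => ?_
    simpa using (hN p).2
  simp only [pderiv_aeval_pair] at htr hmin
  have hne : aeval ![u, v] h ≠ 0 := fun h' => by
    have := congrFun (hindep ![0, 0, 1] (by
      change (0 : ℝ) • u + (0 : ℝ) • v + (1 : ℝ) • aeval ![u, v] h = 0
      rw [h', zero_smul, zero_smul, smul_zero, add_zero, add_zero])) 2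
    exact one_ne_zero this
  have h0 : eval 0 h = 0 := by
    rw [eval_zero, constantCoeff_eq]
    exact hlin 0 (by simp)
  have hd (i : Fin 2) : eval 0 (pderiv i h) = 0 := by
    rw [eval_zero, constantCoeff_eq, coeff_pderiv, zero_add,
      hlin _ (by rw [Finsupp.sum_single_index rfl]), zero_mul]
  have hAB : pderiv 0 v * pderiv 2 u - pderiv 0 u * pderiv 2 v ≠ 0 ∨
      pderiv 1 v * pderiv 2 u - pderiv 1 u * pderiv 2 v ≠ 0 := by
    by_contra! hcon
    simp [hcon.1, hcon.2] at hdeg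
  have htr' : pderiv 0 u + aeval ![u, v] (pderiv 0 h) * pderiv 2 u +
      (pderiv 1 v + aeval ![u, v] (pderiv 1 h) * pderiv 2 v) = 0 := by
    linear_combination htr
  have hdet : (pderiv 0 u + aeval ![u, v] (pderiv 0 h) * pderiv 2 u) *
        (pderiv 1 v + aeval ![u, v] (pderiv 1 h) * pderiv 2 v) -
      (pderiv 1 u + aeval ![u, v] (pderiv 1 h) * pderiv 2 u) *
        (pderiv 0 v + aeval ![u, v] (pderiv 0 h) * pderiv 2 v) = 0 := by
    linear_combination hmin
  obtain ⟨c, d, hcd, hz⟩ := exists_unit_direction htr' hdet hdeg hAB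
    (fun h' => hne (by rw [h', map_zero])) h0 (hd 0) (hd 1)
  obtain ⟨b, ρ, k, g, hstr⟩ := exists_structure_of_rotation hcd hz hAB htr' hdet (hH0 0) (hH0 1)
    hne h0 (hd 0) (hd 1)
  obtain ⟨G, hG, hG'⟩ := exists_polynomial_inverse hcd hlam hstr
  have hleft (p : Fin 3 → ℝ) : (fun i => eval (F p) (G i)) = p := by
    rw [hF]
    exact hG p
  refine ⟨fun p q hpq => ?_, G, hleft, fun p => ?_⟩
  · rw [← hleft p, hpq, hleft q]
  · rw [hF]
    exact hG' p
end

section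
/- Let λ ≠ 0, γ = 1/λ, and let b₁, v₁, α ∈ ℝ with v₁·α ≠ 0, and g ∈ ℝ[t] a polynomial with g(0) = 0. Define H(x,y,z) = (g(t), v₁z − (b₁ + 2v₁αx)·g(t), α·g(t)²) where t = y + b₁x + v₁αx², and define P(x,y,z) = (−γ·g(s), −γ²v₁z + γ(b₁ + 2γv₁αx)·g(s) − γ²v₁α·g(s)², −αγ·g(s)²) where s = γy + γb₁x + γ²v₁αx² − γ²v₁z. Then the polynomial maps λ·id + H and γ·id + P are mutually inverse: (λ·id + H) ∘ (γ·id + P) = id and (γ·id + P) ∘ (λ·id + H) = id on ℝ³. -/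
/-- With `λ ≠ 0`, `γ = 1/λ`, `v₁·α ≠ 0` and `g ∈ ℝ[t]` with `g(0) = 0`,
the maps `λ·id + H` and `γ·id + P` (with `H`, `P` as in the paper) are mutually inverse. -/
theorem stmt2 (lam γ b₁ v₁ α : ℝ) (hlam : lam ≠ 0) (hγ : γ = 1 / lam)
    (hv₁α : v₁ * α ≠ 0) (g : Polynomial ℝ) (hg0 : g.eval 0 = 0)
    (F P : ℝ × ℝ × ℝ → ℝ × ℝ × ℝ)
    (hF : ∀ x y z : ℝ, F (x, y, z) =
      (lam * x + g.eval (y + b₁ * x + v₁ * α * x ^ 2),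
       lam * y + (v₁ * z - (b₁ + 2 * v₁ * α * x) * g.eval (y + b₁ * x + v₁ * α * x ^ 2)),
       lam * z + α * (g.eval (y + b₁ * x + v₁ * α * x ^ 2)) ^ 2))
    (hP : ∀ x y z : ℝ, P (x, y, z) =
      (γ * x + (-(γ * g.eval (γ * y + γ * b₁ * x + γ ^ 2 * v₁ * α * x ^ 2 - γ ^ 2 * v₁ * z))),
       γ * y + (-(γ ^ 2 * v₁ * z)
         + γ * (b₁ + 2 * γ * v₁ * α * x) *
             g.eval (γ * y + γ * b₁ * x + γ ^ 2 * v₁ * α * x ^ 2 - γ ^ 2 * v₁ * z)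
         - γ ^ 2 * v₁ * α *
             (g.eval (γ * y + γ * b₁ * x + γ ^ 2 * v₁ * α * x ^ 2 - γ ^ 2 * v₁ * z)) ^ 2),
       γ * z + (-(α * γ *
         (g.eval (γ * y + γ * b₁ * x + γ ^ 2 * v₁ * α * x ^ 2 - γ ^ 2 * v₁ * z)) ^ 2)))) :
    (∀ p : ℝ × ℝ × ℝ, F (P p) = p) ∧ (∀ p : ℝ × ℝ × ℝ, P (F p) = p) := by
  subst hγ
  refine ⟨?_, ?_⟩
  · rintro ⟨x, y, z⟩
    rw [hP]
    set s := 1 / lam * y + 1 / lam * b₁ * x + (1 / lam) ^ 2 * v₁ * α * x ^ 2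
      - (1 / lam) ^ 2 * v₁ * z with hs
    generalize hG : g.eval s = G
    rw [hF]
    have key : 1 / lam * y + (-((1 / lam) ^ 2 * v₁ * z)
        + 1 / lam * (b₁ + 2 * (1 / lam) * v₁ * α * x) * G - (1 / lam) ^ 2 * v₁ * α * G ^ 2)
        + b₁ * (1 / lam * x + (-(1 / lam * G)))
        + v₁ * α * (1 / lam * x + (-(1 / lam * G))) ^ 2 = s := by
      rw [hs]; ring
    rw [key, hG]
    ext <;> simp only <;> field_simp <;> ring
  · rintro ⟨x, y, z⟩
    rw [hF]
    set t := y + b₁ * x + v₁ * α * x ^ 2 with ht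
    generalize hG : g.eval t = G
    rw [hP]
    have key : 1 / lam * (lam * y + (v₁ * z - (b₁ + 2 * v₁ * α * x) * G))
        + 1 / lam * b₁ * (lam * x + G) + (1 / lam) ^ 2 * v₁ * α * (lam * x + G) ^ 2
        - (1 / lam) ^ 2 * v₁ * (lam * z + α * G ^ 2) = t := by
      rw [ht]; field_simp; ring
    rw [key, hG]
    ext <;> simp only <;> field_simp <;> ring
end

section
/- Let λ ≠ 0, γ = 1/λ, let b₁, v₁, α ∈ ℝ with v₁·α ≠ 0, and let g ∈ ℝ[t] be a polynomial with g(0) = 0 and deg g ≥ 1. Define P(x,y,z) = (−γ·g(s), −γ²v₁z + γ(b₁ + 2γv₁αx)·g(s) − γ²v₁α·g(s)², −αγ·g(s)²) where s = γy + γb₁x + γ²v₁αx² − γ²v₁z. Then the Jacobian matrix JP of P is nilpotent with (JP(p))³ = 0 for every p ∈ ℝ³, and the three component functions of P are linearly independent over ℝ. -/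
open MvPolynomial

/-- The Jacobian matrix of the polynomial map `P` (the inverse part of
`λ·id + H`) is nilpotent, `(JP(p))³ = 0` for every `p`, and the components of `P` are
linearly independent over `ℝ`. -/
theorem stmt3 (lam γ b₁ v₁ α : ℝ) (hlam : lam ≠ 0) (hγ : γ = 1 / lam)
    (hv₁α : v₁ * α ≠ 0) (g : Polynomial ℝ) (hg0 : g.eval 0 = 0) (hgdeg : 1 ≤ g.natDegree)
    (s : MvPolynomial (Fin 3) ℝ)
    (hs : s = C γ * X 1 + C (γ * b₁) * X 0 + C (γ ^ 2 * v₁ * α) * X 0 ^ 2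
            - C (γ ^ 2 * v₁) * X 2)
    (P : Fin 3 → MvPolynomial (Fin 3) ℝ)
    (hP : P = ![C (-γ) * Polynomial.aeval s g,
                C (-(γ ^ 2 * v₁)) * X 2
                  + C γ * (C b₁ + C (2 * γ * v₁ * α) * X 0) * Polynomial.aeval s g
                  - C (γ ^ 2 * v₁ * α) * (Polynomial.aeval s g) ^ 2,
                C (-(α * γ)) * (Polynomial.aeval s g) ^ 2]) :
    (∀ p : Fin 3 → ℝ,
      ((Matrix.of fun i j => eval p (pderiv j (P i))) ^ 3 : Matrix (Fin 3) (Fin 3) ℝ) = 0) ∧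
    (∀ c : Fin 3 → ℝ, c 0 • P 0 + c 1 • P 1 + c 2 • P 2 = 0 → c = 0) := by
  subst hP
  have hγ0 : γ ≠ 0 := by rw [hγ]; exact one_div_ne_zero hlam
  have hv : v₁ ≠ 0 := left_ne_zero_of_mul hv₁α
  have hα : α ≠ 0 := right_ne_zero_of_mul hv₁α
  constructor
  · intro p
    have hD : ∀ j, pderiv j (Polynomial.aeval s g)
        = Polynomial.aeval s (Polynomial.derivative g) * pderiv j s := fun j => by
      rw [Derivation.map_aeval, smul_eq_mul]
    have h0 : eval p (pderiv 0 s) = γ * b₁ + 2 * γ ^ 2 * v₁ * α * p 0 := by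
      simp [hs, pderiv_X, Derivation.leibniz_pow]; ring
    have h1 : eval p (pderiv 1 s) = γ := by
      simp [hs, pderiv_X, Derivation.leibniz_pow]
    have h2 : eval p (pderiv 2 s) = -(γ ^ 2 * v₁) := by
      simp [hs, pderiv_X, Derivation.leibniz_pow]
    clear hs
    generalize Polynomial.aeval s g = G at *
    generalize Polynomial.aeval s (Polynomial.derivative g) = G' at *
    ext i j
    fin_cases i <;> fin_cases j <;>
      simp [pow_succ, Matrix.mul_apply, Fin.sum_univ_three, hD, h0, h1, h2, pderiv_X,
        Pi.single_apply, Derivation.leibniz] <;> ring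
  · intro c hc
    have key : ∀ t z : ℝ, c 0 * (-γ * g.eval t)
        + c 1 * (-(γ ^ 2 * v₁) * z + γ * b₁ * g.eval t - γ ^ 2 * v₁ * α * g.eval t ^ 2)
        + c 2 * (-(α * γ) * g.eval t ^ 2) = 0 := fun t z => by
      have hsp : eval ![0, t / γ + γ * v₁ * z, z] s = t := by
        simp [hs]; field_simp; ring
      have hG : eval ![0, t / γ + γ * v₁ * z, z] (Polynomial.aeval s g) = g.eval t := by
        rw [← coe_aeval_eq_eval] at hsp ⊢
        rw [RingHom.coe_coe] at hsp ⊢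
        rw [← Polynomial.aeval_algHom_apply, hsp, Polynomial.coe_aeval_eq_eval]
      have h := congrArg (eval ![0, t / γ + γ * v₁ * z, z]) hc
      simp [smul_eval, hG] at h
      linear_combination h
    have hc1 : c 1 = 0 := by
      have h := key 0 1
      simpa [hg0, hγ0, hv] using h
    have hg : g ≠ 0 := by rintro rfl; simp at hgdeg
    have hfac : g * (Polynomial.C (c 0) + Polynomial.C (c 2 * α) * g) = 0 := by
      refine Polynomial.funext fun t => ?_
      have h := key t 0
      rw [hc1] at h
      simp only [Polynomial.eval_mul, Polynomial.eval_add, Polynomial.eval_C,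
        Polynomial.eval_zero]
      refine mul_left_cancel₀ hγ0 ?_
      linear_combination -h
    have hlin := (mul_eq_zero.mp hfac).resolve_left hg
    have hc0 : c 0 = 0 := by
      simpa [hg0] using congrArg (Polynomial.eval 0) hlin
    have hc2 : c 2 = 0 := by
      simpa [hc0, hα, hg] using hlin
    ext i
    fin_cases i <;> simp [hc0, hc1, hc2]
end

section
/- Let λ ≠ 0, γ = 1/λ, let b₁, v₁, α ∈ ℝ with v₁·α ≠ 0, and let g ∈ ℝ[t] be a polynomial with g(0) = 0. Define u(x,y,z) = −γ·g(s) and v(x,y,z) = −γ²v₁z + γ(b₁ + 2γv₁αx)·g(s) − γ²v₁α·g(s)², where s = γy + γb₁x + γ²v₁αx² − γ²v₁z. Then, with A = vₓ·u_z − uₓ·v_z and B = v_y·u_z − u_y·v_z, one has the identities B = −γ⁴v₁·g′(s) and A = −γ⁴v₁·g′(s)·(b₁ + 2γv₁αx − 2γv₁α·g(s)). -/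
open MvPolynomial

/-- For `u, v` the first two components of the inverse map `P`,
the quantities `A = v_x u_z - u_x v_z` and `B = v_y u_z - u_y v_z` satisfy
`B = -γ⁴v₁ g'(s)` and `A = -γ⁴v₁ g'(s)·(b₁ + 2γv₁αx - 2γv₁α g(s))`. -/
theorem stmt4 (lam γ b₁ v₁ α : ℝ) (hlam : lam ≠ 0) (hγ : γ = 1 / lam)
    (hv₁α : v₁ * α ≠ 0) (g : Polynomial ℝ) (hg0 : g.eval 0 = 0)
    (s : MvPolynomial (Fin 3) ℝ)
    (hs : s = C γ * X 1 + C (γ * b₁) * X 0 + C (γ ^ 2 * v₁ * α) * X 0 ^ 2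
            - C (γ ^ 2 * v₁) * X 2)
    (u v : MvPolynomial (Fin 3) ℝ)
    (hu : u = C (-γ) * Polynomial.aeval s g)
    (hv : v = C (-(γ ^ 2 * v₁)) * X 2
            + C γ * (C b₁ + C (2 * γ * v₁ * α) * X 0) * Polynomial.aeval s g
            - C (γ ^ 2 * v₁ * α) * (Polynomial.aeval s g) ^ 2)
    (A B : MvPolynomial (Fin 3) ℝ)
    (hA : A = pderiv 0 v * pderiv 2 u - pderiv 0 u * pderiv 2 v)
    (hB : B = pderiv 1 v * pderiv 2 u - pderiv 1 u * pderiv 2 v) :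
    B = C (-(γ ^ 4 * v₁)) * Polynomial.aeval s (Polynomial.derivative g) ∧
    A = C (-(γ ^ 4 * v₁)) * Polynomial.aeval s (Polynomial.derivative g) *
          (C b₁ + C (2 * γ * v₁ * α) * X 0 - C (2 * γ * v₁ * α) * Polynomial.aeval s g) := by
  have hd : ∀ i, pderiv i (Polynomial.aeval s g) =
      Polynomial.aeval s (Polynomial.derivative g) * pderiv i s := fun i => by
    rw [Derivation.map_aeval, smul_eq_mul]
  have hx : pderiv 0 s = C (γ * b₁) + 2 * C (γ ^ 2 * v₁ * α) * X 0 := by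
    simp [hs, pderiv_X]
    ring
  have hy : pderiv 1 s = C γ := by
    simp [hs, pderiv_X]
  have hz : pderiv 2 s = -C (γ ^ 2 * v₁) := by
    simp [hs, pderiv_X]
  have h2 : (C 2 : MvPolynomial (Fin 3) ℝ) = 2 := map_ofNat C 2
  subst hA hB hu hv
  simp only [map_add, map_sub, Derivation.leibniz, Derivation.leibniz_pow, hd, hx, hy, hz,
    pderiv_C, pderiv_X, smul_eq_mul]
  generalize Polynomial.aeval s (Polynomial.derivative g) = D
  generalize Polynomial.aeval s g = G
  constructor <;>
  · simp [h2]
    ring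
end

section
/- Let λ ≠ 0, γ = 1/λ, let b₁, v₁, α ∈ ℝ with v₁·α ≠ 0, and let g ∈ ℝ[t] be a polynomial with g(0) = 0 and deg g = k ≥ 1. Define u(x,y,z) = −γ·g(s) and v(x,y,z) = −γ²v₁z + γ(b₁ + 2γv₁αx)·g(s) − γ²v₁α·g(s)², where s = γy + γb₁x + γ²v₁αx² − γ²v₁z, and set A = vₓ·u_z − uₓ·v_z, B = v_y·u_z − u_y·v_z. Then deg_z(u·A) = deg_z(v·B) = 3k − 1, where deg_z denotes the degree in the variable z of a polynomial in ℝ[x,y,z]. -/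
open MvPolynomial

/-- Substituting `s` into a univariate polynomial multiplies degrees in each variable. -/
lemma MvPolynomial.degreeOf_aeval {σ R : Type*} [CommRing R] [IsDomain R] (n : σ)
    (s : MvPolynomial σ R) (p : Polynomial R) :
    degreeOf n (Polynomial.aeval s p) = p.natDegree * degreeOf n s := by
  classical
  simp_rw [degreeOf_eq_natDegree, ← renameEquiv_apply, ← AlgEquiv.trans_apply]
  generalize (renameEquiv R (Equiv.optionSubtypeNe n).symm).trans
    (optionEquivLeft R {b // b ≠ n}) = e
  rw [← Polynomial.aeval_algHom_apply, Polynomial.aeval_def, IsScalarTower.algebraMap_eq R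
    (MvPolynomial {b // b ≠ n} R) (Polynomial (MvPolynomial {b // b ≠ n} R)),
    ← Polynomial.eval₂_map, Polynomial.algebraMap_eq, ← Polynomial.comp, Polynomial.natDegree_comp,
    Polynomial.natDegree_map_eq_of_injective (FaithfulSMul.algebraMap_injective R _)]

/-- With `u, v` the first two components of the inverse map `P` and
`deg g = k ≥ 1`, one has `deg_z(u·A) = deg_z(v·B) = 3k - 1`. -/
theorem stmt5 (lam γ b₁ v₁ α : ℝ) (hlam : lam ≠ 0) (hγ : γ = 1 / lam)
    (hv₁α : v₁ * α ≠ 0) (g : Polynomial ℝ) (hg0 : g.eval 0 = 0)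
    (k : ℕ) (hk : 1 ≤ k) (hgdeg : g.natDegree = k)
    (s : MvPolynomial (Fin 3) ℝ)
    (hs : s = C γ * X 1 + C (γ * b₁) * X 0 + C (γ ^ 2 * v₁ * α) * X 0 ^ 2
            - C (γ ^ 2 * v₁) * X 2)
    (u v : MvPolynomial (Fin 3) ℝ)
    (hu : u = C (-γ) * Polynomial.aeval s g)
    (hv : v = C (-(γ ^ 2 * v₁)) * X 2
            + C γ * (C b₁ + C (2 * γ * v₁ * α) * X 0) * Polynomial.aeval s g
            - C (γ ^ 2 * v₁ * α) * (Polynomial.aeval s g) ^ 2)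
    (A B : MvPolynomial (Fin 3) ℝ)
    (hA : A = pderiv 0 v * pderiv 2 u - pderiv 0 u * pderiv 2 v)
    (hB : B = pderiv 1 v * pderiv 2 u - pderiv 1 u * pderiv 2 v) :
    degreeOf 2 (u * A) = 3 * k - 1 ∧ degreeOf 2 (v * B) = 3 * k - 1 := by
  have hγ0 : γ ≠ 0 := by rw [hγ]; exact one_div_ne_zero hlam
  have hv₁ : v₁ ≠ 0 := left_ne_zero_of_mul hv₁α
  have hα : α ≠ 0 := right_ne_zero_of_mul hv₁α
  have hXC : ∀ i : Fin 3, i ≠ 2 → ∀ c : ℝ, ∀ n : ℕ,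
      degreeOf 2 (C c * X i ^ n : MvPolynomial (Fin 3) ℝ) = 0 := fun i hi c n =>
    Nat.le_zero.mp ((degreeOf_C_mul_le _ _ _).trans (degreeOf_X_pow_of_ne n hi.symm).le)
  have hz : ∀ c : ℝ, c ≠ 0 → degreeOf 2 (C c * X 2 : MvPolynomial (Fin 3) ℝ) = 1 := fun c hc => by
    rw [degreeOf_mul_eq (by simpa using hc) (X_ne_zero _), degreeOf_C, degreeOf_X_self]
  have hw : ∀ c d : ℝ, degreeOf 2 (C c + C d * X 0 : MvPolynomial (Fin 3) ℝ) = 0 := fun c d => by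
    refine Nat.le_zero.mp ((degreeOf_add_le _ _ _).trans ?_)
    simpa using hXC 0 (by decide) d 1
  have hsdeg : degreeOf 2 s = 1 := by
    have h : degreeOf 2 (C γ * X 1 + C (γ * b₁) * X 0 + C (γ ^ 2 * v₁ * α) * X 0 ^ 2 :
        MvPolynomial (Fin 3) ℝ) = 0 := by
      refine Nat.le_zero.mp ((degreeOf_add_le _ _ _).trans (max_le ((degreeOf_add_le _ _ _).trans
        (max_le ?_ ?_)) (hXC 0 (by decide) _ 2).le))
      · simpa using hXC 1 (by decide) γ 1
      · simpa using hXC 0 (by decide) (γ * b₁) 1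
    have hz' := hz (-(γ ^ 2 * v₁)) (by simp [hγ0, hv₁])
    rw [hs, sub_eq_add_neg, add_comm, ← neg_mul, ← C_neg,
      degreeOf_add_eq_of_degreeOf_lt (by rw [h, hz']; exact zero_lt_one), hz']
  have hdeg : ∀ p : Polynomial ℝ, degreeOf 2 (Polynomial.aeval s p) = p.natDegree := fun p => by
    rw [degreeOf_aeval, hsdeg, mul_one]
  have hG : degreeOf 2 (Polynomial.aeval s g) = k := (hdeg g).trans hgdeg
  have hG' : degreeOf 2 (Polynomial.aeval s (Polynomial.derivative g)) = k - 1 := by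
    rw [hdeg, Polynomial.natDegree_derivative, hgdeg]
  have hG0 : Polynomial.aeval s g ≠ 0 := fun h => by simp [h] at hG; omega
  have hG'0 : Polynomial.aeval s (Polynomial.derivative g) ≠ 0 := by
    have hinj : Function.Injective (Polynomial.aeval (R := ℝ) s) := by
      refine (injective_iff_map_eq_zero _).2 fun p hp => ?_
      have hp0 : p.natDegree = 0 := by rw [← hdeg, hp, degreeOf_zero]
      rw [Polynomial.eq_C_of_natDegree_eq_zero hp0] at hp ⊢
      simpa [algebraMap_eq] using hp
    rw [map_ne_zero_iff _ hinj]
    exact fun h => by have := Polynomial.derivative_eq_zero.1 h; omega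
  have hCG : ∀ c : ℝ, c ≠ 0 → ∀ n : ℕ,
      degreeOf 2 (C c * Polynomial.aeval s g ^ n) = n * k := fun c hc n => by
    rw [degreeOf_mul_eq (by simpa using hc) (pow_ne_zero _ hG0), degreeOf_C, zero_add,
      degreeOf_pow_eq _ _ _ hG0, hG]
  have hdx : ∀ i, pderiv i (Polynomial.aeval s g) =
      Polynomial.aeval s (Polynomial.derivative g) * pderiv i s := fun i => by
    rw [Derivation.map_aeval, smul_eq_mul]
  have hs0 : pderiv 0 s = C γ * (C b₁ + C (2 * γ * v₁ * α) * X 0) := by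
    rw [hs]
    have hC2 : (C 2 : MvPolynomial (Fin 3) ℝ) = 2 := map_ofNat C 2
    simp [pderiv_X, hC2]
    ring
  have hs1 : pderiv 1 s = C γ := by rw [hs]; simp [pderiv_X]
  have hs2 : pderiv 2 s = - C (γ ^ 2 * v₁) := by rw [hs]; simp [pderiv_X]
  have hA' : A = C (γ ^ 3 * v₁) * Polynomial.aeval s (Polynomial.derivative g) *
      (C (2 * γ ^ 2 * v₁ * α) * Polynomial.aeval s g ^ 1
        + C (-γ) * (C b₁ + C (2 * γ * v₁ * α) * X 0)) := by
    rw [hA, hu, hv]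
    simp [hdx, hs0, hs2, pderiv_X]
    ring
  have hB' : B = C (-γ ^ 4 * v₁) * Polynomial.aeval s (Polynomial.derivative g) := by
    rw [hB, hu, hv]
    simp [hdx, hs1, hs2, pderiv_X]
    ring
  constructor
  · have h1 := hCG (2 * γ ^ 2 * v₁ * α) (by simp [hγ0, hv₁, hα]) 1
    have h2 : degreeOf 2 (C (2 * γ ^ 2 * v₁ * α) * Polynomial.aeval s g ^ 1
        + C (-γ) * (C b₁ + C (2 * γ * v₁ * α) * X 0)) = k := by
      rw [degreeOf_add_eq_of_degreeOf_lt, h1, one_mul]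
      exact ((degreeOf_C_mul_le _ _ _).trans (hw _ _).le).trans_lt (by omega)
    have h3 := ne_zero_of_degreeOf_ne_zero (h2.trans_ne (by omega))
    have hc : (C (γ ^ 3 * v₁) : MvPolynomial (Fin 3) ℝ) ≠ 0 := by simp [hγ0, hv₁]
    have hc' : (C (-γ) : MvPolynomial (Fin 3) ℝ) ≠ 0 := by simp [hγ0]
    rw [hu, hA', degreeOf_mul_eq (mul_ne_zero hc' hG0) (mul_ne_zero (mul_ne_zero hc hG'0) h3),
      degreeOf_mul_eq hc' hG0, degreeOf_mul_eq (mul_ne_zero hc hG'0) h3,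
      degreeOf_mul_eq hc hG'0, h2, hG, hG', degreeOf_C, degreeOf_C]
    omega
  · have h1 := hCG (-(γ ^ 2 * v₁ * α)) (by simp [hγ0, hv₁, hα]) 2
    have h2 : degreeOf 2 v = 2 * k := by
      have hlow : degreeOf 2 (C (-(γ ^ 2 * v₁)) * X 2
          + C γ * (C b₁ + C (2 * γ * v₁ * α) * X 0) * Polynomial.aeval s g) ≤ k := by
        refine (degreeOf_add_le _ _ _).trans (max_le ?_ ?_)
        · exact ((degreeOf_C_mul_le _ _ _).trans (degreeOf_X_self _).le).trans hk
        · rw [mul_assoc]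
          refine (degreeOf_C_mul_le _ _ _).trans ((degreeOf_mul_le _ _ _).trans ?_)
          rw [hw, hG, zero_add]
      rw [hv, sub_eq_add_neg, add_comm, ← neg_mul, ← C_neg,
        degreeOf_add_eq_of_degreeOf_lt (by rw [h1]; omega), h1]
    have h3 : v ≠ 0 := ne_zero_of_degreeOf_ne_zero (h2.trans_ne (by omega))
    have hc : (C (-γ ^ 4 * v₁) : MvPolynomial (Fin 3) ℝ) ≠ 0 := by simp [hγ0, hv₁]
    rw [hB', degreeOf_mul_eq h3 (mul_ne_zero hc hG'0), degreeOf_mul_eq hc hG'0, h2, hG',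
      degreeOf_C]
    omega
end

section
/- Let λ ≠ 0 and γ = 1/λ. Let a, b, c, d ∈ ℝ[z] be polynomials and let f(t,z) be a polynomial in two variables. Define P(x,y,z) = −b(z)·f(a(z)x + b(z)y, z) + c(z) and Q(x,y,z) = a(z)·f(a(z)x + b(z)y, z) + d(z). Then the polynomial map λ·id + (P, Q, 0), i.e. (x,y,z) ↦ (λx + P, λy + Q, λz), is bijective with inverse γ·id + (R, S, 0), where R(x,y,z) = γ·b(γz)·f(γ·(a(γz)x + b(γz)y − a(γz)c(γz) − b(γz)d(γz)), γz) − γ·c(γz) and S(x,y,z) = −γ·a(γz)·f(γ·(a(γz)x + b(γz)y − a(γz)c(γz) − b(γz)d(γz)), γz) − γ·d(γz); that is, the composition of the two maps in either order is the identity of ℝ³. -/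
/-- With `a, b, c, d ∈ ℝ[z]` and `f(t,z)` a polynomial in two variables,
the triangular map `λ·id + (P, Q, 0)` is bijective, with inverse `γ·id + (R, S, 0)`. -/
theorem stmt7 (lam γ : ℝ) (hlam : lam ≠ 0) (hγ : γ = 1 / lam)
    (a b c d : Polynomial ℝ) (f : MvPolynomial (Fin 2) ℝ)
    (F G : ℝ × ℝ × ℝ → ℝ × ℝ × ℝ)
    (hF : ∀ x y z : ℝ, F (x, y, z) =
      (lam * x + (-(b.eval z) *
          MvPolynomial.eval ![a.eval z * x + b.eval z * y, z] f + c.eval z),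
       lam * y + (a.eval z *
          MvPolynomial.eval ![a.eval z * x + b.eval z * y, z] f + d.eval z),
       lam * z))
    (hG : ∀ x y z : ℝ, G (x, y, z) =
      (γ * x + (γ * b.eval (γ * z) *
          MvPolynomial.eval
            ![γ * (a.eval (γ * z) * x + b.eval (γ * z) * y
                - a.eval (γ * z) * c.eval (γ * z) - b.eval (γ * z) * d.eval (γ * z)),
              γ * z] f
          - γ * c.eval (γ * z)),
       γ * y + (-(γ * a.eval (γ * z)) *
          MvPolynomial.eval
            ![γ * (a.eval (γ * z) * x + b.eval (γ * z) * y
                - a.eval (γ * z) * c.eval (γ * z) - b.eval (γ * z) * d.eval (γ * z)),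
              γ * z] f
          - γ * d.eval (γ * z)),
       γ * z)) :
    Function.Bijective F ∧ (∀ p : ℝ × ℝ × ℝ, F (G p) = p) ∧
      (∀ p : ℝ × ℝ × ℝ, G (F p) = p) := by
  have hmul : lam * γ = 1 := by rw [hγ]; field_simp
  have hFG : ∀ p : ℝ × ℝ × ℝ, F (G p) = p := by
    rintro ⟨x, y, z⟩
    rw [hG, hF]
    generalize a.eval (γ * z) = A
    generalize b.eval (γ * z) = B
    generalize c.eval (γ * z) = C
    generalize d.eval (γ * z) = D
    set t := γ * (A * x + B * y - A * C - B * D) with ht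
    generalize hφ : MvPolynomial.eval ![t, γ * z] f = φ
    have harg : A * (γ * x + (γ * B * φ - γ * C)) + B * (γ * y + (-(γ * A) * φ - γ * D)) = t := by
      rw [ht]; ring
    rw [harg, hφ]
    refine Prod.ext ?_ (Prod.ext ?_ ?_)
    · linear_combination (x + B * φ - C) * hmul
    · linear_combination (y - A * φ - D) * hmul
    · linear_combination z * hmul
  have hGF : ∀ p : ℝ × ℝ × ℝ, G (F p) = p := by
    rintro ⟨x, y, z⟩
    have hz : γ * (lam * z) = z := by linear_combination z * hmul
    rw [hF, hG, hz]
    generalize a.eval z = A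
    generalize b.eval z = B
    generalize c.eval z = C
    generalize d.eval z = D
    generalize hφ : MvPolynomial.eval ![A * x + B * y, z] f = φ
    have harg : γ * (A * (lam * x + (-B * φ + C)) + B * (lam * y + (A * φ + D))
        - A * C - B * D) = A * x + B * y := by
      linear_combination (A * x + B * y) * hmul
    rw [harg, hφ]
    refine Prod.ext ?_ (Prod.ext ?_ rfl)
    · linear_combination x * hmul
    · linear_combination y * hmul
  exact ⟨Function.bijective_iff_has_inverse.mpr ⟨G, hGF, hFG⟩, hFG, hGF⟩
end

section
/- Fix an integer k ≥ 1, real numbers c ≤ a < 0, b ∈ ℝ, and coefficients a₂, a₄, …, a₂ₖ > 0; set R(z) = Σ_{i=1}^k a_{2i} z^{2i}, and define F : ℝ³ → ℝ³ by F(x,y,z) = (y + (ax + by)·R(z), −x + (−bx + cy)·R(z), −z·R(z)). Then F is an almost Hurwitz vector field: for every point (x,y,z) with z ≠ 0, all complex eigenvalues of the Jacobian matrix JF(x,y,z) have strictly negative real part, while for every point (x,y,0) all complex eigenvalues of JF(x,y,0) have real part equal to zero. -/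
/-- Monic real quadratics with positive coefficients are Hurwitz. -/
theorem re_neg_of_sq_add_mul_add_eq_zero {s d : ℝ} (hs : 0 < s) (hd : 0 < d) {μ : ℂ}
    (h : μ ^ 2 + s * μ + d = 0) : μ.re < 0 := by
  have hre := congrArg Complex.re h
  have him := congrArg Complex.im h
  simp [pow_two] at hre him
  have hprod : μ.im * (2 * μ.re + s) = 0 := by linarith
  rcases mul_eq_zero.mp hprod with h0 | h0
  · by_contra! hn
    rw [h0] at hre
    nlinarith [mul_nonneg hs.le hn, mul_nonneg hn hn]
  · linarith

/-- Roots of `μ ^ 2 + d` with `0 < d` are purely imaginary. -/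
theorem re_eq_zero_of_sq_add_eq_zero {d : ℝ} (hd : 0 < d) {μ : ℂ}
    (h : μ ^ 2 + d = 0) : μ.re = 0 := by
  have hre := congrArg Complex.re h
  have him := congrArg Complex.im h
  simp [pow_two] at hre him
  have hprod : μ.re * μ.im = 0 := by linarith
  rcases mul_eq_zero.mp hprod with h0 | h0
  · exact h0
  · rw [h0] at hre
    nlinarith [mul_self_nonneg μ.re]

/-- The characteristic polynomial of a block upper triangular `3 × 3` matrix, at its roots. -/
theorem Matrix.eq_or_eq_of_isRoot_charpoly_fin_three {M : Matrix (Fin 3) (Fin 3) ℂ}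
    (h20 : M 2 0 = 0) (h21 : M 2 1 = 0) {μ : ℂ} (h : M.charpoly.IsRoot μ) :
    μ = M 2 2 ∨ (μ - M 0 0) * (μ - M 1 1) - M 0 1 * M 1 0 = 0 := by
  rw [Polynomial.IsRoot, Matrix.eval_charpoly, Matrix.det_fin_three] at h
  simp [Matrix.scalar_apply, h20, h21] at h
  have hprod : (μ - M 2 2) * ((μ - M 0 0) * (μ - M 1 1) - M 0 1 * M 1 0) = 0 := by
    linear_combination h
  exact (mul_eq_zero.mp hprod).imp_left sub_eq_zero.mp

/-- Partial derivatives of `q ↦ ℓ q + m q * R (q 2)` for linear forms `ℓ` and `m`. -/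
theorem fderiv_add_mul_comp_apply_two (ℓ m : (Fin 3 → ℝ) →L[ℝ] ℝ) {R : ℝ → ℝ} {r : ℝ}
    {p : Fin 3 → ℝ} (hR : HasDerivAt R r (p 2)) (v : Fin 3 → ℝ) :
    fderiv ℝ (fun q => ℓ q + m q * R (q 2)) p v = ℓ v + (m v * R (p 2) + m p * (r * v 2)) := by
  have hcomp : HasFDerivAt (fun q : Fin 3 → ℝ => R (q 2))
      (r • ContinuousLinearMap.proj (R := ℝ) (φ := fun _ : Fin 3 => ℝ) 2) p :=
    hR.comp_hasFDerivAt p (hasFDerivAt_apply 2 p)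
  have hF : HasFDerivAt (fun q => ℓ q + m q * R (q 2)) _ p :=
    ℓ.hasFDerivAt.add (m.hasFDerivAt.mul hcomp)
  rw [hF.fderiv]
  simp
  ring


/-- The vector field
`F(x,y,z) = (y + (ax+by)R(z), -x + (-bx+cy)R(z), -zR(z))`, with `c ≤ a < 0` and
`R(z) = Σ_{i=1}^k a_{2i} z^{2i}` with positive coefficients, is almost Hurwitz: all
eigenvalues of `JF` have negative real part when `z ≠ 0`, and zero real part when `z = 0`. -/
theorem stmt9 (k : ℕ) (hk : 1 ≤ k) (a b c : ℝ) (hca : c ≤ a) (ha : a < 0)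
    (coef : ℕ → ℝ) (hcoef : ∀ i ∈ Finset.Icc 1 k, 0 < coef i)
    (R : ℝ → ℝ) (hR : ∀ z, R z = ∑ i ∈ Finset.Icc 1 k, coef i * z ^ (2 * i))
    (F : (Fin 3 → ℝ) → (Fin 3 → ℝ))
    (hF : ∀ p, F p = ![p 1 + (a * p 0 + b * p 1) * R (p 2),
                       -p 0 + (-b * p 0 + c * p 1) * R (p 2),
                       -(p 2) * R (p 2)])
    (J : (Fin 3 → ℝ) → Matrix (Fin 3) (Fin 3) ℝ)
    (hJ : ∀ p, J p = Matrix.of fun i j => fderiv ℝ (fun q => F q i) p (Pi.single j 1)) :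
    ∀ p : Fin 3 → ℝ,
      (p 2 ≠ 0 → ∀ μ : ℂ,
        ((J p).map (fun r => (r : ℂ))).charpoly.IsRoot μ → μ.re < 0) ∧
      (p 2 = 0 → ∀ μ : ℂ,
        ((J p).map (fun r => (r : ℂ))).charpoly.IsRoot μ → μ.re = 0) := by
  intro p
  set S : ℝ := ∑ i ∈ Finset.Icc 1 k, coef i * ((2 * i : ℕ) * p 2 ^ (2 * i - 1)) with hS
  have hderiv : HasDerivAt R S (p 2) := by
    rw [funext hR]
    exact HasDerivAt.fun_sum fun i _ => (hasDerivAt_pow (2 * i) (p 2)).const_mul (coef i)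
  have hzS : p 2 * S = ∑ i ∈ Finset.Icc 1 k, (2 * i : ℕ) * (coef i * p 2 ^ (2 * i)) := by
    rw [hS, Finset.mul_sum]
    refine Finset.sum_congr rfl fun i hi => ?_
    have hi1 := (Finset.mem_Icc.mp hi).1
    rw [show p 2 ^ (2 * i) = p 2 ^ (2 * i - 1) * p 2 by
      rw [← pow_succ, Nat.sub_add_cancel (by lia)]]
    ring
  let e (i : Fin 3) : (Fin 3 → ℝ) →L[ℝ] ℝ := ContinuousLinearMap.proj i
  have hJ0 (j : Fin 3) : J p 0 j = fderiv ℝ (fun q => e 1 q + (a • e 0 + b • e 1) q * R (q 2))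
      p (Pi.single j 1) := by
    simp [hJ, hF, e]
  have hJ1 (j : Fin 3) : J p 1 j =
      fderiv ℝ (fun q => (-e 0) q + (-b • e 0 + c • e 1) q * R (q 2)) p (Pi.single j 1) := by
    simp [hJ, hF, e]
  have hJ2 (j : Fin 3) : J p 2 j =
      fderiv ℝ (fun q => (0 : (Fin 3 → ℝ) →L[ℝ] ℝ) q + (-e 2) q * R (q 2)) p
        (Pi.single j 1) := by
    simp [hJ, hF, e]
  simp only [fderiv_add_mul_comp_apply_two _ _ hderiv] at hJ0 hJ1 hJ2
  have h00 : J p 0 0 = a * R (p 2) := by simp [hJ0, e]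
  have h01 : J p 0 1 = 1 + b * R (p 2) := by simp [hJ0, e]
  have h10 : J p 1 0 = -(1 + b * R (p 2)) := by simp [hJ1, e]; ring
  have h11 : J p 1 1 = c * R (p 2) := by simp [hJ1, e]
  have h20 : J p 2 0 = 0 := by simp [hJ2, e]
  have h21 : J p 2 1 = 0 := by simp [hJ2, e]
  have h22 : J p 2 2 = -(R (p 2) + p 2 * S) := by simp [hJ2, e]; ring
  have key {μ : ℂ} (h : ((J p).map (fun r => (r : ℂ))).charpoly.IsRoot μ) :=
    Matrix.eq_or_eq_of_isRoot_charpoly_fin_three (by simp [h20]) (by simp [h21]) h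
  simp only [Matrix.map_apply, h00, h01, h10, h11, h22] at key
  constructor
  · intro hz μ hμ
    have hterm : ∀ i ∈ Finset.Icc 1 k, 0 < coef i * p 2 ^ (2 * i) := fun i hi =>
      mul_pos (hcoef i hi) ((even_two_mul i).pow_pos hz)
    have hRpos : 0 < R (p 2) := by
      rw [hR]
      exact Finset.sum_pos hterm (Finset.nonempty_Icc.mpr hk)
    have hzS_nonneg : 0 ≤ p 2 * S := by
      rw [hzS]
      exact Finset.sum_nonneg fun i hi => mul_nonneg (Nat.cast_nonneg _) (hterm i hi).le
    rcases key hμ with h | h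
    · rw [h, Complex.ofReal_re]
      linarith
    · have hc : c < 0 := hca.trans_lt ha
      have hs : 0 < -(a + c) * R (p 2) := mul_pos (by linarith) hRpos
      have hd : 0 < a * c * R (p 2) ^ 2 + (1 + b * R (p 2)) ^ 2 := by
        have := mul_pos_of_neg_of_neg ha hc
        positivity
      refine re_neg_of_sq_add_mul_add_eq_zero hs hd ?_
      push_cast at h ⊢
      linear_combination h
  · intro hz μ hμ
    have hR0 : R (p 2) = 0 := by
      rw [hR, hz]
      refine Finset.sum_eq_zero fun i hi => ?_
      have hi1 := (Finset.mem_Icc.mp hi).1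
      rw [zero_pow (by lia), mul_zero]
    rcases key hμ with h | h
    · rw [h, hR0, hz]
      simp
    · refine re_eq_zero_of_sq_add_eq_zero one_pos ?_
      simp only [hR0] at h
      push_cast at h ⊢
      linear_combination h
end

section
/- Fix an integer k ≥ 1, real numbers c ≤ a < 0, b ∈ ℝ, and coefficients a₂, a₄, …, a₂ₖ > 0; set R(z) = Σ_{i=1}^k a_{2i} z^{2i}, define F : ℝ³ → ℝ³ by F(x,y,z) = (y + (ax + by)·R(z), −x + (−bx + cy)·R(z), −z·R(z)), and let ρ(x,y,z) = (x² + y² + R(z))^{−α}. If α > max{2, (a + c − 1 − 2k)/(2a), (3 − a − c)/2}, then the divergence of ρF satisfies ∇·(ρF)(x,y,z) > 0 at every point with z ≠ 0, and ∇·(ρF)(x,y,z) = 0 at every point (x,y,0) ≠ (0,0,0). -/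
lemma hasDerivAt_sum_even_powers (k : ℕ) (coef : ℕ → ℝ) (z : ℝ) :
    HasDerivAt (fun z : ℝ => ∑ i ∈ Finset.Icc 1 k, coef i * z ^ (2 * i))
      (∑ i ∈ Finset.Icc 1 k, coef i * (((2 * i : ℕ) : ℝ) * z ^ (2 * i - 1))) z :=
  HasDerivAt.fun_sum fun i _ => (hasDerivAt_pow (2 * i) z).const_mul (coef i)

/-- The Euler operator `z d/dz` acts on an even polynomial of degree at most `2 * k` without
constant term with eigenvalues between `2` and `2 * k`. -/
lemma euler_sum_even_powers_bounds (k : ℕ) (coef : ℕ → ℝ)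
    (hcoef : ∀ i ∈ Finset.Icc 1 k, 0 < coef i) (z : ℝ) :
    2 * (∑ i ∈ Finset.Icc 1 k, coef i * z ^ (2 * i)) ≤
        z * ∑ i ∈ Finset.Icc 1 k, coef i * (((2 * i : ℕ) : ℝ) * z ^ (2 * i - 1)) ∧
      z * ∑ i ∈ Finset.Icc 1 k, coef i * (((2 * i : ℕ) : ℝ) * z ^ (2 * i - 1)) ≤
        2 * (k : ℝ) * ∑ i ∈ Finset.Icc 1 k, coef i * z ^ (2 * i) := by
  have key : ∀ i ∈ Finset.Icc 1 k, z * (coef i * (((2 * i : ℕ) : ℝ) * z ^ (2 * i - 1))) =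
      2 * (i : ℝ) * (coef i * z ^ (2 * i)) := by
    intro i hi
    have hpos : 2 * i ≠ 0 := by have := (Finset.mem_Icc.1 hi).1; lia
    rw [← mul_pow_sub_one hpos z]
    push_cast
    ring
  have hnn : ∀ i ∈ Finset.Icc 1 k, 0 ≤ coef i * z ^ (2 * i) := fun i hi =>
    mul_nonneg (hcoef i hi).le ((even_two_mul i).pow_nonneg z)
  simp only [Finset.mul_sum]
  rw [Finset.sum_congr rfl key]
  constructor <;> refine Finset.sum_le_sum fun i hi => mul_le_mul_of_nonneg_right ?_ (hnn i hi)
  · have : (1 : ℝ) ≤ i := by exact_mod_cast (Finset.mem_Icc.1 hi).1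
    linarith
  · have : (i : ℝ) ≤ k := by exact_mod_cast (Finset.mem_Icc.1 hi).2
    linarith

lemma sum_even_powers_pos (k : ℕ) (hk : 1 ≤ k) (coef : ℕ → ℝ)
    (hcoef : ∀ i ∈ Finset.Icc 1 k, 0 < coef i) {z : ℝ} (hz : z ≠ 0) :
    0 < ∑ i ∈ Finset.Icc 1 k, coef i * z ^ (2 * i) :=
  Finset.sum_pos (fun i hi => mul_pos (hcoef i hi) ((even_two_mul i).pow_pos hz))
    ⟨1, Finset.mem_Icc.2 ⟨le_rfl, hk⟩⟩

lemma sum_even_powers_zero (k : ℕ) (coef : ℕ → ℝ) :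
    ∑ i ∈ Finset.Icc 1 k, coef i * (0 : ℝ) ^ (2 * i) = 0 :=
  Finset.sum_eq_zero fun i hi => by
    have : 2 * i ≠ 0 := by have := (Finset.mem_Icc.1 hi).1; lia
    rw [zero_pow this, mul_zero]

/-- The sign of `∇·(ρF)` is that of this expression, in which `u`, `v`, `r`, `d` stand for
`x ^ 2`, `y ^ 2`, `R z` and `z * R' z`. -/
lemma divergence_factor_pos {a c α K u v r d : ℝ} (hca : c ≤ a)
    (hα : 2 < α) (h1 : 2 * a * α < a + c - 1 - 2 * K) (h2 : 3 - a - c < 2 * α)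
    (hu : 0 ≤ u) (hv : 0 ≤ v) (hr : 0 < r) (hd : 2 * r ≤ d) (hd' : d ≤ 2 * K * r) :
    0 < -α * (2 * a * u + 2 * c * v - d) * r + (u + v + r) * ((a + c - 1) * r - d) := by
  have e1 : 0 ≤ (u + v) * (2 * K * r - d) := mul_nonneg (by linarith) (by linarith)
  have e2 : 0 ≤ (u + v) * r * (a + c - 1 - 2 * K - 2 * a * α) :=
    mul_nonneg (by positivity) (by linarith)
  have e3 : 0 ≤ v * r * (2 * α * (a - c)) :=
    mul_nonneg (by positivity) (mul_nonneg (by linarith) (by linarith))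
  have e4 : 0 ≤ r * ((α - 1) * (d - 2 * r)) :=
    mul_nonneg hr.le (mul_nonneg (by linarith) (by linarith))
  have e5 : 0 < r * r * (2 * α - (3 - a - c)) := mul_pos (by positivity) (by linarith)
  linarith


/-- With `F` as in the almost-Hurwitz family and
`ρ(x,y,z) = (x² + y² + R(z))^{-α}` for `α > max{2, (a+c-1-2k)/(2a), (3-a-c)/2}`, the
divergence `∇·(ρF) = ∇ρ·F + ρ(∇·F)` is positive whenever `z ≠ 0` and vanishes on
`z = 0` away from the origin. -/
theorem stmt10 (k : ℕ) (hk : 1 ≤ k) (a b c : ℝ) (hca : c ≤ a) (ha : a < 0)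
    (coef : ℕ → ℝ) (hcoef : ∀ i ∈ Finset.Icc 1 k, 0 < coef i)
    (R : ℝ → ℝ) (hR : ∀ z, R z = ∑ i ∈ Finset.Icc 1 k, coef i * z ^ (2 * i))
    (F : (Fin 3 → ℝ) → (Fin 3 → ℝ))
    (hF : ∀ p, F p = ![p 1 + (a * p 0 + b * p 1) * R (p 2),
                       -p 0 + (-b * p 0 + c * p 1) * R (p 2),
                       -(p 2) * R (p 2)])
    (α : ℝ)
    (hα : max 2 (max ((a + c - 1 - 2 * (k : ℝ)) / (2 * a)) ((3 - a - c) / 2)) < α)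
    (ρ : (Fin 3 → ℝ) → ℝ)
    (hρ : ∀ p, ρ p = ((p 0) ^ 2 + (p 1) ^ 2 + R (p 2)) ^ (-α))
    (dv : (Fin 3 → ℝ) → ℝ)
    (hdv : ∀ p, dv p = fderiv ℝ ρ p (F p) +
        ρ p * ∑ i, fderiv ℝ (fun q => F q i) p (Pi.single i 1)) :
    ∀ p : Fin 3 → ℝ,
      (p 2 ≠ 0 → 0 < dv p) ∧ (p 2 = 0 → p ≠ 0 → dv p = 0) := by
  intro p
  set R' : ℝ := ∑ i ∈ Finset.Icc 1 k, coef i * (((2 * i : ℕ) : ℝ) * (p 2) ^ (2 * i - 1)) with hR'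
  have hRd : HasDerivAt R R' (p 2) := by
    rw [funext hR]
    exact hasDerivAt_sum_even_powers k coef (p 2)
  have hx (i : Fin 3) :
      HasFDerivAt (fun q : Fin 3 → ℝ => q i) (ContinuousLinearMap.proj (R := ℝ) i) p :=
    hasFDerivAt_apply i p
  have hRz := hRd.comp_hasFDerivAt p (hx 2)
  have dF0 := (hx 1).add ((((hx 0).const_mul a).add ((hx 1).const_mul b)).mul hRz)
  have dF1 := (hx 0).neg.add ((((hx 0).const_mul (-b)).add ((hx 1).const_mul c)).mul hRz)
  have dF2 := (hx 2).neg.mul hRz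
  have divF : ∑ i, fderiv ℝ (fun q => F q i) p (Pi.single i 1) =
      (a + c - 1) * R (p 2) - p 2 * R' := by
    have f0 : (fun q => F q 0) = fun q => q 1 + (a * q 0 + b * q 1) * R (q 2) := by
      ext q; simp [hF]
    have f1 : (fun q => F q 1) = fun q => -q 0 + (-b * q 0 + c * q 1) * R (q 2) := by
      ext q; simp [hF]
    have f2 : (fun q => F q 2) = fun q => -(q 2) * R (q 2) := by
      ext q; simp [hF]
    rw [Fin.sum_univ_three, f0, f1, f2]
    erw [dF0.fderiv, dF1.fderiv, dF2.fderiv]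
    simp
    ring
  have main (hS : 0 < p 0 ^ 2 + p 1 ^ 2 + R (p 2)) :
      dv p = (p 0 ^ 2 + p 1 ^ 2 + R (p 2)) ^ (-α - 1) *
        (-α * (2 * a * p 0 ^ 2 + 2 * c * p 1 ^ 2 - p 2 * R') * R (p 2) +
          (p 0 ^ 2 + p 1 ^ 2 + R (p 2)) * ((a + c - 1) * R (p 2) - p 2 * R')) := by
    have dS : HasFDerivAt (fun q : Fin 3 → ℝ => q 0 ^ 2 + q 1 ^ 2 + R (q 2)) _ p :=
      (((hx 0).pow 2).add ((hx 1).pow 2)).add hRz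
    have hpow : (p 0 ^ 2 + p 1 ^ 2 + R (p 2)) ^ (-α) =
        (p 0 ^ 2 + p 1 ^ 2 + R (p 2)) ^ (-α - 1) * (p 0 ^ 2 + p 1 ^ 2 + R (p 2)) := by
      rw [← Real.rpow_add_one hS.ne', sub_add_cancel]
    have dρ := dS.rpow_const (p := -α) (Or.inl hS.ne')
    rw [hdv, divF, hρ, funext hρ, dρ.fderiv, hpow, hF]
    simp
    ring
  simp only [max_lt_iff] at hα
  obtain ⟨hα2, hα1, hα3⟩ := hα
  rw [div_lt_iff_of_neg (by linarith)] at hα1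
  rw [div_lt_iff₀ two_pos] at hα3
  constructor
  · intro hz
    have hRpos : 0 < R (p 2) := by
      rw [hR]
      exact sum_even_powers_pos k hk coef hcoef hz
    have hS : 0 < p 0 ^ 2 + p 1 ^ 2 + R (p 2) := by positivity
    obtain ⟨hd, hd'⟩ := euler_sum_even_powers_bounds k coef hcoef (p 2)
    rw [← hR, ← hR'] at hd hd'
    rw [main hS]
    exact mul_pos (Real.rpow_pos_of_pos hS _)
      (divergence_factor_pos hca hα2 (by linarith) (by linarith) (sq_nonneg _) (sq_nonneg _)
        hRpos hd hd')
  · intro hz hp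
    have hR0 : R (p 2) = 0 := by rw [hz, hR, sum_even_powers_zero]
    have hS : 0 < p 0 ^ 2 + p 1 ^ 2 + R (p 2) := by
      rw [hR0, add_zero]
      refine lt_of_le_of_ne (by positivity) fun h => hp ?_
      have h0 : p 0 = 0 := by nlinarith [sq_nonneg (p 0), sq_nonneg (p 1)]
      have h1 : p 1 = 0 := by nlinarith [sq_nonneg (p 0), sq_nonneg (p 1)]
      ext i
      fin_cases i <;> assumption
    rw [main hS, hR0, hz]
    ring
end

section
/- Fix an integer k ≥ 1 and coefficients a₂, a₄, …, a₂ₖ > 0; set R(z) = Σ_{i=1}^k a_{2i} z^{2i}. If α > 2, then the function ρ(x,y,z) = (x² + y² + R(z))^{−α} is Lebesgue integrable on the region {(x,y,z) ∈ ℝ³ : x² + y² + z² ≥ 1}. -/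
open MeasureTheory

/-- For `R(z) = Σ_{i=1}^k a_{2i} z^{2i}` with positive coefficients and
`α > 2`, the function `ρ(x,y,z) = (x² + y² + R(z))^{-α}` is Lebesgue integrable on the
region `{x² + y² + z² ≥ 1}`. -/
theorem stmt11 (k : ℕ) (hk : 1 ≤ k)
    (coef : ℕ → ℝ) (hcoef : ∀ i ∈ Finset.Icc 1 k, 0 < coef i)
    (R : ℝ → ℝ) (hR : ∀ z, R z = ∑ i ∈ Finset.Icc 1 k, coef i * z ^ (2 * i))
    (α : ℝ) (hα : 2 < α) :
    IntegrableOn (fun p : Fin 3 → ℝ => ((p 0) ^ 2 + (p 1) ^ 2 + R (p 2)) ^ (-α))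
      {p : Fin 3 → ℝ | 1 ≤ (p 0) ^ 2 + (p 1) ^ 2 + (p 2) ^ 2} volume := by
  have h1 : 1 ∈ Finset.Icc 1 k := by simp [hk]
  have hc := hcoef 1 h1
  have hRge : ∀ z, coef 1 * z ^ 2 ≤ R z := fun z => by
    rw [hR]
    exact Finset.single_le_sum (f := fun i => coef i * z ^ (2 * i))
      (fun i hi => mul_nonneg (hcoef i hi).le ((even_two_mul i).pow_nonneg z)) h1
  have hRm : Measurable R := by
    rw [funext hR]
    fun_prop
  set m := min 1 (coef 1) with hm
  have hm0 : 0 < m := lt_min one_pos hc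
  have hm1 : m ≤ 1 := min_le_left _ _
  have hmc : m ≤ coef 1 := min_le_right _ _
  have hS : MeasurableSet {p : Fin 3 → ℝ | 1 ≤ (p 0) ^ 2 + (p 1) ^ 2 + (p 2) ^ 2} :=
    measurableSet_le (by fun_prop) (by fun_prop)
  have hint : Integrable
      (fun p : Fin 3 → ℝ => (m / 2) ^ (-α) * (1 + ‖p‖ ^ 2) ^ (-(2 * α) / 2)) volume :=
    (integrable_rpow_neg_one_add_norm_sq (by norm_num; linarith)).const_mul _
  have hmeas : Measurable
      (fun p : Fin 3 → ℝ => ((p 0) ^ 2 + (p 1) ^ 2 + R (p 2)) ^ (-α)) :=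
    Measurable.pow_const (by fun_prop) _
  refine hint.integrableOn.mono' hmeas.aestronglyMeasurable
    ((ae_restrict_iff' hS).2 (.of_forall fun p hp => ?_))
  have hp : 1 ≤ (p 0) ^ 2 + (p 1) ^ 2 + (p 2) ^ 2 := hp
  have hnorm : ‖p‖ ^ 2 ≤ (p 0) ^ 2 + (p 1) ^ 2 + (p 2) ^ 2 := by
    rw [← Real.le_sqrt (norm_nonneg _) (by positivity), pi_norm_le_iff_of_nonneg (by positivity)]
    intro i
    refine Real.abs_le_sqrt ?_
    fin_cases i <;> simp <;> nlinarith [sq_nonneg (p 0), sq_nonneg (p 1), sq_nonneg (p 2)]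
  have hle : m / 2 * (1 + ‖p‖ ^ 2) ≤ (p 0) ^ 2 + (p 1) ^ 2 + R (p 2) := by
    have := hRge (p 2)
    nlinarith [mul_le_mul_of_nonneg_right hm1 (sq_nonneg (p 0)),
      mul_le_mul_of_nonneg_right hm1 (sq_nonneg (p 1)),
      mul_le_mul_of_nonneg_right hmc (sq_nonneg (p 2))]
  have hpos : 0 < m / 2 * (1 + ‖p‖ ^ 2) := by positivity
  rw [Real.norm_of_nonneg (Real.rpow_nonneg (hpos.le.trans hle) _),
    show -(2 * α) / 2 = -α by ring, ← Real.mul_rpow (by positivity) (by positivity)]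
  exact Real.rpow_le_rpow_of_nonpos hpos hle (by linarith)
end

section
/- Fix an integer k ≥ 1, real numbers c ≤ a < 0, b ∈ ℝ, and coefficients a₂, a₄, …, a₂ₖ > 0; set R(z) = Σ_{i=1}^k a_{2i} z^{2i}, define F : ℝ³ → ℝ³ by F(x,y,z) = (y + (ax + by)·R(z), −x + (−bx + cy)·R(z), −z·R(z)), and let ρ(x,y,z) = (x² + y² + R(z))^{−α} with α > max{2, (a + c − 1 − 2k)/(2a), (3 − a − c)/2}. Then the function p ↦ ρ(p)·‖F(p)‖/‖p‖ is Lebesgue integrable on the region {p ∈ ℝ³ : ‖p‖ ≥ 1}. -/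
open MeasureTheory

lemma two_add_inv_lt_exponent {k a c α : ℝ} (hk : 1 ≤ k) (hca : c ≤ a) (ha : a < 0)
    (h₁ : (a + c - 1 - 2 * k) / (2 * a) < α) (h₂ : (3 - a - c) / 2 < α) :
    2 + 1 / (2 * k) < α := by
  rw [div_lt_iff_of_neg (by linarith)] at h₁
  have hu : 2 * k + 1 < (α - 1) * (2 * α - 3) := by nlinarith
  by_contra! h
  have hik : 1 / k ≤ 1 := by rw [div_le_one (by linarith)]; exact hk
  have hik' : 1 / (2 * k) = (1 / k) / 2 := by field_simp
  have h₀ : 0 < 1 / k := by positivity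
  rw [hik'] at h
  have : (α - 1) * (2 * α - 3) ≤ (1 + (1 / k) / 2) * (1 + 1 / k) :=
    mul_le_mul (by linarith) (by linarith) (by linarith) (by linarith)
  nlinarith

lemma integrable_const_mul_one_add_sq_pow_rpow_neg (L : ℝ) (hL : 0 ≤ L) (n : ℕ) {β : ℝ}
    (hβ : 1 < 2 * (n * β)) :
    Integrable (fun x : ℝ => (L * (1 + x ^ 2) ^ n) ^ (-β)) := by
  have h := integrable_rpow_neg_one_add_norm_sq (E := ℝ) (μ := volume) (r := 2 * (n * β))
    (by simpa using hβ)
  refine (h.const_mul (L ^ (-β))).congr (.of_forall fun x => ?_)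
  have hx : 0 ≤ 1 + x ^ 2 := by positivity
  simp only [Real.norm_eq_abs, sq_abs]
  rw [Real.mul_rpow hL (by positivity), ← Real.rpow_natCast (1 + x ^ 2) n, ← Real.rpow_mul hx]
  ring_nf

lemma integrable_prod_coords {ι : Type*} [Fintype ι] {g : ι → ℝ → ℝ}
    (hg : ∀ i, Integrable (g i)) :
    Integrable (fun p : EuclideanSpace ℝ ι => ∏ i, g i (p i)) :=
  (EuclideanSpace.volume_preserving_symm_measurableEquiv_toLp ι).integrable_comp_of_integrable
    (Integrable.fintype_prod hg)

lemma one_add_sq_pow_le (z : ℝ) (k : ℕ) :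
    (1 + z ^ 2) ^ k ≤ 2 ^ k * (1 + z ^ (2 * k)) := by
  have h := add_pow_le zero_le_one (sq_nonneg z) k
  rw [one_pow, ← pow_mul] at h
  refine h.trans (mul_le_mul_of_nonneg_right ?_ ?_)
  · exact pow_le_pow_right₀ one_le_two (Nat.sub_le k 1)
  · rw [pow_mul]; positivity

/-- Away from the unit ball, `s + r`, with `r ≥ γ z ^ (2 * k)`, controls the constants and
`(1 + z ^ 2) ^ k`. -/
lemma exists_bounds_of_one_le_add_sq (k : ℕ) {γ : ℝ} (hγ : 0 < γ) :
    ∃ K : ℝ, 0 < K ∧ ∀ s r z : ℝ, 0 ≤ s → γ * z ^ (2 * k) ≤ r → 1 ≤ s + z ^ 2 →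
      1 ≤ K * (s + r) ∧ 1 + s ≤ K * (s + r) ∧ 1 + r ≤ K * (s + r) ∧
        (1 + z ^ 2) ^ k ≤ K * (s + r) := by
  set L : ℝ := 2 + 2 ^ k / γ with hL
  have hL0 : 0 < L := by positivity
  refine ⟨L + 1 + 2 ^ k * (L + 1 / γ), by positivity, fun s r z hs hr h => ?_⟩
  have hz : 0 ≤ z ^ (2 * k) := by rw [pow_mul]; positivity
  have hr0 : 0 ≤ r := (by positivity : 0 ≤ γ * z ^ (2 * k)).trans hr
  have hz' : z ^ (2 * k) ≤ r / γ := by rw [le_div_iff₀ hγ]; linarith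
  have h1 : 1 ≤ L * (s + r) := by
    have e : L * (s + r) = 2 * s + 2 * r + 2 ^ k / γ * s + 2 ^ k * (r / γ) := by
      rw [hL]; ring
    have e1 : 0 ≤ 2 ^ k / γ * s := by positivity
    have e2 : 0 ≤ 2 ^ k * (r / γ) := by positivity
    rcases le_total (1 / 2) s with h' | h'
    · linarith
    · have h2 : (1 / 2 : ℝ) ^ k ≤ z ^ (2 * k) := by
        rw [pow_mul]
        exact pow_le_pow_left₀ (by norm_num) (by linarith) k
      have h3 : (1 : ℝ) = 2 ^ k * (1 / 2) ^ k := by rw [← mul_pow]; norm_num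
      have h4 : (2 : ℝ) ^ k * (1 / 2) ^ k ≤ 2 ^ k * (r / γ) :=
        mul_le_mul_of_nonneg_left (h2.trans hz') (by positivity)
      linarith
  have hT : (1 + z ^ 2) ^ k ≤ 2 ^ k * (L + 1 / γ) * (s + r) := by
    refine (one_add_sq_pow_le z k).trans ?_
    rw [mul_assoc]
    refine mul_le_mul_of_nonneg_left ?_ (by positivity)
    have : r / γ = 1 / γ * r := by ring
    have : 0 ≤ 1 / γ * s := by positivity
    nlinarith
  have hq : 0 ≤ 2 ^ k * (L + 1 / γ) * (s + r) := by positivity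
  have hq' : 0 ≤ L * (s + r) := by positivity
  rw [add_mul, add_mul]
  refine ⟨?_, ?_, ?_, ?_⟩ <;> linarith

lemma EuclideanSpace.norm_le_sum_abs {ι : Type*} [Fintype ι] (v : EuclideanSpace ℝ ι) :
    ‖v‖ ≤ ∑ i, |v i| := by
  rw [EuclideanSpace.norm_eq]
  refine Real.sqrt_le_iff.2 ⟨Finset.sum_nonneg fun i _ => abs_nonneg _, ?_⟩
  exact Finset.sum_sq_le_sq_sum_of_nonneg fun i _ => abs_nonneg _

lemma norm_field_le {a b c r : ℝ} (hr : 0 ≤ r) {p v : EuclideanSpace ℝ (Fin 3)}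
    (hv : v = ![p 1 + (a * p 0 + b * p 1) * r, -p 0 + (-b * p 0 + c * p 1) * r, -(p 2) * r]) :
    ‖v‖ ≤ (|a| + 2 * |b| + |c| + 2) * (1 + r) * ‖p‖ := by
  have hp : ∀ i, |p i| ≤ ‖p‖ := fun i => by simpa using PiLp.norm_apply_le p i
  have key : ∀ x y d e : ℝ, |x| ≤ ‖p‖ → |y| ≤ ‖p‖ → |(d * x + e * y) * r| ≤
      (|d| + |e|) * r * ‖p‖ := fun x y d e hx hy => by
    rw [abs_mul, abs_of_nonneg hr]
    calc |d * x + e * y| * r ≤ (|d| * |x| + |e| * |y|) * r := by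
          gcongr
          simpa only [abs_mul] using abs_add_le (d * x) (e * y)
      _ ≤ (|d| * ‖p‖ + |e| * ‖p‖) * r := by gcongr
      _ = _ := by ring
  refine (EuclideanSpace.norm_le_sum_abs v).trans ?_
  rw [Fin.sum_univ_three, hv]
  simp only [Matrix.cons_val]
  have h0 := (abs_add_le (p 1) ((a * p 0 + b * p 1) * r)).trans
    (add_le_add (hp 1) (key _ _ a b (hp 0) (hp 1)))
  have h1 := (abs_add_le (-p 0) ((-b * p 0 + c * p 1) * r)).trans
    (add_le_add ((abs_neg _).trans_le (hp 0)) (key _ _ (-b) c (hp 0) (hp 1)))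
  have h2 : |-(p 2) * r| ≤ r * ‖p‖ := by
    rw [abs_mul, abs_neg, abs_of_nonneg hr, mul_comm]
    gcongr
    exact hp 2
  rw [abs_neg b] at h1
  have : 0 ≤ (|a| + 2 * |b| + |c|) * ‖p‖ := by positivity
  have : 0 ≤ r * ‖p‖ := by positivity
  linarith

lemma norm_sq_fin_three (p : EuclideanSpace ℝ (Fin 3)) :
    ‖p‖ ^ 2 = p 0 ^ 2 + p 1 ^ 2 + p 2 ^ 2 := by
  simp [EuclideanSpace.norm_sq_eq, Fin.sum_univ_three]

lemma rpow_neg_le_rpow_neg_of_le_mul {K q t β : ℝ} (hK : 0 < K) (ht : 0 < t) (hβ : 0 ≤ β)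
    (h : t ≤ K * q) : q ^ (-β) ≤ (K⁻¹ * t) ^ (-β) := by
  refine Real.rpow_le_rpow_of_nonpos (by positivity) ?_ (by linarith)
  rwa [inv_mul_le_iff₀ hK]

/-- With `F` and `ρ` as in the almost-Hurwitz family
(`α > max{2, (a+c-1-2k)/(2a), (3-a-c)/2}`), the function `p ↦ ρ(p)‖F(p)‖/‖p‖` is Lebesgue
integrable on `{‖p‖ ≥ 1}` (Euclidean norm). -/
theorem stmt12 (k : ℕ) (hk : 1 ≤ k) (a b c : ℝ) (hca : c ≤ a) (ha : a < 0)
    (coef : ℕ → ℝ) (hcoef : ∀ i ∈ Finset.Icc 1 k, 0 < coef i)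
    (R : ℝ → ℝ) (hR : ∀ z, R z = ∑ i ∈ Finset.Icc 1 k, coef i * z ^ (2 * i))
    (F : EuclideanSpace ℝ (Fin 3) → EuclideanSpace ℝ (Fin 3))
    (hF : ∀ p, F p = ![p 1 + (a * p 0 + b * p 1) * R (p 2),
                       -p 0 + (-b * p 0 + c * p 1) * R (p 2),
                       -(p 2) * R (p 2)])
    (α : ℝ)
    (hα : max 2 (max ((a + c - 1 - 2 * (k : ℝ)) / (2 * a)) ((3 - a - c) / 2)) < α)
    (ρ : EuclideanSpace ℝ (Fin 3) → ℝ)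
    (hρ : ∀ p, ρ p = ((p 0) ^ 2 + (p 1) ^ 2 + R (p 2)) ^ (-α)) :
    IntegrableOn (fun p : EuclideanSpace ℝ (Fin 3) => ρ p * ‖F p‖ / ‖p‖)
      {p : EuclideanSpace ℝ (Fin 3) | 1 ≤ ‖p‖} volume := by
  have hk' : (1 : ℝ) ≤ k := by exact_mod_cast hk
  simp only [max_lt_iff] at hα
  have hexp := two_add_inv_lt_exponent hk' hca ha hα.2.1 hα.2.2
  obtain ⟨δ, hδ, hδα⟩ : ∃ δ : ℝ, 0 < δ ∧ α = 2 + 1 / (2 * k) + 3 * δ :=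
    ⟨(α - (2 + 1 / (2 * k))) / 3, by linarith, by ring⟩
  have hterm : ∀ z, ∀ i ∈ Finset.Icc 1 k, 0 ≤ coef i * z ^ (2 * i) := fun z i hi => by
    rw [pow_mul]
    exact mul_nonneg (hcoef i hi).le (by positivity)
  have hkmem : k ∈ Finset.Icc 1 k := Finset.mem_Icc.2 ⟨hk, le_rfl⟩
  have hR0 : ∀ z, 0 ≤ R z := fun z => hR z ▸ Finset.sum_nonneg (hterm z)
  have hRk : ∀ z, coef k * z ^ (2 * k) ≤ R z := fun z =>
    hR z ▸ Finset.single_le_sum (hterm z) hkmem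
  have hRm : Measurable R := by
    rw [funext hR]
    fun_prop
  obtain ⟨K, hK, hbd⟩ := exists_bounds_of_one_le_add_sq k (hcoef k hkmem)
  set β : Fin 3 → ℝ := ![1 / 2 + δ, 1 / 2 + δ, 1 / (2 * k) + δ] with hβ
  set n : Fin 3 → ℕ := ![1, 1, k] with hn
  have hint := (integrable_prod_coords
    (g := fun i x => (K⁻¹ * (1 + x ^ 2) ^ n i) ^ (-β i)) fun i =>
      integrable_const_mul_one_add_sq_pow_rpow_neg K⁻¹ (by positivity) (n i) (by
        have : (k : ℝ) * (1 / (2 * k) + δ) = 1 / 2 + k * δ := by field_simp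
        have : 0 < (k : ℝ) * δ := by positivity
        fin_cases i <;> simp only [hβ, hn, Fin.zero_eta, Fin.mk_one, Fin.reduceFinMk,
          Matrix.cons_val, Nat.cast_one] <;> linarith)).const_mul
    ((|a| + 2 * |b| + |c| + 2) * K)
  have hFm : Measurable F := by
    rw [← (MeasurableEquiv.toLp 2 (Fin 3 → ℝ)).symm.measurableEmbedding.measurable_comp_iff,
      measurable_pi_iff]
    intro i
    change Measurable fun p => (F p) i
    simp only [hF]
    fin_cases i <;> simp only [Fin.zero_eta, Fin.mk_one, Fin.reduceFinMk, Matrix.cons_val] <;>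
      fun_prop
  have hρm : Measurable ρ := by
    rw [funext hρ]
    fun_prop
  refine hint.integrableOn.mono'
    ((hρm.mul hFm.norm).div measurable_norm).aestronglyMeasurable ?_
  refine (ae_restrict_iff' (measurableSet_le measurable_const measurable_norm)).2
    (.of_forall fun p hp => ?_)
  have hp : 1 ≤ ‖p‖ := hp
  obtain ⟨h1, hs, hr, hT⟩ := hbd (p 0 ^ 2 + p 1 ^ 2) (R (p 2)) (p 2) (by positivity) (hRk _)
    (by rw [← norm_sq_fin_three]; exact one_le_pow₀ hp)
  set q := p 0 ^ 2 + p 1 ^ 2 + R (p 2)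
  have hq0 : 0 < q := pos_of_mul_pos_right (zero_lt_one.trans_le h1) hK.le
  have hρ0 : ρ p = q ^ (-α) := hρ p
  have hbound : ∀ i, q ^ (-β i) ≤ (K⁻¹ * (1 + p i ^ 2) ^ n i) ^ (-β i) := fun i => by
    refine rpow_neg_le_rpow_neg_of_le_mul hK (by positivity) ?_ ?_
    · fin_cases i <;> simp only [hβ, Fin.zero_eta, Fin.mk_one, Fin.reduceFinMk,
        Matrix.cons_val] <;> positivity
    · have := sq_nonneg (p 0)
      have := sq_nonneg (p 1)
      fin_cases i <;> simp only [hn, Fin.zero_eta, Fin.mk_one, Fin.reduceFinMk,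
        Matrix.cons_val, pow_one] <;> linarith
  have hnorm : ‖F p‖ / ‖p‖ ≤ (|a| + 2 * |b| + |c| + 2) * (K * q) := by
    rw [div_le_iff₀ (by linarith)]
    refine (norm_field_le (hR0 _) (hF p)).trans ?_
    gcongr
  have hsplit : q ^ (-α) * q = ∏ i, q ^ (-β i) := by
    rw [← Real.rpow_add_one hq0.ne', ← Real.rpow_sum_of_pos hq0, Fin.sum_univ_three]
    simp only [hβ, Matrix.cons_val, hδα]
    congr 1
    ring
  rw [Real.norm_of_nonneg (by rw [hρ0]; positivity), hρ0, mul_div_assoc]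
  calc q ^ (-α) * (‖F p‖ / ‖p‖)
      ≤ q ^ (-α) * ((|a| + 2 * |b| + |c| + 2) * (K * q)) := by gcongr
    _ = (|a| + 2 * |b| + |c| + 2) * K * ∏ i, q ^ (-β i) := by rw [← hsplit]; ring
    _ ≤ _ := by
      refine mul_le_mul_of_nonneg_left ?_ (by positivity)
      exact Finset.prod_le_prod (fun i _ => by positivity) fun i _ => hbound i
end

section
/- Let F : ℝ³ → ℝ³ be a C¹ vector field with F(0) = 0 such that the plane z = 0 is invariant (the third component of F vanishes whenever z = 0) and ∇·F(x,y,z) < 0 at every point with z ≠ 0, and let ρ : ℝ³ ∖ {0} → (0,∞) be a positive C¹ function with ρ(p) → ∞ as p → 0 and ρ(p) → 0 as ‖p‖ → ∞. If moreover ∇·(ρF)(p) > 0 for every p ∈ ℝ³ ∖ {0}, then the origin is globally asymptotically stable for ẋ = F(x): every solution with any initial state p ∈ ℝ³ exists for all t ∈ [0,∞) and tends to the origin as t → ∞. -/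
open Filter Topology

section GlobalFlow

variable {E : Type*} [NormedAddCommGroup E] [NormedSpace ℝ E]

open scoped Manifold in
theorem exists_hasDerivAt_of_hasCompactSupport [CompleteSpace E] {G : E → E}
    (hG : ContDiff ℝ 1 G) (hc : HasCompactSupport G) (x : E) :
    ∃ γ : ℝ → E, γ 0 = x ∧ ∀ t, HasDerivAt γ (G (γ t)) t := by
  obtain ⟨K, hK⟩ := hG.lipschitzWith_of_hasCompactSupport hc one_ne_zero
  obtain ⟨C, hC⟩ := hc.exists_bound_of_continuous hG.continuous
  have h_local : ∀ x : E, ∃ γ : ℝ → E, γ 0 = x ∧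
      IsMIntegralCurveOn (I := 𝓘(ℝ, E)) γ G (Set.Ioo (-1) 1) := by
    intro x
    have hPL : IsPicardLindelof (fun _ => G) (tmin := -1) (tmax := 1) ⟨0, by norm_num⟩ x
        (Real.toNNReal C) 0 (Real.toNNReal C) K :=
      .of_time_independent (fun y _ => (hC y).trans (Real.le_coe_toNNReal C))
        hK.lipschitzOnWith (by simp)
    obtain ⟨γ, hγ0, hγ⟩ := hPL.exists_eq_forall_mem_Icc_hasDerivWithinAt₀
    refine ⟨γ, hγ0, fun t ht => ?_⟩
    have h_deriv : HasDerivAt γ (G (γ t)) t :=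
      (hγ t (Set.Ioo_subset_Icc_self ht)).hasDerivAt (Icc_mem_nhds ht.1 ht.2)
    exact (hasMFDerivAt_iff_hasFDerivAt.2 h_deriv.hasFDerivAt).hasMFDerivWithinAt
  obtain ⟨γ, hγ0, hγ⟩ := exists_isMIntegralCurve_of_isMIntegralCurveOn (I := 𝓘(ℝ, E))
    (contMDiff_vectorSpace_iff_contDiff.2 hG) one_pos h_local x
  refine ⟨γ, hγ0, fun t => ?_⟩
  have h_deriv : HasFDerivAt γ ((1 : ℝ →L[ℝ] ℝ).smulRight (G (γ t))) t :=
    hasMFDerivAt_iff_hasFDerivAt.1 (hγ t)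
  simpa using h_deriv.hasDerivAt

theorem eq_zero_of_hasDerivAt_of_eq_zero [ProperSpace E] {G : E → E} (hG : ContDiff ℝ 1 G)
    (hG0 : G 0 = 0) {γ : ℝ → E} {a b : ℝ} (hab : a ≤ b)
    (hγ : ∀ t ∈ Set.Icc a b, HasDerivAt γ (G (γ t)) t) (ha : γ a = 0) : γ b = 0 := by
  have hcont : ContinuousOn γ (Set.Icc a b) :=
    fun t ht => (hγ t ht).continuousAt.continuousWithinAt
  obtain ⟨R, hR⟩ := isCompact_Icc.exists_bound_of_continuousOn hcont
  obtain ⟨K, hK⟩ := LocallyLipschitzOn.exists_lipschitzOnWith_of_compact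
    (isCompact_closedBall (0 : E) R) (hG.locallyLipschitz.locallyLipschitzOn)
  have ha_mem : γ a ∈ Metric.closedBall (0 : E) R := by
    simpa using hR a (Set.left_mem_Icc.2 hab)
  rw [ha] at ha_mem
  exact ODE_solution_unique_of_mem_Icc_right (v := fun _ => G) (g := fun _ => 0)
    (s := fun _ => Metric.closedBall 0 R) (fun _ _ => hK) hcont
    (fun t ht => (hγ t (Set.Ico_subset_Icc_self ht)).hasDerivWithinAt)
    (fun t ht => by simpa using hR t (Set.Ico_subset_Icc_self ht))
    continuousOn_const (fun t _ => by simpa [hG0] using hasDerivWithinAt_const t (Set.Ici t) (0 : E))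
    (fun _ _ => ha_mem) ha (Set.right_mem_Icc.2 hab)

end GlobalFlow

section DensityLyapunov

theorem exists_forall_norm_ge_lt {E : Type*} [Norm E] {ρ : E → ℝ}
    (hρ : Tendsto ρ (comap (fun p : E => ‖p‖) atTop) (𝓝 0))
    {c : ℝ} (hc : 0 < c) : ∃ R : ℝ, ∀ q, R ≤ ‖q‖ → ρ q < c := by
  have h := hρ.eventually (gt_mem_nhds hc)
  rw [eventually_comap, eventually_atTop] at h
  exact h.imp fun R hR q hq => hR _ hq q rfl

variable {E : Type*} [NormedAddCommGroup E] [NormedSpace ℝ E] {ρ : E → ℝ}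

theorem mul_sub_le_of_hasDerivAt {G : E → E} (hρ : DifferentiableOn ℝ ρ {0}ᶜ) {γ : ℝ → E}
    {a b m : ℝ} (hab : a ≤ b) (hγ : ∀ t ∈ Set.Icc a b, HasDerivAt γ (G (γ t)) t)
    (hne : ∀ t ∈ Set.Icc a b, γ t ≠ 0)
    (hm : ∀ t ∈ Set.Icc a b, m ≤ fderiv ℝ ρ (γ t) (G (γ t))) :
    m * (b - a) ≤ ρ (γ b) - ρ (γ a) := by
  have hderiv : ∀ t ∈ Set.Icc a b,
      HasDerivAt (fun s => ρ (γ s)) (fderiv ℝ ρ (γ t) (G (γ t))) t := fun t ht =>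
    ((hρ.differentiableAt (isOpen_compl_singleton.mem_nhds (hne t ht))).hasFDerivAt).comp_hasDerivAt
      t (hγ t ht)
  refine (convex_Icc a b).mul_sub_le_image_sub_of_le_deriv (f := fun s => ρ (γ s))
    (fun t ht => (hderiv t ht).continuousAt.continuousWithinAt)
    (fun t ht => (hderiv t (interior_subset ht)).differentiableAt.differentiableWithinAt)
    (fun t ht => ?_) a (Set.left_mem_Icc.2 hab) b (Set.right_mem_Icc.2 hab) hab
  rw [(hderiv t (interior_subset ht)).deriv]
  exact hm t (interior_subset ht)

theorem exists_forall_hasDerivAt_of_density [FiniteDimensional ℝ E] {F : E → E}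
    (hF : ContDiff ℝ 1 F) (hF0 : F 0 = 0) (hρ : DifferentiableOn ℝ ρ {0}ᶜ)
    (hpos : ∀ p, p ≠ 0 → 0 < ρ p)
    (hinf : Tendsto ρ (comap (fun p : E => ‖p‖) atTop) (𝓝 0))
    (hmono : ∀ p, p ≠ 0 → 0 < fderiv ℝ ρ p (F p)) (p : E) :
    ∃ γ : ℝ → E, γ 0 = p ∧ ∀ t ∈ Set.Ici (0 : ℝ), HasDerivAt γ (F (γ t)) t := by
  have : ProperSpace E := FiniteDimensional.proper ℝ E
  rcases eq_or_ne p 0 with rfl | hp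
  · exact ⟨fun _ => 0, rfl, fun t _ => by simpa [hF0] using hasDerivAt_const t (0 : E)⟩
  obtain ⟨R, hR⟩ := exists_forall_norm_ge_lt hinf (hpos p hp)
  let χ : ContDiffBump (0 : E) := ⟨|R| + 1, |R| + 2, by positivity, by linarith⟩
  let G : E → E := fun q => χ q • F q
  have hG : ContDiff ℝ 1 G := χ.contDiff.smul hF
  have hG0 : G 0 = 0 := by simp [G, hF0]
  obtain ⟨γ, hγ0, hγ⟩ := exists_hasDerivAt_of_hasCompactSupport hG
    (χ.hasCompactSupport.smul_right) p
  refine ⟨γ, hγ0, fun t ht => ?_⟩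
  have h_norm : ‖γ t‖ ≤ |R| + 1 := by
    by_contra! h
    have htne : γ t ≠ 0 := norm_pos_iff.1 (lt_trans (by positivity) h)
    have hne : ∀ s ∈ Set.Icc 0 t, γ s ≠ 0 := fun s hs h0 =>
      htne (eq_zero_of_hasDerivAt_of_eq_zero hG hG0 hs.2 (fun u _ => hγ u) h0)
    have := mul_sub_le_of_hasDerivAt (m := 0) hρ ht (fun u _ => hγ u) hne fun s hs => by
      simpa [G] using mul_nonneg χ.nonneg (hmono _ (hne s hs)).le
    rw [hγ0] at this
    linarith [hR (γ t) (by linarith [le_abs_self R])]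
  have h_one : χ (γ t) = 1 := χ.one_of_mem_closedBall (by simpa using h_norm)
  simpa [G, h_one] using hγ t

theorem tendsto_zero_of_density [ProperSpace E] {F : E → E}
    (hF : ContDiff ℝ 1 F) (hF0 : F 0 = 0) (hρ : ContDiffOn ℝ 1 ρ {0}ᶜ)
    (hpos : ∀ p, p ≠ 0 → 0 < ρ p) (hzero : Tendsto ρ (𝓝[≠] 0) atTop)
    (hinf : Tendsto ρ (comap (fun p : E => ‖p‖) atTop) (𝓝 0))
    (hmono : ∀ p, p ≠ 0 → 0 < fderiv ℝ ρ p (F p)) {γ : ℝ → E}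
    (hγ : ∀ t ∈ Set.Ici (0 : ℝ), HasDerivAt γ (F (γ t)) t) :
    Tendsto γ atTop (𝓝 0) := by
  have hγ' : ∀ {a b : ℝ}, 0 ≤ a → ∀ t ∈ Set.Icc a b, HasDerivAt γ (F (γ t)) t :=
    fun ha t ht => hγ t (ha.trans ht.1)
  by_cases hz : ∃ s, 0 ≤ s ∧ γ s = 0
  · obtain ⟨s, hs, hs0⟩ := hz
    refine tendsto_const_nhds.congr' ?_
    filter_upwards [eventually_ge_atTop s] with t ht
    exact (eq_zero_of_hasDerivAt_of_eq_zero hF hF0 ht (hγ' hs) hs0).symm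
  push Not at hz
  have hdiff : DifferentiableOn ℝ ρ {0}ᶜ := hρ.differentiableOn one_ne_zero
  have h_le : ∀ a b, 0 ≤ a → a ≤ b → ρ (γ a) ≤ ρ (γ b) := fun a b ha hab => by
    have := mul_sub_le_of_hasDerivAt (m := 0) hdiff hab (hγ' ha)
      (fun t ht => hz t (ha.trans ht.1)) (fun t ht => (hmono _ (hz t (ha.trans ht.1))).le)
    linarith
  have h_annulus : ∀ δ R : ℝ, IsCompact (Metric.closedBall (0 : E) R \ Metric.ball 0 δ) :=
    fun δ R => (isCompact_closedBall 0 R).diff Metric.isOpen_ball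
  have h_subset : ∀ δ R : ℝ, 0 < δ →
      Metric.closedBall (0 : E) R \ Metric.ball 0 δ ⊆ {0}ᶜ := by
    rintro δ R hδ q hq rfl
    exact hq.2 (Metric.mem_ball_self hδ)
  have h_unbdd : ∀ M, ∃ s, 0 ≤ s ∧ M < ρ (γ s) := by
    by_contra! ⟨M, hM⟩
    obtain ⟨δ, hδ, hδM⟩ := Metric.mem_nhdsWithin_iff.1 (hzero.eventually (eventually_gt_atTop M))
    obtain ⟨R, hR⟩ := exists_forall_norm_ge_lt hinf (hpos _ (hz 0 le_rfl))
    have h_mem : ∀ t, 0 ≤ t → γ t ∈ Metric.closedBall (0 : E) R \ Metric.ball 0 δ := by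
      refine fun t ht => ⟨?_, fun h => ?_⟩
      · by_contra h
        rw [mem_closedBall_zero_iff, not_le] at h
        exact absurd (hR _ h.le) (h_le 0 t le_rfl ht).not_gt
      · exact absurd (hδM ⟨h, hz t ht⟩) (hM t ht).not_gt
    have h_cont : ContinuousOn (fun q => fderiv ℝ ρ q (F q))
        (Metric.closedBall (0 : E) R \ Metric.ball 0 δ) :=
      ((hρ.continuousOn_fderiv_of_isOpen isOpen_compl_singleton le_rfl).clm_apply
        hF.continuous.continuousOn).mono (h_subset δ R hδ)
    obtain ⟨q, hq, hq_min⟩ := (h_annulus δ R).exists_isMinOn ⟨_, h_mem 0 le_rfl⟩ h_cont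
    have hm := hmono q (h_subset δ R hδ hq)
    set m := fderiv ℝ ρ q (F q)
    have hT : 0 ≤ M / m := div_nonneg ((hpos _ (hz 0 le_rfl)).le.trans (hM 0 le_rfl)) hm.le
    have := mul_sub_le_of_hasDerivAt (m := m) hdiff hT (hγ' le_rfl)
      (fun t ht => hz t ht.1) (fun t ht => hq_min (h_mem t ht.1))
    rw [sub_zero, mul_div_cancel₀ _ hm.ne'] at this
    linarith [hM _ hT, hpos _ (hz 0 le_rfl)]
  rw [Metric.tendsto_atTop]
  intro ε hε
  obtain ⟨R, hR⟩ := exists_forall_norm_ge_lt hinf one_pos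
  obtain ⟨N, hN⟩ := (h_annulus ε R).exists_bound_of_continuousOn
    (hρ.continuousOn.mono (h_subset ε R hε))
  obtain ⟨s, hs, hsN⟩ := h_unbdd (max N 1)
  refine ⟨s, fun t hst => ?_⟩
  have hlt := hsN.trans_le (h_le s t hs hst)
  by_contra h
  rcases le_total R ‖γ t‖ with hRt | hRt
  · exact absurd (hR _ hRt) ((le_max_right N 1).trans hlt.le).not_gt
  · have := hN (γ t) ⟨by simpa using hRt, h⟩
    exact absurd ((le_abs_self _).trans this) ((le_max_left N 1).trans_lt hlt).not_ge

end DensityLyapunov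

/-- (Corollary.) Under the hypotheses of the density-function
proposition, if moreover `∇·(ρF)(p) > 0` for every `p ≠ 0`, then the origin is globally
asymptotically stable: from every initial state a global solution exists, and every global
solution tends to the origin. -/
theorem stmt16 (F : EuclideanSpace ℝ (Fin 3) → EuclideanSpace ℝ (Fin 3))
    (hF1 : ContDiff ℝ 1 F) (hF0 : F 0 = 0)
    (hinv : ∀ p : EuclideanSpace ℝ (Fin 3), p 2 = 0 → F p 2 = 0)
    (hdivF : ∀ p : EuclideanSpace ℝ (Fin 3), p 2 ≠ 0 →
      (∑ i, fderiv ℝ (fun q => F q i) p (EuclideanSpace.single i 1)) < 0)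
    (ρ : EuclideanSpace ℝ (Fin 3) → ℝ)
    (hρC1 : ContDiffOn ℝ 1 ρ {(0 : EuclideanSpace ℝ (Fin 3))}ᶜ)
    (hρpos : ∀ p : EuclideanSpace ℝ (Fin 3), p ≠ 0 → 0 < ρ p)
    (hrho0 : Tendsto ρ (𝓝[≠] (0 : EuclideanSpace ℝ (Fin 3))) atTop)
    (hrhoInf : Tendsto ρ (comap (fun p : EuclideanSpace ℝ (Fin 3) => ‖p‖) atTop) (𝓝 0))
    (hdivρF : ∀ p : EuclideanSpace ℝ (Fin 3), p ≠ 0 →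
      0 < fderiv ℝ ρ p (F p) +
          ρ p * ∑ i, fderiv ℝ (fun q => F q i) p (EuclideanSpace.single i 1)) :
    ∀ p : EuclideanSpace ℝ (Fin 3),
      (∃ γ : ℝ → EuclideanSpace ℝ (Fin 3), γ 0 = p ∧
        ∀ t ∈ Set.Ici (0 : ℝ), HasDerivAt γ (F (γ t)) t) ∧
      (∀ γ : ℝ → EuclideanSpace ℝ (Fin 3), γ 0 = p →
        (∀ t ∈ Set.Ici (0 : ℝ), HasDerivAt γ (F (γ t)) t) →
        Tendsto γ atTop (𝓝 0)) := by
  have h_div : ∀ p : EuclideanSpace ℝ (Fin 3),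
      (∑ i, fderiv ℝ (fun q => F q i) p (EuclideanSpace.single i 1)) ≤ 0 := by
    intro p
    by_cases hp : p 2 = 0
    · have h_cont : Continuous fun p : EuclideanSpace ℝ (Fin 3) =>
          ∑ i, fderiv ℝ (fun q => F q i) p (EuclideanSpace.single i 1) :=
        continuous_finsetSum _ fun i _ =>
          (((contDiff_euclidean.1 hF1 i).continuous_fderiv one_ne_zero).clm_apply
            continuous_const)
      have h_line : Continuous fun s : ℝ => p + s • EuclideanSpace.single (2 : Fin 3) (1 : ℝ) := by
        fun_prop
      have h_tendsto := ((h_cont.comp h_line).tendsto 0).mono_left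
        (nhdsWithin_le_nhds (s := {(0 : ℝ)}ᶜ))
      simp only [Function.comp_apply, zero_smul, add_zero] at h_tendsto
      refine le_of_tendsto h_tendsto ?_
      filter_upwards [self_mem_nhdsWithin] with s hs
      exact (hdivF _ (by simpa [hp] using hs)).le
    · exact (hdivF p hp).le
  have hmono : ∀ p, p ≠ 0 → 0 < fderiv ℝ ρ p (F p) := fun p hp => by
    linarith [hdivρF p hp, mul_nonpos_of_nonneg_of_nonpos (hρpos p hp).le (h_div p)]
  exact fun p => ⟨exists_forall_hasDerivAt_of_density hF1 hF0
    (hρC1.differentiableOn one_ne_zero) hρpos hrhoInf hmono p,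
    fun γ _ hγ => tendsto_zero_of_density hF1 hF0 hρC1 hρpos hrho0 hrhoInf hmono hγ⟩
end

section
/- Fix an integer k ≥ 1, real numbers c ≤ a < 0, b ∈ ℝ, λ < 0, and coefficients a₂, a₄, …, a₂ₖ > 0; set R(z) = Σ_{i=1}^k a_{2i} z^{2i}, define F(x,y,z) = (y + (ax + by)·R(z), −x + (−bx + cy)·R(z), −z·R(z)) and G = λ·id + F. Then: (i) G is a Hurwitz vector field, i.e. at every point p ∈ ℝ³ all complex eigenvalues of the Jacobian matrix JG(p) have strictly negative real part; (ii) for ρ(x,y,z) = (x² + y² + R(z))^{−α} with α > max{3, (a + c − 1 − 2k)/(2a), (3 − a − c)/2}, one has ∇·(ρG)(p) > 0 for every p ∈ ℝ³ ∖ {0}; and (iii) the origin is globally asymptotically stable for ẋ = G(x): every solution exists for all t ∈ [0,∞) and tends to the origin as t → ∞. -/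
open Filter Topology

section Dissipative

variable {E : Type*} [NormedAddCommGroup E]

/-- A bounded Lipschitz vector field has global integral curves. -/
lemma exists_forall_hasDerivAt_of_lipschitzWith_of_norm_le [NormedSpace ℝ E] [CompleteSpace E]
    {v : E → E} {K : NNReal} (hv : LipschitzWith K v) {L : NNReal} (hL : ∀ x, ‖v x‖ ≤ L) (p : E) :
    ∃ γ : ℝ → E, γ 0 = p ∧ ∀ t, HasDerivAt γ (v (γ t)) t := by
  have hloc : ∀ T : ℝ, 0 < T → ∃ γ : ℝ → E, γ 0 = p ∧
      ∀ t ∈ Set.Ioo (-T) T, HasDerivAt γ (v (γ t)) t := by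
    intro T hT
    have hpl : IsPicardLindelof (fun _ ↦ v) (tmin := -T) (tmax := T)
        ⟨0, by constructor <;> linarith⟩ p (L * T.toNNReal) 0 L K :=
      .of_time_independent (fun x _ ↦ hL x) hv.lipschitzOnWith (by simp [hT.le])
    obtain ⟨γ, h0, h⟩ := hpl.exists_eq_forall_mem_Icc_hasDerivWithinAt₀
    exact ⟨γ, h0, fun t ht ↦
      (h t (Set.Ioo_subset_Icc_self ht)).hasDerivAt (Icc_mem_nhds ht.1 ht.2)⟩
  choose! γ h0 h using hloc
  have heq : ∀ S T : ℝ, 0 < S → S ≤ T → Set.EqOn (γ S) (γ T) (Set.Ioo (-S) S) := by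
    intro S T hS hST
    exact ODE_solution_unique_of_mem_Ioo (v := fun _ ↦ v) (s := fun _ ↦ Set.univ) (t₀ := 0)
      (fun _ _ ↦ hv.lipschitzOnWith) ⟨by linarith, hS⟩ (fun t ht ↦ ⟨h S hS t ht, trivial⟩)
      (fun t ht ↦ ⟨h T (by linarith) t ⟨by linarith [ht.1], by linarith [ht.2]⟩, trivial⟩)
      (by rw [h0 S hS, h0 T (by linarith)])
  refine ⟨fun t ↦ γ (|t| + 1) t, h0 _ (by positivity), fun t ↦ ?_⟩
  have hlt : ∀ s : ℝ, s ∈ Set.Ioo (-(|s| + 1)) (|s| + 1) := fun s ↦ abs_lt.mp (lt_add_one _)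
  have hev : (fun s ↦ γ (|s| + 1) s) =ᶠ[𝓝 t] γ (|t| + 2) := by
    have : ∀ᶠ s in 𝓝 t, |s| < |t| + 1 :=
      continuous_abs.continuousAt.eventually_lt continuousAt_const (lt_add_one _)
    filter_upwards [this] with s hs
    exact heq (|s| + 1) (|t| + 2) (by positivity) (by linarith) (hlt s)
  have ht := h (|t| + 2) (by positivity) t (abs_lt.mp (by linarith))
  refine (ht.congr_of_eventuallyEq hev).congr_deriv ?_
  exact congrArg v hev.eq_of_nhds.symm

variable [InnerProductSpace ℝ E]

/-- Along a forward solution of a field with `⟪x, v x⟫ ≤ l ‖x‖²`, the norm is bounded by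
`exp (l t)` times its initial value. -/
lemma norm_le_exp_mul_of_inner_le {v : E → E} {l : ℝ}
    {γ : ℝ → E} (hγ : ∀ t ∈ Set.Ici (0 : ℝ), HasDerivAt γ (v (γ t)) t)
    (hv : ∀ t ∈ Set.Ici (0 : ℝ), inner ℝ (γ t) (v (γ t)) ≤ l * ‖γ t‖ ^ 2) {t : ℝ} (ht : 0 ≤ t) :
    ‖γ t‖ ≤ Real.exp (l * t) * ‖γ 0‖ := by
  have hd : ∀ s ∈ Set.Ici (0 : ℝ), HasDerivAt (fun s ↦ Real.exp (-(2 * l) * s) * ‖γ s‖ ^ 2)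
      (Real.exp (-(2 * l) * s) * (2 * inner ℝ (γ s) (v (γ s)) - 2 * l * ‖γ s‖ ^ 2)) s := by
    intro s hs
    have h1 := ((hasDerivAt_id s).const_mul (-(2 * l))).exp
    refine (h1.mul (hγ s hs).norm_sq).congr_deriv ?_
    simp only [id]
    ring
  have hanti : AntitoneOn (fun s ↦ Real.exp (-(2 * l) * s) * ‖γ s‖ ^ 2) (Set.Ici 0) := by
    refine antitoneOn_of_hasDerivWithinAt_nonpos (convex_Ici 0)
      (fun s hs ↦ (hd s hs).continuousAt.continuousWithinAt)
      (fun s hs ↦ (hd s (interior_subset hs)).hasDerivWithinAt) fun s hs ↦ ?_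
    have := hv s (interior_subset hs)
    exact mul_nonpos_of_nonneg_of_nonpos (Real.exp_pos _).le (by linarith)
  have h := hanti Set.self_mem_Ici ht ht
  simp only [mul_zero, Real.exp_zero, one_mul] at h
  have hexp : Real.exp (l * t) ^ 2 * Real.exp (-(2 * l) * t) = 1 := by
    rw [← Real.exp_nat_mul, ← Real.exp_add, ← Real.exp_zero]
    congr 1
    push_cast
    ring
  refine le_of_sq_le_sq ?_ (by positivity)
  calc ‖γ t‖ ^ 2 = Real.exp (l * t) ^ 2 * (Real.exp (-(2 * l) * t) * ‖γ t‖ ^ 2) := by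
        rw [← mul_assoc, hexp, one_mul]
    _ ≤ Real.exp (l * t) ^ 2 * ‖γ 0‖ ^ 2 := by gcongr
    _ = (Real.exp (l * t) * ‖γ 0‖) ^ 2 := by ring

/-- A `C¹` vector field with `⟪x, v x⟫ ≤ 0` is forward complete. -/
lemma exists_forall_hasDerivAt_of_inner_nonpos [FiniteDimensional ℝ E] {v : E → E}
    (hv : ContDiff ℝ 1 v) (hin : ∀ x, inner ℝ x (v x) ≤ 0) (p : E) :
    ∃ γ : ℝ → E, γ 0 = p ∧ ∀ t ∈ Set.Ici (0 : ℝ), HasDerivAt γ (v (γ t)) t := by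
  let χ : ContDiffBump (0 : E) := ⟨‖p‖ + 1, ‖p‖ + 2, by positivity, by linarith⟩
  have hcs : HasCompactSupport fun x ↦ χ x • v x := χ.hasCompactSupport.smul_right
  have hsm : ContDiff ℝ 1 fun x ↦ χ x • v x := χ.contDiff.smul hv
  obtain ⟨K, hK⟩ := hsm.lipschitzWith_of_hasCompactSupport hcs one_ne_zero
  obtain ⟨C, hC⟩ := hsm.continuous.bounded_above_of_compact_support hcs
  obtain ⟨γ, h0, hγ⟩ := exists_forall_hasDerivAt_of_lipschitzWith_of_norm_le hK
    (L := C.toNNReal) (fun x ↦ (hC x).trans (Real.le_coe_toNNReal C)) p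
  have hle : ∀ t, 0 ≤ t → ‖γ t‖ ≤ ‖p‖ := by
    intro t ht
    have := norm_le_exp_mul_of_inner_le (v := fun x ↦ χ x • v x) (l := 0) (fun s _ ↦ hγ s) (fun s _ ↦ by
      rw [inner_smul_right, zero_mul]
      exact mul_nonpos_of_nonneg_of_nonpos χ.nonneg (hin _)) ht
    simpa [h0] using this
  refine ⟨γ, h0, fun t ht ↦ (hγ t).congr_deriv ?_⟩
  rw [χ.one_of_mem_closedBall, one_smul]
  simpa [χ] using (hle t ht).trans (by linarith)

/-- Forward solutions of a field with `⟪x, v x⟫ ≤ l ‖x‖²`, `l < 0`, tend to the origin. -/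
lemma tendsto_zero_of_inner_le {v : E → E} {l : ℝ} (hl : l < 0)
    (hv : ∀ x, inner ℝ x (v x) ≤ l * ‖x‖ ^ 2)
    {γ : ℝ → E} (hγ : ∀ t ∈ Set.Ici (0 : ℝ), HasDerivAt γ (v (γ t)) t) :
    Tendsto γ atTop (𝓝 0) := by
  have hlim : Tendsto (fun t ↦ Real.exp (l * t) * ‖γ 0‖) atTop (𝓝 0) := by
    simpa using (Real.tendsto_exp_atBot.comp
      (tendsto_id.const_mul_atTop_of_neg hl)).mul_const ‖γ 0‖
  refine squeeze_zero_norm' ?_ hlim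
  filter_upwards [eventually_ge_atTop 0] with t ht
  exact norm_le_exp_mul_of_inner_le hγ (fun s _ ↦ hv _) ht

end Dissipative

section EvenPolynomial

variable {k : ℕ} {coef : ℕ → ℝ} {R : ℝ → ℝ}

lemma hasDerivAt_of_eq_even_sum (hR : ∀ z, R z = ∑ i ∈ Finset.Icc 1 k, coef i * z ^ (2 * i))
    (z : ℝ) : HasDerivAt R
      (∑ i ∈ Finset.Icc 1 k, coef i * (((2 * i : ℕ) : ℝ) * z ^ (2 * i - 1))) z := by
  rw [funext hR]
  exact HasDerivAt.fun_sum fun i _ ↦ (hasDerivAt_pow _ z).const_mul _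

lemma contDiff_of_eq_even_sum (hR : ∀ z, R z = ∑ i ∈ Finset.Icc 1 k, coef i * z ^ (2 * i))
    {n : WithTop ℕ∞} : ContDiff ℝ n R := by
  rw [funext hR]
  fun_prop

lemma mul_deriv_of_eq_even_sum (hR : ∀ z, R z = ∑ i ∈ Finset.Icc 1 k, coef i * z ^ (2 * i))
    (z : ℝ) : z * deriv R z = ∑ i ∈ Finset.Icc 1 k, (2 * i : ℝ) * (coef i * z ^ (2 * i)) := by
  rw [(hasDerivAt_of_eq_even_sum hR z).deriv, Finset.mul_sum]
  refine Finset.sum_congr rfl fun i hi ↦ ?_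
  obtain ⟨j, rfl⟩ := Nat.exists_eq_add_of_le (Finset.mem_Icc.mp hi).1
  rw [show 2 * (1 + j) - 1 = 2 * j + 1 by lia, show 2 * (1 + j) = 2 * j + 1 + 1 by lia]
  push_cast
  ring

lemma nonneg_of_eq_even_sum (hcoef : ∀ i ∈ Finset.Icc 1 k, 0 < coef i)
    (hR : ∀ z, R z = ∑ i ∈ Finset.Icc 1 k, coef i * z ^ (2 * i)) (z : ℝ) :
    0 ≤ R z := by
  rw [hR]
  exact Finset.sum_nonneg fun i hi ↦ mul_nonneg (hcoef i hi).le ((even_two_mul i).pow_nonneg z)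

lemma pos_of_eq_even_sum (hk : 1 ≤ k) (hcoef : ∀ i ∈ Finset.Icc 1 k, 0 < coef i)
    (hR : ∀ z, R z = ∑ i ∈ Finset.Icc 1 k, coef i * z ^ (2 * i))
    {z : ℝ} (hz : z ≠ 0) : 0 < R z := by
  rw [hR]
  exact Finset.sum_pos (fun i hi ↦ mul_pos (hcoef i hi) ((even_two_mul i).pow_pos hz))
    ⟨1, Finset.mem_Icc.mpr ⟨le_rfl, hk⟩⟩

lemma two_mul_le_mul_deriv_of_eq_even_sum (hcoef : ∀ i ∈ Finset.Icc 1 k, 0 < coef i)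
    (hR : ∀ z, R z = ∑ i ∈ Finset.Icc 1 k, coef i * z ^ (2 * i))
    (z : ℝ) : 2 * R z ≤ z * deriv R z := by
  rw [mul_deriv_of_eq_even_sum hR, hR, Finset.mul_sum]
  refine Finset.sum_le_sum fun i hi ↦ mul_le_mul_of_nonneg_right ?_
    (mul_nonneg (hcoef i hi).le ((even_two_mul i).pow_nonneg z))
  have : (1 : ℝ) ≤ i := by exact_mod_cast (Finset.mem_Icc.mp hi).1
  linarith

lemma mul_deriv_le_of_eq_even_sum (hcoef : ∀ i ∈ Finset.Icc 1 k, 0 < coef i)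
    (hR : ∀ z, R z = ∑ i ∈ Finset.Icc 1 k, coef i * z ^ (2 * i))
    (z : ℝ) : z * deriv R z ≤ 2 * k * R z := by
  rw [mul_deriv_of_eq_even_sum hR, hR, Finset.mul_sum]
  refine Finset.sum_le_sum fun i hi ↦ mul_le_mul_of_nonneg_right ?_
    (mul_nonneg (hcoef i hi).le ((even_two_mul i).pow_nonneg z))
  have : (i : ℝ) ≤ k := by exact_mod_cast (Finset.mem_Icc.mp hi).2
  linarith

end EvenPolynomial

/-- A complex root of `(z - x)(z - y) + w² = 0` with `x, y < 0` has negative real part. -/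
lemma Complex.re_neg_of_sub_mul_sub_add_sq_eq_zero {x y w : ℝ} (hx : x < 0) (hy : y < 0) {z : ℂ}
    (h : (z - x) * (z - y) + (w : ℂ) ^ 2 = 0) : z.re < 0 := by
  have hre := congrArg Complex.re h
  have him := congrArg Complex.im h
  simp [pow_two] at hre him
  by_contra! hz
  have hz0 : z.im = 0 := by
    have : z.im * (2 * z.re - x - y) = 0 := by linarith
    rcases mul_eq_zero.mp this with h | h <;> linarith
  rw [hz0] at hre
  nlinarith [mul_pos (show 0 < z.re - x by linarith) (show 0 < z.re - y by linarith), sq_nonneg w]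

/-- Positivity of `∇·(ρG) / N ^ (-α - 1)` at a point, where `N = x² + y² + r`, `r = R z` and
`s = z R'(z)`. -/
lemma density_factor_pos {k a c lam α x y r s : ℝ} (hca : c ≤ a) (hlam : lam < 0)
    (hα₁ : 3 < α) (hα₂ : α * (2 * a) < a + c - 1 - 2 * k) (hα₃ : 3 - a - c < α * 2)
    (hr : 0 ≤ r) (hN : 0 < x ^ 2 + y ^ 2 + r) (hs₁ : 2 * r ≤ s) (hs₂ : s ≤ 2 * k * r) :
    0 < -α * (2 * lam * (x ^ 2 + y ^ 2) + 2 * (a * x ^ 2 + c * y ^ 2) * r + s * (lam - r)) +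
      (x ^ 2 + y ^ 2 + r) * (3 * lam + (a + c - 1) * r - s) := by
  have h₁ : 0 < -lam * ((2 * α - 3) * (x ^ 2 + y ^ 2) + α * s - 3 * r) := by
    refine mul_pos (by linarith) ?_
    nlinarith [mul_pos (show 0 < 2 * α - 3 by linarith) hN]
  have hx : 0 ≤ -2 * α * a * r + (a + c - 1) * r - s := by
    nlinarith
  have hy : 0 ≤ -2 * α * c * r + (a + c - 1) * r - s := by
    nlinarith [mul_nonneg (mul_nonneg (show 0 ≤ α by linarith) (sub_nonneg.mpr hca)) hr]
  have hz : 0 ≤ (α - 1) * s + (a + c - 1) * r := by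
    nlinarith
  nlinarith [mul_nonneg (sq_nonneg x) hx, mul_nonneg (sq_nonneg y) hy, mul_nonneg hr hz]

/-- For `λ < 0` the perturbed field `G = λ·id + F` of the almost-Hurwitz
family is Hurwitz (all eigenvalues of `JG(p)` have negative real part), admits the density
function `ρ = (x² + y² + R(z))^{-α}` for `α > max{3, (a+c-1-2k)/(2a), (3-a-c)/2}`
(i.e. `∇·(ρG) > 0` off the origin), and the origin is globally asymptotically stable. -/
theorem stmt17 (k : ℕ) (hk : 1 ≤ k) (a b c lam : ℝ) (hca : c ≤ a) (ha : a < 0)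
    (hlam : lam < 0)
    (coef : ℕ → ℝ) (hcoef : ∀ i ∈ Finset.Icc 1 k, 0 < coef i)
    (R : ℝ → ℝ) (hR : ∀ z, R z = ∑ i ∈ Finset.Icc 1 k, coef i * z ^ (2 * i))
    (F G : EuclideanSpace ℝ (Fin 3) → EuclideanSpace ℝ (Fin 3))
    (hF : ∀ p, F p = ![p 1 + (a * p 0 + b * p 1) * R (p 2),
                       -p 0 + (-b * p 0 + c * p 1) * R (p 2),
                       -(p 2) * R (p 2)])
    (hG : ∀ p, G p = lam • p + F p)
    (α : ℝ)
    (hα : max 3 (max ((a + c - 1 - 2 * (k : ℝ)) / (2 * a)) ((3 - a - c) / 2)) < α)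
    (ρ : EuclideanSpace ℝ (Fin 3) → ℝ)
    (hρ : ∀ p, ρ p = ((p 0) ^ 2 + (p 1) ^ 2 + R (p 2)) ^ (-α)) :
    (∀ p : EuclideanSpace ℝ (Fin 3), ∀ μ : ℂ,
      ((Matrix.of fun i j : Fin 3 =>
          fderiv ℝ (fun q => G q i) p (EuclideanSpace.single j 1)).map
        (fun r => (r : ℂ))).charpoly.IsRoot μ → μ.re < 0) ∧
    (∀ p : EuclideanSpace ℝ (Fin 3), p ≠ 0 →
      0 < fderiv ℝ ρ p (G p) +
          ρ p * ∑ i, fderiv ℝ (fun q => G q i) p (EuclideanSpace.single i 1)) ∧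
    (∀ p : EuclideanSpace ℝ (Fin 3),
      (∃ γ : ℝ → EuclideanSpace ℝ (Fin 3), γ 0 = p ∧
        ∀ t ∈ Set.Ici (0 : ℝ), HasDerivAt γ (G (γ t)) t) ∧
      (∀ γ : ℝ → EuclideanSpace ℝ (Fin 3), γ 0 = p →
        (∀ t ∈ Set.Ici (0 : ℝ), HasDerivAt γ (G (γ t)) t) →
        Tendsto γ atTop (𝓝 0))) := by
  have hRd : ∀ z, HasDerivAt R (deriv R z) z := fun z ↦
    (hasDerivAt_of_eq_even_sum hR z).differentiableAt.hasDerivAt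
  have hR0 := nonneg_of_eq_even_sum hcoef hR
  have hS₁ := two_mul_le_mul_deriv_of_eq_even_sum hcoef hR
  have hS₂ := mul_deriv_le_of_eq_even_sum hcoef hR
  have hG0 : ∀ q, G q 0 = lam * q 0 + (q 1 + (a * q 0 + b * q 1) * R (q 2)) := by simp [hG, hF]
  have hG1 : ∀ q, G q 1 = lam * q 1 + (-q 0 + (-b * q 0 + c * q 1) * R (q 2)) := by simp [hG, hF]
  have hG2 : ∀ q, G q 2 = lam * q 2 + -(q 2) * R (q 2) := by simp [hG, hF]
  have hP : ∀ (i : Fin 3) (p : EuclideanSpace ℝ (Fin 3)),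
      HasFDerivAt (fun q : EuclideanSpace ℝ (Fin 3) ↦ q i)
        (EuclideanSpace.proj i : EuclideanSpace ℝ (Fin 3) →L[ℝ] ℝ) p :=
    fun i _ ↦ (EuclideanSpace.proj i : EuclideanSpace ℝ (Fin 3) →L[ℝ] ℝ).hasFDerivAt
  have hPR : ∀ p : EuclideanSpace ℝ (Fin 3), HasFDerivAt (fun q ↦ R (q 2))
      (deriv R (p 2) • (EuclideanSpace.proj 2 : EuclideanSpace ℝ (Fin 3) →L[ℝ] ℝ)) p :=
    fun p ↦ (hRd (p 2)).comp_hasFDerivAt p (hP 2 p)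
  have hd0 : ∀ p v, fderiv ℝ (fun q ↦ G q 0) p v = lam * v 0 + (v 1 +
      ((a * p 0 + b * p 1) * (deriv R (p 2) * v 2) + R (p 2) * (a * v 0 + b * v 1))) := by
    intro p v
    rw [funext hG0, (((hP 0 p).const_mul lam).fun_add ((hP 1 p).fun_add
      ((((hP 0 p).const_mul a).fun_add ((hP 1 p).const_mul b)).fun_mul (hPR p)))).fderiv]
    simp
    ring
  have hd1 : ∀ p v, fderiv ℝ (fun q ↦ G q 1) p v = lam * v 1 + (-v 0 +
      ((-b * p 0 + c * p 1) * (deriv R (p 2) * v 2) + R (p 2) * (-b * v 0 + c * v 1))) := by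
    intro p v
    rw [funext hG1, (((hP 1 p).const_mul lam).fun_add ((hP 0 p).fun_neg.fun_add
      ((((hP 0 p).const_mul (-b)).fun_add ((hP 1 p).const_mul c)).fun_mul (hPR p)))).fderiv]
    simp
    ring
  have hd2 : ∀ p v, fderiv ℝ (fun q ↦ G q 2) p v = lam * v 2 +
      (-p 2 * (deriv R (p 2) * v 2) + R (p 2) * (-v 2)) := by
    intro p v
    rw [funext hG2, (((hP 2 p).const_mul lam).fun_add ((hP 2 p).fun_neg.fun_mul (hPR p))).fderiv]
    simp
  refine ⟨fun p μ hμ ↦ ?_, fun p hp ↦ ?_, fun p ↦ ?_⟩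
  · rw [Polynomial.IsRoot, Matrix.eval_charpoly, Matrix.det_fin_three] at hμ
    simp [hd0, hd1, hd2] at hμ
    have hμ' : (μ - (lam - p 2 * deriv R (p 2) - R (p 2) : ℝ)) *
        ((μ - (lam + R (p 2) * a : ℝ)) * (μ - (lam + R (p 2) * c : ℝ)) +
          ((1 + R (p 2) * b : ℝ) : ℂ) ^ 2) = 0 := by
      push_cast
      linear_combination hμ
    have hr := hR0 (p 2)
    have hs := hS₁ (p 2)
    rcases mul_eq_zero.mp hμ' with h | h
    · rw [sub_eq_zero.mp h, Complex.ofReal_re]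
      linarith
    · exact Complex.re_neg_of_sub_mul_sub_add_sq_eq_zero (by nlinarith) (by nlinarith) h
  · obtain ⟨hα₁, hα₂, hα₃⟩ : 3 < α ∧ α * (2 * a) < a + c - 1 - 2 * k ∧ 3 - a - c < α * 2 := by
      rw [max_lt_iff, max_lt_iff, div_lt_iff_of_neg (by linarith), div_lt_iff₀ two_pos] at hα
      exact hα
    have hN : 0 < (p 0) ^ 2 + (p 1) ^ 2 + R (p 2) := by
      have hr := hR0 (p 2)
      by_contra! h
      have h0 : p 0 = 0 := by nlinarith [sq_nonneg (p 0), sq_nonneg (p 1)]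
      have h1 : p 1 = 0 := by nlinarith [sq_nonneg (p 0), sq_nonneg (p 1)]
      have h2 : p 2 = 0 := by
        by_contra h2
        nlinarith [pos_of_eq_even_sum hk hcoef hR h2, sq_nonneg (p 0), sq_nonneg (p 1)]
      exact hp (by ext i; fin_cases i <;> simp [h0, h1, h2])
    have hρd := ((((hP 0 p).pow 2).fun_add ((hP 1 p).pow 2)).fun_add (hPR p)).rpow_const (p := -α)
      (Or.inl hN.ne')
    have hNpow : ((p 0) ^ 2 + (p 1) ^ 2 + R (p 2)) ^ (-α) =
        ((p 0) ^ 2 + (p 1) ^ 2 + R (p 2)) ^ (-α - 1) * ((p 0) ^ 2 + (p 1) ^ 2 + R (p 2)) := by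
      rw [← Real.rpow_add_one hN.ne', sub_add_cancel]
    rw [hρ p, funext hρ, hρd.fderiv, hNpow]
    have hpos := mul_pos (Real.rpow_pos_of_pos hN (-α - 1))
      (density_factor_pos hca hlam hα₁ hα₂ hα₃ (hR0 (p 2)) hN (hS₁ (p 2)) (hS₂ (p 2)))
    refine hpos.trans_eq ?_
    rw [Fin.sum_univ_three, hd0, hd1, hd2]
    simp [hG0, hG1, hG2]
    ring
  · have hin : ∀ x, inner ℝ x (G x) ≤ lam * ‖x‖ ^ 2 := by
      intro x
      rw [EuclideanSpace.norm_sq_eq, PiLp.inner_apply]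
      simp [Fin.sum_univ_three, hG0, hG1, hG2]
      have hr := hR0 (x 2)
      nlinarith [mul_nonneg hr (mul_nonneg (neg_pos.mpr ha).le (sq_nonneg (x 0))),
        mul_nonneg hr (mul_nonneg (neg_nonneg.mpr (hca.trans ha.le)) (sq_nonneg (x 1))),
        mul_nonneg hr (sq_nonneg (x 2))]
    have hsm : ContDiff ℝ 1 G := by
      have hRc : ContDiff ℝ 1 R := contDiff_of_eq_even_sum hR
      rw [contDiff_euclidean]
      intro i
      fin_cases i
      · exact (funext hG0 ▸ by fun_prop : ContDiff ℝ 1 fun q ↦ G q 0)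
      · exact (funext hG1 ▸ by fun_prop : ContDiff ℝ 1 fun q ↦ G q 1)
      · exact (funext hG2 ▸ by fun_prop : ContDiff ℝ 1 fun q ↦ G q 2)
    refine ⟨exists_forall_hasDerivAt_of_inner_nonpos hsm (fun x ↦ (hin x).trans ?_) p,
      fun γ _ hγ ↦ tendsto_zero_of_inner_le hlam hin hγ⟩
    exact mul_nonpos_of_nonpos_of_nonneg hlam.le (sq_nonneg _)
end

section
/- Let a₁,…,a₁₀, b₃, b₅, c₁₀ ∈ ℝ and define a₈ = 2/3 − a₃, a₁₀ = (3/2)(a₅ − a₇), b₁ = −3a₂ + a₄ + 3b₃, b₂ = 1 − a₃ − c₁₀/3, b₄ = 3 − a₁ − c₁₀, b₆ = (a₅ − a₇)/2, b₇ = 2a₆ + b₅, b₈ = 2a₂ − a₄ − a₉ − b₃, b₉ = −1/3 + a₃ + c₁₀/3, b₁₀ = 3a₆, c₅ = −2/3 + a₁/3 + a₃ + c₁₀/3, c₆ = 2a₄/3 − a₂ + b₃, c₇ = 4/3 − a₁/3 − a₃ − c₁₀/3, c₈ = (a₅ + a₇)/2, c₉ = a₆ + b₅. Define the polynomial vector field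 F = (P,Q,R) on ℝ³ by P = −x + A₂y + a₁x³ + 3a₂x²y + 3a₃xy² + a₄y³ + 3a₅x²z + 6a₆xyz + 3a₇y²z + 3a₈xz² + 3a₉yz² + a₁₀z³, Q = −A₂x − y + b₁x³ + 3b₂x²y + 3b₃xy² + b₄y³ + 3b₅x²z + 6b₆xyz + 3b₇y²z + 3b₈xz² + 3b₉yz² + b₁₀z³, R = z·(−1 + 3c₅x² + 6c₆xy + 3c₇y² + 3c₈xz + 3c₉yz + c₁₀z²), where A₂ ∈ ℝ is arbitrary. Then the polynomial identity −4·(xP + yQ + zR) + (x² + y² + z²)·(∇·F) = (1 + x² + y² + z²)·(x² + y² + z²) holds identically in (x,y,z); equivalently, for ρ(x,y,z) = (x² + y² + z²)^{−2} one has ∇·(ρF)(x,y,z) = (1 + x² + y² + z²)/(x² + y² + z²)² for all (x,y,z) ≠ 0. -/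
theorem deriv_eq_of_eq_cubic {f : ℝ → ℝ} (c₀ c₁ c₂ c₃ : ℝ)
    (hf : ∀ t, f t = c₀ + c₁ * t + c₂ * t ^ 2 + c₃ * t ^ 3) (t : ℝ) :
    deriv f t = c₁ + 2 * c₂ * t + 3 * c₃ * t ^ 2 := by
  rw [funext hf]
  have h := ((((hasDerivAt_id t).const_mul c₁).const_add c₀).add
    ((hasDerivAt_pow 2 t).const_mul c₂)).add ((hasDerivAt_pow 3 t).const_mul c₃)
  refine (h.congr_deriv ?_).deriv
  push_cast
  ring

theorem deriv_eq_of_eq_sq_add_zpow_neg_two {f : ℝ → ℝ} {s t : ℝ}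
    (hf : ∀ u, f u = (u ^ 2 + s) ^ (-2 : ℤ)) (ht : t ^ 2 + s ≠ 0) :
    deriv f t = -4 * t / (t ^ 2 + s) ^ 3 := by
  rw [funext hf]
  have h := (hasDerivAt_zpow (-2) (t ^ 2 + s) (Or.inl ht)).comp t
    ((hasDerivAt_pow 2 t).add_const s)
  refine (h.congr_deriv ?_).deriv
  rw [show (-2 - 1 : ℤ) = -(3 : ℕ) by norm_num, zpow_neg, zpow_natCast]
  field_simp
  push_cast
  ring

/-- For the cubic vector field `F = (P,Q,R)` with the prescribed
coefficient relations, the polynomial identity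
`-4(xP + yQ + zR) + (x² + y² + z²)(∇·F) = (1 + x² + y² + z²)(x² + y² + z²)` holds;
equivalently, for `ρ = (x² + y² + z²)^{-2}`,
`∇·(ρF) = (1 + x² + y² + z²)/(x² + y² + z²)²` away from the origin. -/
theorem stmt18 (A₂ a₁ a₂ a₃ a₄ a₅ a₆ a₇ a₈ a₉ a₁₀ b₁ b₂ b₃ b₄ b₅ b₆ b₇ b₈ b₉ b₁₀
      c₅ c₆ c₇ c₈ c₉ c₁₀ : ℝ)
    (ha₈ : a₈ = 2 / 3 - a₃) (ha₁₀ : a₁₀ = 3 / 2 * (a₅ - a₇))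
    (hb₁ : b₁ = -3 * a₂ + a₄ + 3 * b₃) (hb₂ : b₂ = 1 - a₃ - c₁₀ / 3)
    (hb₄ : b₄ = 3 - a₁ - c₁₀) (hb₆ : b₆ = (a₅ - a₇) / 2) (hb₇ : b₇ = 2 * a₆ + b₅)
    (hb₈ : b₈ = 2 * a₂ - a₄ - a₉ - b₃) (hb₉ : b₉ = -(1 / 3) + a₃ + c₁₀ / 3)
    (hb₁₀ : b₁₀ = 3 * a₆)
    (hc₅ : c₅ = -(2 / 3) + a₁ / 3 + a₃ + c₁₀ / 3) (hc₆ : c₆ = 2 * a₄ / 3 - a₂ + b₃)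
    (hc₇ : c₇ = 4 / 3 - a₁ / 3 - a₃ - c₁₀ / 3) (hc₈ : c₈ = (a₅ + a₇) / 2)
    (hc₉ : c₉ = a₆ + b₅)
    (P Q R : ℝ → ℝ → ℝ → ℝ)
    (hP : ∀ x y z, P x y z = -x + A₂ * y + a₁ * x ^ 3 + 3 * a₂ * x ^ 2 * y
      + 3 * a₃ * x * y ^ 2 + a₄ * y ^ 3 + 3 * a₅ * x ^ 2 * z + 6 * a₆ * x * y * z
      + 3 * a₇ * y ^ 2 * z + 3 * a₈ * x * z ^ 2 + 3 * a₉ * y * z ^ 2 + a₁₀ * z ^ 3)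
    (hQ : ∀ x y z, Q x y z = -A₂ * x - y + b₁ * x ^ 3 + 3 * b₂ * x ^ 2 * y
      + 3 * b₃ * x * y ^ 2 + b₄ * y ^ 3 + 3 * b₅ * x ^ 2 * z + 6 * b₆ * x * y * z
      + 3 * b₇ * y ^ 2 * z + 3 * b₈ * x * z ^ 2 + 3 * b₉ * y * z ^ 2 + b₁₀ * z ^ 3)
    (hRR : ∀ x y z, R x y z = z * (-1 + 3 * c₅ * x ^ 2 + 6 * c₆ * x * y
      + 3 * c₇ * y ^ 2 + 3 * c₈ * x * z + 3 * c₉ * y * z + c₁₀ * z ^ 2))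
    (divF : ℝ → ℝ → ℝ → ℝ)
    (hdivF : ∀ x y z, divF x y z = deriv (fun x' => P x' y z) x
      + deriv (fun y' => Q x y' z) y + deriv (fun z' => R x y z') z)
    (ρ : ℝ → ℝ → ℝ → ℝ)
    (hρ : ∀ x y z, ρ x y z = (x ^ 2 + y ^ 2 + z ^ 2) ^ (-2 : ℤ)) :
    (∀ x y z : ℝ,
      -4 * (x * P x y z + y * Q x y z + z * R x y z)
        + (x ^ 2 + y ^ 2 + z ^ 2) * divF x y z
      = (1 + x ^ 2 + y ^ 2 + z ^ 2) * (x ^ 2 + y ^ 2 + z ^ 2)) ∧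
    (∀ x y z : ℝ, ¬(x = 0 ∧ y = 0 ∧ z = 0) →
      deriv (fun x' => ρ x' y z) x * P x y z + deriv (fun y' => ρ x y' z) y * Q x y z
        + deriv (fun z' => ρ x y z') z * R x y z + ρ x y z * divF x y z
      = (1 + x ^ 2 + y ^ 2 + z ^ 2) / (x ^ 2 + y ^ 2 + z ^ 2) ^ 2) := by
  have key : ∀ x y z : ℝ,
      -4 * (x * P x y z + y * Q x y z + z * R x y z)
        + (x ^ 2 + y ^ 2 + z ^ 2) * divF x y z
      = (1 + x ^ 2 + y ^ 2 + z ^ 2) * (x ^ 2 + y ^ 2 + z ^ 2) := by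
    intro x y z
    have hPx := deriv_eq_of_eq_cubic (f := fun x' => P x' y z)
      (A₂ * y + a₄ * y ^ 3 + 3 * a₇ * y ^ 2 * z + 3 * a₉ * y * z ^ 2 + a₁₀ * z ^ 3)
      (-1 + 3 * a₃ * y ^ 2 + 6 * a₆ * y * z + 3 * a₈ * z ^ 2)
      (3 * a₂ * y + 3 * a₅ * z) a₁ (fun t => by rw [hP]; ring) x
    have hQy := deriv_eq_of_eq_cubic (f := fun y' => Q x y' z)
      (-A₂ * x + b₁ * x ^ 3 + 3 * b₅ * x ^ 2 * z + 3 * b₈ * x * z ^ 2 + b₁₀ * z ^ 3)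
      (-1 + 3 * b₂ * x ^ 2 + 6 * b₆ * x * z + 3 * b₉ * z ^ 2)
      (3 * b₃ * x + 3 * b₇ * z) b₄ (fun t => by rw [hQ]; ring) y
    have hRz := deriv_eq_of_eq_cubic (f := fun z' => R x y z')
      0 (-1 + 3 * c₅ * x ^ 2 + 6 * c₆ * x * y + 3 * c₇ * y ^ 2)
      (3 * c₈ * x + 3 * c₉ * y) c₁₀ (fun t => by rw [hRR]; ring) z
    rw [hdivF, hPx, hQy, hRz, hP, hQ, hRR]
    subst_vars
    ring
  refine ⟨key, fun x y z hne => ?_⟩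
  have hr : x ^ 2 + y ^ 2 + z ^ 2 ≠ 0 := fun h => hne
    ⟨by nlinarith only [h, sq_nonneg x, sq_nonneg y, sq_nonneg z],
      by nlinarith only [h, sq_nonneg x, sq_nonneg y, sq_nonneg z],
      by nlinarith only [h, sq_nonneg x, sq_nonneg y, sq_nonneg z]⟩
  have ex : x ^ 2 + (y ^ 2 + z ^ 2) = x ^ 2 + y ^ 2 + z ^ 2 := by ring
  have ey : y ^ 2 + (x ^ 2 + z ^ 2) = x ^ 2 + y ^ 2 + z ^ 2 := by ring
  have ez : z ^ 2 + (x ^ 2 + y ^ 2) = x ^ 2 + y ^ 2 + z ^ 2 := by ring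
  have hρx := deriv_eq_of_eq_sq_add_zpow_neg_two (f := fun x' => ρ x' y z)
    (s := y ^ 2 + z ^ 2) (t := x) (fun u => by rw [hρ, add_assoc]) (ex ▸ hr)
  have hρy := deriv_eq_of_eq_sq_add_zpow_neg_two (f := fun y' => ρ x y' z)
    (s := x ^ 2 + z ^ 2) (t := y) (fun u => by rw [hρ, add_comm (x ^ 2), add_assoc]) (ey ▸ hr)
  have hρz := deriv_eq_of_eq_sq_add_zpow_neg_two (f := fun z' => ρ x y z')
    (s := x ^ 2 + y ^ 2) (t := z) (fun u => by rw [hρ, add_comm (x ^ 2 + y ^ 2)]) (ez ▸ hr)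
  have hρ' : ρ x y z = 1 / (x ^ 2 + y ^ 2 + z ^ 2) ^ 2 := by
    rw [hρ, show (-2 : ℤ) = -(2 : ℕ) by norm_num, zpow_neg, zpow_natCast, one_div]
  rw [ex] at hρx
  rw [ey] at hρy
  rw [ez] at hρz
  rw [hρx, hρy, hρz, hρ']
  calc _ = (-4 * (x * P x y z + y * Q x y z + z * R x y z)
        + (x ^ 2 + y ^ 2 + z ^ 2) * divF x y z) / (x ^ 2 + y ^ 2 + z ^ 2) ^ 3 := by
        field_simp
        ring
    _ = _ := by
        rw [key]
        field_simp
end
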